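/- arXiv:2005.01640 — 3 statements merged into one kernel-verified Lean document; each statement's English description precedes it below -/
import Mathlib

section
/- Under Assumption 3.1 (compact metric space model), there exists a subjective equilibrium under beliefs of exogenous uncertainty (SEBEU) in mixed strategies: a joint mixed strategy γ = (γ^1,…,γ^N) ∈ Γ such that for every DM i ∈ [1,N] and every alternative mixed strategy γ̃^i ∈ Γ^i, E^{(γ^i, ζ_γ)}[J^i] ≤ E^{(γ̃^i, ζ_γ)}[J^i], where ζ_γ is the probability distribution on Y^{[0,T)} of the environment process induced endogenously by γ, but treated by each DM as an exogenous random sequence independent of all other primitive random variables. -/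
/-
STATEMENT 0.  Existence of a subjective equilibrium under beliefs of exogenous
uncertainty (SEBEU) in mixed strategies, for the compact metric space model of
Arslan–Yüksel under Assumption 3.1.

The model: `N` decision makers; DM `i` has state `x_tᶦ ∈ X i`, control `u_tᶦ ∈ U i`,
disturbance `w_tᶦ ∈ W i`; the environment variables `y_t ∈ Y` are generated by the
environment state `x_t⁰ ∈ X0` and the disturbance `ξ_t ∈ Ξ` through
`x_{t+1}ᶦ = f_tᶦ(x_tᶦ, u_tᶦ, y_t, w_tᶦ)`, `y_t = g_t(x_t⁰, x_t, u_t, ξ_t)`,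
`x_{t+1}⁰ = f_t⁰(x_t⁰, x_t, u_t, w_t⁰)`, with a given joint law `μ` for the initial
states and all disturbances.  Time runs over `ℕ`; this subsumes every horizon
`T ∈ ℕ ∪ {∞}` of the paper, since a finite-horizon model (including its terminal cost
`c_Tᶦ`) is recovered by taking stage costs that vanish beyond the horizon.

A pure strategy of DM `i` picks, at each time `t`, a continuous map from the information
space `I_tᶦ × Y^{[0,t)}` into `U i` lying in the prescribed compact set `Sset i t`
(Assumption 3.1(3)); mixed strategies are Borel probability measures on the pure strategy
space.  `envLaw μ f g f0 γ` is the distribution `ζ_γ` of the environment process induced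
endogenously by the joint mixed strategy `γ`, and `expSubjCost μ f c β i γ' ζ` is
`E^{(γ', ζ)}[Jᶦ]`, DM `i`'s expected cost when its strategy is drawn from `γ'` and the
environment sequence is treated as an independent exogenous random sequence with
distribution `ζ`.

The theorem: under Assumption 3.1 (compact metric spaces, continuous dynamics and costs,
compact strategy constraint sets, uniformly bounded stage costs and discount factors
uniformly below one) there exists a joint mixed strategy `γ` such that no DM can lower its
expected cost by a unilateral deviation when the endogenous environment distribution
`ζ_γ` is treated as exogenous.
-/

open MeasureTheory

namespace SEBEU0

/-- Borel σ-algebra on a space of continuous maps (with the compact-open topology, which is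
the topology of uniform convergence when the domain is compact). -/
noncomputable instance instMeasurableSpaceContinuousMap (A B : Type)
    [TopologicalSpace A] [TopologicalSpace B] : MeasurableSpace C(A, B) := borel _

/-- The information available to a DM at time `t`: its own state history `(x_k)_{k ≤ t}`,
its own control history `(u_k)_{k < t}` and the environment history `(y_k)_{k < t}`. -/
abbrev Hist (X U Y : Type) (t : ℕ) : Type :=
  (Fin (t + 1) → X) × (Fin t → U) × (Fin t → Y)

variable {N : ℕ}
variable (X0 : Type) (X : Fin N → Type) (U : Fin N → Type)
    (W0 : Type) (W : Fin N → Type) (Y : Type) (Ξ : Type)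
variable [∀ i, TopologicalSpace (X i)] [∀ i, TopologicalSpace (U i)] [TopologicalSpace Y]

/-- The set of pure strategies of DM `i`: at each time `t` a continuous map from the
information space into `U i`, constrained to lie in the prescribed set `Sset i t`. -/
abbrev Strat (Sset : ∀ i : Fin N, ∀ t : ℕ, Set C(Hist (X i) (U i) Y t, U i)) (i : Fin N) :
    Type :=
  ∀ t : ℕ, ↥(Sset i t)

/-- Joint history of the whole system at time `t`. -/
abbrev SysHist (t : ℕ) : Type :=
  (∀ i : Fin N, (Fin (t + 1) → X i) × (Fin t → U i)) × (Fin t → Y) × X0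

/-- Primitive random variables: the environment's initial state and disturbances
`ω⁰ = (x₀⁰, (w_t⁰), (ξ_t))` together with each DM's initial state and disturbances
`ωᶦ = (x₀ᶦ, (w_tᶦ))`. -/
abbrev Prim : Type := (X0 × (ℕ → W0) × (ℕ → Ξ)) × (∀ i : Fin N, X i × (ℕ → W i))

variable {X0 X U W0 W Y Ξ}
variable {Sset : ∀ i : Fin N, ∀ t : ℕ, Set C(Hist (X i) (U i) Y t, U i)}

/-- Closed-loop joint history under the pure strategy profile `s`, given a realization `ω`
of the primitive random variables: `u_tᶦ = s_tᶦ(I_tᶦ, Y_{t-1})`,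
`y_t = g_t(x_t⁰, x_t, u_t, ξ_t)`, `x_{t+1}⁰ = f_t⁰(x_t⁰, x_t, u_t, w_t⁰)`,
`x_{t+1}ᶦ = f_tᶦ(x_tᶦ, u_tᶦ, y_t, w_tᶦ)`. -/
noncomputable def sysHist
    (f : ∀ i : Fin N, ℕ → X i → U i → Y → W i → X i)
    (g : ℕ → X0 → (∀ i, X i) → (∀ i, U i) → Ξ → Y)
    (f0 : ℕ → X0 → (∀ i, X i) → (∀ i, U i) → W0 → X0)
    (s : ∀ i, Strat X U Y Sset i) (ω : Prim X0 X W0 W Ξ) :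
    (t : ℕ) → SysHist X0 X U Y t
  | 0 => (fun i => (fun _ => (ω.2 i).1, Fin.elim0), Fin.elim0, ω.1.1)
  | t + 1 =>
      let h := sysHist f g f0 s ω t
      let xcur : ∀ i, X i := fun i => (h.1 i).1 (Fin.last t)
      let u : ∀ i, U i := fun i => (s i t).val ⟨(h.1 i).1, (h.1 i).2, h.2.1⟩
      let y : Y := g t h.2.2 xcur u (ω.1.2.2 t)
      (fun i => (Fin.snoc (h.1 i).1 (f i t (xcur i) (u i) y ((ω.2 i).2 t)),
                 Fin.snoc (h.1 i).2 (u i)),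
       Fin.snoc h.2.1 y,
       f0 t h.2.2 xcur u (ω.1.2.1 t))

/-- The realized environment path `(y_t)_{t ∈ ℕ}` under the profile `s`. -/
noncomputable def yPath
    (f : ∀ i : Fin N, ℕ → X i → U i → Y → W i → X i)
    (g : ℕ → X0 → (∀ i, X i) → (∀ i, U i) → Ξ → Y)
    (f0 : ℕ → X0 → (∀ i, X i) → (∀ i, U i) → W0 → X0)
    (s : ∀ i, Strat X U Y Sset i) (ω : Prim X0 X W0 W Ξ) : ℕ → Y :=
  fun t => (sysHist f g f0 s ω (t + 1)).2.1 (Fin.last t)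

/-- DM `i`'s own state–control history when its strategy is `si` and the environment is a
fixed deterministic sequence `Z`. -/
noncomputable def subjHist (f : ∀ i : Fin N, ℕ → X i → U i → Y → W i → X i) (i : Fin N)
    (si : Strat X U Y Sset i) (Z : ℕ → Y) (ωi : X i × (ℕ → W i)) :
    (t : ℕ) → (Fin (t + 1) → X i) × (Fin t → U i)
  | 0 => (fun _ => ωi.1, Fin.elim0)
  | t + 1 =>
      let h := subjHist f i si Z ωi t
      let u : U i := (si t).val ⟨h.1, h.2, fun k : Fin t => Z k⟩
      (Fin.snoc h.1 (f i t (h.1 (Fin.last t)) u (Z t) (ωi.2 t)), Fin.snoc h.2 u)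

section Meas

variable [∀ i, MeasurableSpace (X i)] [∀ i, MeasurableSpace (U i)]
    [MeasurableSpace X0] [MeasurableSpace W0] [∀ i, MeasurableSpace (W i)]
    [MeasurableSpace Y] [MeasurableSpace Ξ]

/-- Subjective cost `J^i(s^i, Z)` of DM `i`: the expected total discounted cost when its
strategy is `si` and the environment sequence is fixed at `Z` (expectation over DM `i`'s
own primitive random variables, whose law is the corresponding marginal of `μ`). -/
noncomputable def subjCost (μ : Measure (Prim X0 X W0 W Ξ))
    (f : ∀ i : Fin N, ℕ → X i → U i → Y → W i → X i)
    (c : ∀ i : Fin N, ℕ → X i → U i → Y → ℝ) (β : Fin N → ℝ)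
    (i : Fin N) (si : Strat X U Y Sset i) (Z : ℕ → Y) : ℝ :=
  ∫ ω, (∑' t : ℕ, β i ^ t *
      c i t ((subjHist f i si Z (ω.2 i) t).1 (Fin.last t))
            ((subjHist f i si Z (ω.2 i) (t + 1)).2 (Fin.last t)) (Z t)) ∂μ

/-- Expected subjective cost `E^{(γ̃ᶦ, ζ)}[Jᶦ]` of DM `i` when its strategy is drawn from
the mixed strategy `γ̃ᶦ` and the environment sequence is an independent exogenous random
sequence with distribution `ζ`. -/
noncomputable def expSubjCost (μ : Measure (Prim X0 X W0 W Ξ))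
    (f : ∀ i : Fin N, ℕ → X i → U i → Y → W i → X i)
    (c : ∀ i : Fin N, ℕ → X i → U i → Y → ℝ) (β : Fin N → ℝ)
    (i : Fin N) (γi : ProbabilityMeasure (Strat X U Y Sset i)) (ζ : Measure (ℕ → Y)) : ℝ :=
  ∫ si, ∫ Z, subjCost μ f c β i si Z ∂ζ ∂(γi : Measure (Strat X U Y Sset i))

/-- The distribution `ζ_γ ∈ P(Y^ℕ)` of the environment process generated endogenously by
the joint mixed strategy `γ`: the mixture over `s ∼ γ` of the closed-loop environment laws
`ζ_s`. -/
noncomputable def envLaw (μ : Measure (Prim X0 X W0 W Ξ))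
    (f : ∀ i : Fin N, ℕ → X i → U i → Y → W i → X i)
    (g : ℕ → X0 → (∀ i, X i) → (∀ i, U i) → Ξ → Y)
    (f0 : ℕ → X0 → (∀ i, X i) → (∀ i, U i) → W0 → X0)
    (γ : ∀ i, ProbabilityMeasure (Strat X U Y Sset i)) : Measure (ℕ → Y) :=
  (Measure.pi fun i => (γ i : Measure (Strat X U Y Sset i))).bind
    (fun s => Measure.map (yPath f g f0 s) μ)

end Meas

end SEBEU0

section NoRetraction

variable {E : Type*} [NormedAddCommGroup E] [NormedSpace ℝ E]

/-- A perturbation of the identity of norm less than one is injective. -/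
theorem injective_one_add_of_norm_lt_one {A : E →L[ℝ] E} (hA : ‖A‖ < 1) :
    Function.Injective (1 + A : E →L[ℝ] E) := by
  rw [injective_iff_map_eq_zero]
  intro x hx
  by_contra hne
  have h1 : x = -(A x) := by
    have : x + A x = 0 := by simpa using hx
    exact eq_neg_of_add_eq_zero_left this
  have h2 : ‖x‖ ≤ ‖A‖ * ‖x‖ := by
    conv_lhs => rw [h1, norm_neg]
    exact A.le_opNorm x
  have h3 : 0 < ‖x‖ := norm_pos_iff.mpr hne
  nlinarith

theorem det_one_add_pos_of_norm_lt_one [FiniteDimensional ℝ E] {A : E →L[ℝ] E} (hA : ‖A‖ < 1) :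
    0 < (1 + A : E →L[ℝ] E).det := by
  have hne : ∀ s ∈ Set.Icc (0 : ℝ) 1, (1 + s • A : E →L[ℝ] E).det ≠ 0 := by
    intro s hs h0
    have hlt : ‖s • A‖ < 1 := by
      rw [norm_smul, Real.norm_of_nonneg hs.1]
      nlinarith [norm_nonneg A, hs.1, hs.2]
    have hker := LinearMap.bot_lt_ker_of_det_eq_zero
      (f := ((1 + s • A : E →L[ℝ] E) : E →ₗ[ℝ] E)) h0
    exact hker.ne' (LinearMap.ker_eq_bot.mpr (injective_one_add_of_norm_lt_one hlt))
  have hcont : Continuous fun s : ℝ => (1 + s • A : E →L[ℝ] E).det :=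
    ContinuousLinearMap.continuous_det.comp (by fun_prop)
  by_contra hle
  push Not at hle
  have h0 : (1 + (0 : ℝ) • A : E →L[ℝ] E).det = 1 := by
    rw [zero_smul, add_zero]
    exact LinearMap.det_id
  obtain ⟨s, hs, hs0⟩ := intermediate_value_Icc' (zero_le_one (α := ℝ)) hcont.continuousOn
    (show (0 : ℝ) ∈ Set.Icc _ _ from ⟨by simpa using hle, by rw [h0]; exact zero_le_one⟩)
  exact hne s hs hs0

/-- The determinant of `1 + A` is recovered from the determinants of `1 + v k • A` by Lagrange
interpolation, with weights independent of `A`. -/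
theorem det_one_add_eq_sum_interpolation [FiniteDimensional ℝ E] {v : ℕ → ℝ}
    (hv : Function.Injective v) (A : E →L[ℝ] E) :
    (1 + A : E →L[ℝ] E).det = ∑ k ∈ Finset.range (Module.finrank ℝ E + 1),
      (1 + v k • A : E →L[ℝ] E).det *
        (Lagrange.basis (Finset.range (Module.finrank ℝ E + 1)) v k).eval 1 := by
  set n := Module.finrank ℝ E with hn
  let b := Module.finBasis ℝ E
  set M := LinearMap.toMatrix b b (A : E →ₗ[ℝ] E) with hM
  set p : Polynomial ℝ := ((Polynomial.X : Polynomial ℝ) • M.map Polynomial.C +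
    (1 : Matrix (Fin n) (Fin n) ℝ).map Polynomial.C).det with hp
  have hdeg : p.degree < (Finset.range (n + 1)).card := by
    have := Polynomial.natDegree_det_X_add_C_le M 1
    rw [Fintype.card_fin] at this
    rw [Finset.card_range]
    exact lt_of_le_of_lt (Polynomial.degree_le_of_natDegree_le this)
      (by exact_mod_cast Nat.lt_succ_self n)
  have heval : ∀ t : ℝ, p.eval t = (1 + t • A : E →L[ℝ] E).det := by
    intro t
    have h1 : (1 + t • A : E →L[ℝ] E).det = (1 + t • M).det := by
      change LinearMap.det _ = _
      rw [← LinearMap.det_toMatrix b]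
      congr 1
      have : ((1 + t • A : E →L[ℝ] E) : E →ₗ[ℝ] E) = LinearMap.id + t • (A : E →ₗ[ℝ] E) := by
        ext x; simp
      rw [this, map_add, map_smul, LinearMap.toMatrix_id]
    rw [h1, hp, ← Polynomial.coe_evalRingHom, RingHom.map_det]
    congr 1
    ext i j
    rcases eq_or_ne i j with rfl | hij
    · simp [add_comm, mul_comm t]
    · simp [hij, mul_comm t]
  have h := Lagrange.eq_interpolate hv.injOn hdeg
  have h1 := congrArg (Polynomial.eval 1) h
  rw [heval, one_smul, Lagrange.interpolate_apply, Polynomial.eval_finsetSum] at h1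
  simpa [heval] using h1


/-- For small `t`, pushing the unit ball towards the image of a `C¹` retraction onto the sphere
gives a bijection of the ball, so the Jacobian determinant integrates to the volume. -/
theorem integral_det_eq_volume_ball {E : Type*} [NormedAddCommGroup E] [InnerProductSpace ℝ E]
    [FiniteDimensional ℝ E] [MeasurableSpace E] [BorelSpace E] {r : E → E}
    (hr : ∀ x ∈ Metric.closedBall (0 : E) 1, ContDiffAt ℝ 1 r x)
    (hn : ∀ x ∈ Metric.closedBall (0 : E) 1, ‖r x‖ = 1)
    (hs : ∀ x : E, ‖x‖ = 1 → r x = x) {C t : ℝ}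
    (hC : ∀ x ∈ Metric.closedBall (0 : E) 1, ‖fderiv ℝ r x - 1‖ ≤ C)
    (ht0 : 0 < t) (htC : t * C < 1) (ht1 : t < 1) :
    ∫ x in Metric.ball (0 : E) 1, (1 + t • (fderiv ℝ r x - 1) : E →L[ℝ] E).det =
      volume.real (Metric.ball (0 : E) 1) := by
  set B := Metric.ball (0 : E) 1 with hB
  set K := Metric.closedBall (0 : E) 1 with hK
  have hBK : B ⊆ K := Metric.ball_subset_closedBall
  let A : E → E →L[ℝ] E := fun x => fderiv ℝ r x - 1
  let h : E → E := fun x => x + t • (r x - x)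
  have hgd : ∀ x ∈ K, HasStrictFDerivAt (fun x => r x - x) (A x) x := fun x hx =>
    ((hr x hx).hasStrictFDerivAt one_ne_zero).sub (hasStrictFDerivAt_id x)
  have hhd : ∀ x ∈ K, HasStrictFDerivAt h (1 + t • A x) x := fun x hx =>
    (hasStrictFDerivAt_id x).add ((hgd x hx).const_smul t)
  have hAt : ∀ x ∈ K, ‖t • A x‖ < 1 := by
    intro x hx
    rw [norm_smul, Real.norm_of_nonneg ht0.le]
    exact lt_of_le_of_lt (mul_le_mul_of_nonneg_left (hC x hx) ht0.le) htC
  have hinj : Set.InjOn h K := by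
    intro x hx y hy hxy
    have hl := Convex.norm_image_sub_le_of_norm_hasFDerivWithin_le
      (fun z hz => (hgd z hz).hasFDerivAt.hasFDerivWithinAt) hC (convex_closedBall 0 1) hx hy
    by_contra hne
    have h3 : 0 < ‖y - x‖ := norm_pos_iff.mpr (sub_ne_zero.mpr (Ne.symm hne))
    have h4 : y - x = -(t • ((r y - y) - (r x - x))) := by
      have : x + t • (r x - x) = y + t • (r y - y) := hxy
      rw [smul_sub t (r y - y), ← sub_eq_zero]
      linear_combination (norm := module) -this
    have h5 : ‖y - x‖ ≤ t * (C * ‖y - x‖) := by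
      conv_lhs => rw [h4, norm_neg, norm_smul, Real.norm_of_nonneg ht0.le]
      exact mul_le_mul_of_nonneg_left hl ht0.le
    nlinarith
  have hmaps : ∀ x ∈ B, h x ∈ B := by
    intro x hx
    have hx' : ‖x‖ < 1 := by simpa [hB] using hx
    have h1 : h x = (1 - t) • x + t • r x := by simp only [h]; module
    rw [hB, mem_ball_zero_iff, h1]
    calc ‖(1 - t) • x + t • r x‖ ≤ ‖(1 - t) • x‖ + ‖t • r x‖ := norm_add_le _ _
      _ = (1 - t) * ‖x‖ + t := by
        rw [norm_smul, norm_smul, hn x (hBK hx), Real.norm_of_nonneg ht0.le,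
          Real.norm_of_nonneg (by linarith)]; ring
      _ < 1 := by nlinarith
  have hopen : IsOpen (h '' B) := by
    rw [isOpen_iff_mem_nhds]
    rintro _ ⟨x, hx, rfl⟩
    have hrange : ((1 + t • A x : E →L[ℝ] E) : E →ₗ[ℝ] E).range = ⊤ :=
      LinearMap.range_eq_top.mpr (LinearMap.surjective_of_injective
        (f := ((1 + t • A x : E →L[ℝ] E) : E →ₗ[ℝ] E))
        (injective_one_add_of_norm_lt_one (hAt x (hBK hx))))
    rw [← (hhd x (hBK hx)).map_nhds_eq_of_surj hrange]
    exact Filter.image_mem_map (Metric.isOpen_ball.mem_nhds hx)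
  have himg : h '' B = B := by
    refine Set.Subset.antisymm (Set.image_subset_iff.mpr hmaps) ?_
    refine (convex_ball (0 : E) 1).isPreconnected.subset_of_closure_inter_subset hopen ?_ ?_
    · have h0 : (0 : E) ∈ B := Metric.mem_ball_self one_pos
      exact ⟨h 0, hmaps 0 h0, Set.mem_image_of_mem h h0⟩
    · rintro y ⟨hy, hyB⟩
      have hcpt : IsCompact (h '' K) := (isCompact_closedBall 0 1).image_of_continuousOn
        fun x hx => (hhd x hx).continuousAt.continuousWithinAt
      obtain ⟨x, hx, rfl⟩ := closure_minimal (Set.image_mono hBK) hcpt.isClosed hy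
      rcases lt_or_eq_of_le (mem_closedBall_zero_iff.mp hx) with hlt | heq
      · exact ⟨x, mem_ball_zero_iff.mpr hlt, rfl⟩
      · have : h x = x := by simp [h, hs x heq]
        rw [this] at hyB
        exact absurd (mem_ball_zero_iff.mp hyB) (by rw [heq]; exact lt_irrefl _)
  have hcov := integral_image_eq_integral_abs_det_fderiv_smul volume
    Metric.isOpen_ball.measurableSet (s := B)
    (fun x hx => (hhd x (hBK hx)).hasFDerivAt.hasFDerivWithinAt) (hinj.mono hBK)
    (fun _ => (1 : ℝ))
  rw [himg] at hcov
  rw [setIntegral_congr_fun Metric.isOpen_ball.measurableSet (g := fun x =>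
    |(1 + t • A x : E →L[ℝ] E).det| • (1 : ℝ)) ?_, ← hcov]
  · simp
  · intro x hx
    simp only [smul_eq_mul, mul_one]
    rw [abs_of_pos (det_one_add_pos_of_norm_lt_one (hAt x (hBK hx)))]

/-- There is no `C¹` retraction of the closed unit ball onto the unit sphere. -/
theorem not_C1_retraction_sphere {E : Type*} [NormedAddCommGroup E] [InnerProductSpace ℝ E]
    [FiniteDimensional ℝ E] {r : E → E}
    (hr : ∀ x ∈ Metric.closedBall (0 : E) 1, ContDiffAt ℝ 1 r x)
    (hn : ∀ x ∈ Metric.closedBall (0 : E) 1, ‖r x‖ = 1)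
    (hs : ∀ x : E, ‖x‖ = 1 → r x = x) : False := by
  borelize E
  have hBK : Metric.ball (0 : E) 1 ⊆ Metric.closedBall (0 : E) 1 := Metric.ball_subset_closedBall
  have hAc : ContinuousOn (fun x => fderiv ℝ r x - 1) (Metric.closedBall (0 : E) 1) := fun x hx =>
    (((hr x hx).fderiv_right (m := 0) (by simp)).continuousAt.sub
      continuousAt_const).continuousWithinAt
  obtain ⟨C, hC⟩ := (isCompact_closedBall (0 : E) 1).exists_bound_of_continuousOn hAc
  have hC0 : 0 ≤ C := (norm_nonneg _).trans (hC 0 (Metric.mem_closedBall_self zero_le_one))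
  let v : ℕ → ℝ := fun k => 1 / (C + 2 + k)
  have hpos : ∀ k : ℕ, 0 < C + 2 + (k : ℝ) := fun k => by positivity
  have hv : Function.Injective v := by
    intro j k hjk
    have := (div_eq_div_iff (hpos j).ne' (hpos k).ne').mp hjk
    have : (j : ℝ) = k := by linarith
    exact_mod_cast this
  set S := Finset.range (Module.finrank ℝ E + 1) with hS
  have hint : ∀ t : ℝ, IntegrableOn
      (fun x => (1 + t • (fderiv ℝ r x - 1) : E →L[ℝ] E).det) (Metric.ball (0 : E) 1) := by
    intro t
    refine IntegrableOn.mono_set (ContinuousOn.integrableOn_compact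
      (isCompact_closedBall (0 : E) 1) ?_) hBK
    exact ContinuousLinearMap.continuous_det.comp_continuousOn
      (continuousOn_const.add (hAc.const_smul t))
  have hdet0 : ∀ x ∈ Metric.ball (0 : E) 1,
      (1 + (fderiv ℝ r x - 1) : E →L[ℝ] E).det = 0 := by
    intro x hx
    rw [add_sub_cancel]
    by_contra hne
    have hd := ((hr x (hBK hx)).differentiableAt one_ne_zero).hasFDerivAt
    have hconst : (fun y => inner ℝ (r y) (r y)) =ᶠ[nhds x] fun _ => (1 : ℝ) := by
      filter_upwards [Metric.isOpen_ball.mem_nhds hx] with y hy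
      rw [real_inner_self_eq_norm_sq, hn y (hBK hy), one_pow]
    have hi := ((hd.inner ℝ hd).congr_of_eventuallyEq hconst.symm).unique (hasFDerivAt_const _ x)
    obtain ⟨w, hw⟩ := (LinearMap.equivOfDetNeZero _ hne).surjective (r x)
    have hw' : fderiv ℝ r x w = r x := hw
    have := DFunLike.congr_fun hi w
    simp [hw', hn x (hBK hx)] at this
  have hkey : ∫ x in Metric.ball (0 : E) 1, (1 + (fderiv ℝ r x - 1) : E →L[ℝ] E).det =
      volume.real (Metric.ball (0 : E) 1) := by
    calc _ = ∫ x in Metric.ball (0 : E) 1, ∑ k ∈ S,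
          (1 + v k • (fderiv ℝ r x - 1) : E →L[ℝ] E).det * (Lagrange.basis S v k).eval 1 := by
          exact integral_congr_ae (Filter.Eventually.of_forall fun x =>
            det_one_add_eq_sum_interpolation hv _)
      _ = ∑ k ∈ S, volume.real (Metric.ball (0 : E) 1) * (Lagrange.basis S v k).eval 1 := by
          rw [integral_finsetSum _ fun k _ => (hint (v k)).mul_const _]
          refine Finset.sum_congr rfl fun k _ => ?_
          rw [integral_mul_const, integral_det_eq_volume_ball hr hn hs hC]
          · exact one_div_pos.mpr (hpos k)
          · rw [div_mul_eq_mul_div, one_mul, div_lt_one (hpos k)]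
            linarith [(Nat.cast_nonneg k : (0 : ℝ) ≤ k)]
          · rw [div_lt_one (hpos k)]
            linarith [(Nat.cast_nonneg k : (0 : ℝ) ≤ k)]
      _ = _ := by
          rw [← Finset.mul_sum, ← Polynomial.eval_finsetSum,
            Lagrange.sum_basis hv.injOn (by simp [hS]), Polynomial.eval_one, mul_one]
  rw [setIntegral_congr_fun Metric.isOpen_ball.measurableSet hdet0, integral_zero] at hkey
  have := Metric.measure_ball_pos volume (0 : E) one_pos
  rw [eq_comm, measureReal_eq_zero_iff Metric.isBounded_ball.measure_lt_top.ne] at hkey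
  exact this.ne' hkey

end NoRetraction

section Brouwer

variable {E : Type*} [NormedAddCommGroup E] [InnerProductSpace ℝ E]

/-- The metric projection onto a complete convex set is continuous and characterised by an obtuse
angle condition. -/
theorem exists_continuous_projection {K : Set E} (hne : K.Nonempty) (hK : IsComplete K)
    (hconv : Convex ℝ K) : ∃ P : E → E, Continuous P ∧ (∀ u, P u ∈ K) ∧
      ∀ u, ∀ w ∈ K, inner ℝ (u - P u) (w - P u) ≤ 0 := by
  choose P hPK hP using fun u => exists_norm_eq_iInf_of_complete_convex hne hK hconv u
  have hPle : ∀ u, ∀ w ∈ K, inner ℝ (u - P u) (w - P u) ≤ 0 := fun u =>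
    (norm_eq_iInf_iff_real_inner_le_zero hconv (hPK u)).mp (hP u)
  refine ⟨P, (LipschitzWith.of_dist_le_mul (K := 1) fun u v => ?_).continuous, hPK, hPle⟩
  rw [NNReal.coe_one, one_mul, dist_eq_norm, dist_eq_norm]
  have h1 := hPle u (P v) (hPK v)
  have h2 := hPle v (P u) (hPK u)
  have h3 : ‖P u - P v‖ ^ 2 =
      inner ℝ (u - v) (P u - P v) + inner ℝ (u - P u) (P v - P u) +
        inner ℝ (v - P v) (P u - P v) := by
    rw [← real_inner_self_eq_norm_sq, ← neg_sub (P u) (P v), inner_neg_right]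
    simp only [inner_sub_left]
    ring
  have h4 := real_inner_le_norm (u - v) (P u - P v)
  by_contra! hlt
  nlinarith [norm_nonneg (u - v)]

variable [FiniteDimensional ℝ E]

/-- **Brouwer's fixed point theorem** for `C¹` maps of the closed unit ball. -/
theorem exists_fixedPoint_of_contDiff {f : E → E} (hf : ContDiff ℝ 1 f)
    (hmaps : ∀ x, ‖f x‖ ≤ 1) : ∃ x, f x = x := by
  by_contra! hne
  let u : E → E := fun x => x - f x
  let D : E → ℝ := fun x => inner ℝ x (u x) ^ 2 + ‖u x‖ ^ 2 * (1 - ‖x‖ ^ 2)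
  let l : E → ℝ := fun x => (-inner ℝ x (u x) + √(D x)) / ‖u x‖ ^ 2
  have hu : ContDiff ℝ 1 u := contDiff_id.sub hf
  have hu0 : ∀ x, 0 < ‖u x‖ := fun x => norm_pos_iff.mpr (sub_ne_zero.mpr (hne x).symm)
  have hinner : ContDiff ℝ 1 fun x => inner ℝ x (u x) := contDiff_id.inner ℝ hu
  have hD : ContDiff ℝ 1 D :=
    (hinner.pow 2).add ((hu.norm_sq ℝ).mul (contDiff_const.sub (contDiff_id.norm_sq ℝ)))
  have hsphere : ∀ x : E, ‖x‖ = 1 → 0 < inner ℝ x (u x) := by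
    intro x hx
    have h1 : ‖u x‖ ^ 2 = 2 * inner ℝ x (u x) - 1 + ‖f x‖ ^ 2 := by
      simp only [u]
      rw [norm_sub_sq_real, inner_sub_right, real_inner_self_eq_norm_sq, hx]; ring
    have h2 : ‖f x‖ ^ 2 ≤ 1 := by nlinarith [hmaps x, norm_nonneg (f x)]
    nlinarith [pow_pos (hu0 x) 2]
  have hDpos : ∀ x ∈ Metric.closedBall (0 : E) 1, 0 < D x := by
    intro x hx
    rcases lt_or_eq_of_le (mem_closedBall_zero_iff.mp hx) with hlt | heq
    · have : 0 < 1 - ‖x‖ ^ 2 := by nlinarith [norm_nonneg x]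
      have := mul_pos (pow_pos (hu0 x) 2) this
      simp only [D]; positivity
    · have := hsphere x heq
      simp only [D, heq]; norm_num; positivity
  refine not_C1_retraction_sphere (r := fun x => x + l x • u x) ?_ ?_ ?_
  · intro x hx
    refine contDiffAt_id.add (ContDiffAt.smul ?_ hu.contDiffAt)
    exact (hinner.neg.contDiffAt.add (hD.contDiffAt.sqrt (hDpos x hx).ne')).div
      (hu.norm_sq ℝ).contDiffAt (pow_pos (hu0 x) 2).ne'
  · intro x hx
    have h1 : ‖u x‖ ^ 2 * l x = -inner ℝ x (u x) + √(D x) :=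
      mul_div_cancel₀ _ (pow_pos (hu0 x) 2).ne'
    have h2 : √(D x) ^ 2 = inner ℝ x (u x) ^ 2 + ‖u x‖ ^ 2 * (1 - ‖x‖ ^ 2) :=
      Real.sq_sqrt (hDpos x hx).le
    have h3 : ‖x + l x • u x‖ ^ 2 = 1 := by
      rw [norm_add_sq_real, inner_smul_right, norm_smul, mul_pow, Real.norm_eq_abs, sq_abs]
      have h4 : ‖u x‖ ^ 2 * (‖x‖ ^ 2 + 2 * (l x * inner ℝ x (u x)) + l x ^ 2 * ‖u x‖ ^ 2) =
          ‖u x‖ ^ 2 * 1 := by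
        linear_combination (‖u x‖ ^ 2 * l x + inner ℝ x (u x) + √(D x)) * h1 + h2
      exact mul_left_cancel₀ (pow_pos (hu0 x) 2).ne' h4
    exact (pow_eq_one_iff_of_nonneg (norm_nonneg _) two_ne_zero).mp h3
  · intro x hx
    have h1 : √(D x) = inner ℝ x (u x) := by
      simp only [D, hx]
      norm_num
      exact Real.sqrt_sq (hsphere x hx).le
    simp [l, h1]

/-- **Brouwer's fixed point theorem** for a continuous map with values in the unit ball. -/
theorem exists_fixedPoint_of_norm_le_one {f : E → E} (hf : Continuous f)
    (hmaps : ∀ x, ‖f x‖ ≤ 1) : ∃ x, f x = x := by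
  obtain ⟨x₀, -, hx₀⟩ := (isCompact_closedBall (0 : E) 1).exists_isMinOn
    ⟨0, Metric.mem_closedBall_self zero_le_one⟩
    (f := fun x => ‖f x - x‖) (by fun_prop)
  by_contra! hne
  have hε : 0 < ‖f x₀ - x₀‖ := norm_pos_iff.mpr (sub_ne_zero.mpr (hne x₀))
  obtain ⟨p, hp⟩ := exists_contMDiffMap_forall_mem_convex_of_local_const
    (modelWithCornersSelf ℝ E) (n := 1)
    (t := fun x => Metric.ball (f x) ‖f x₀ - x₀‖ ∩ Metric.closedBall 0 1)
    (fun x => (convex_ball _ _).inter (convex_closedBall _ _)) (fun x => ⟨f x, by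
      filter_upwards [hf.continuousAt.eventually (Metric.ball_mem_nhds (f x) hε)] with y hy
      exact ⟨Metric.mem_ball_comm.mp hy, mem_closedBall_zero_iff.mpr (hmaps x)⟩⟩)
  obtain ⟨x, hx⟩ := exists_fixedPoint_of_contDiff (f := p) p.contMDiff.contDiff
    fun x => mem_closedBall_zero_iff.mp (hp x).2
  have h1 := (hp x).1
  rw [hx, Metric.mem_ball, dist_comm, dist_eq_norm] at h1
  exact absurd (hx₀ (show x ∈ Metric.closedBall (0 : E) 1 from hx ▸ (hp x).2)) (not_le.mpr h1)

/-- A bounded continuous self-map of a Euclidean space has a fixed point. -/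
theorem exists_fixedPoint_of_bounded {f : E → E} (hf : Continuous f) {R : ℝ}
    (hmaps : ∀ x, ‖f x‖ ≤ R) : ∃ x, f x = x := by
  have hR : 0 < R + 1 := by linarith [(norm_nonneg _).trans (hmaps 0)]
  obtain ⟨x, hx⟩ := exists_fixedPoint_of_norm_le_one
    (f := fun x => (R + 1)⁻¹ • f ((R + 1) • x)) (by fun_prop) fun x => by
      rw [norm_smul, norm_inv, Real.norm_of_nonneg hR.le, inv_mul_le_iff₀ hR]
      linarith [hmaps ((R + 1) • x)]
  refine ⟨(R + 1) • x, ?_⟩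
  conv_rhs => rw [← hx]
  rw [smul_inv_smul₀ hR.ne']

/-- **Hartman–Stampacchia theorem**: a continuous vector field on a compact convex set admits a
solution of the associated variational inequality. -/
theorem exists_variational_inequality {K : Set E} (hne : K.Nonempty) (hK : IsCompact K)
    (hconv : Convex ℝ K) {G : E → E} (hG : Continuous G) :
    ∃ x ∈ K, ∀ y ∈ K, 0 ≤ inner ℝ (G x) (y - x) := by
  obtain ⟨P, hPc, hPK, hP⟩ := exists_continuous_projection hne hK.isComplete hconv
  obtain ⟨R, hR⟩ := hK.isBounded.exists_norm_le
  obtain ⟨x, hx⟩ := exists_fixedPoint_of_bounded (f := fun x => P (x - G x))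
    (hPc.comp (continuous_id.sub hG)) fun x => hR _ (hPK _)
  refine ⟨x, hx ▸ hPK _, fun y hy => ?_⟩
  have := hP (x - G x) y hy
  rw [hx, sub_sub_cancel_left, inner_neg_left] at this
  linarith

end Brouwer

section Game

/-- Equilibrium of a finite game in which each player treats the joint distribution of play as
exogenous. -/
theorem exists_equilibrium_finite {ι κ : Type*} [Fintype ι] [DecidableEq ι] [Fintype κ]
    [Nonempty κ] (φ : ι → κ → (ι → κ) → ℝ) :
    ∃ x : ι → κ → ℝ, (∀ i, x i ∈ stdSimplex ℝ κ) ∧ ∀ i a,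
      ∑ b, x i b * ∑ d : ι → κ, (∏ j, x j (d j)) * φ i b d ≤
        ∑ d : ι → κ, (∏ j, x j (d j)) * φ i a d := by
  classical
  let e : EuclideanSpace ℝ (ι × κ) → ι → κ → ℝ := fun x i a => x (i, a)
  have he : Continuous e := by fun_prop
  let K : Set (EuclideanSpace ℝ (ι × κ)) := {x | ∀ i, e x i ∈ stdSimplex ℝ κ}
  have hKne : K.Nonempty :=
    ⟨WithLp.toLp 2 fun p => Pi.single (M := fun _ => ℝ) (Classical.arbitrary κ) 1 p.2, fun i =>
      single_mem_stdSimplex ℝ (Classical.arbitrary κ)⟩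
  have hKclosed : IsClosed K := by
    have : K = e ⁻¹' Set.univ.pi fun _ => stdSimplex ℝ κ := by ext; simp [K]
    rw [this]
    exact (isClosed_set_pi fun _ _ => isClosed_stdSimplex ℝ κ).preimage he
  have hKbdd : Bornology.IsBounded K := by
    refine (Metric.isBounded_iff_subset_closedBall 0).mpr ⟨√(Fintype.card (ι × κ)), fun x hx => ?_⟩
    rw [mem_closedBall_zero_iff, EuclideanSpace.norm_eq]
    refine Real.sqrt_le_sqrt ?_
    refine (Finset.sum_le_card_nsmul _ _ 1 fun p _ => ?_).trans (by simp)
    have h0 := (hx p.1).1 p.2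
    have h1 : x p ≤ 1 := (mem_Icc_of_mem_stdSimplex (hx p.1) p.2).2
    rw [Real.norm_eq_abs, sq_abs]
    exact pow_le_one₀ h0 h1
  have hKconv : Convex ℝ K := by
    intro x hx y hy a b ha hb hab i
    exact convex_stdSimplex ℝ κ (hx i) (hy i) ha hb hab
  let G : EuclideanSpace ℝ (ι × κ) → EuclideanSpace ℝ (ι × κ) := fun x =>
    WithLp.toLp 2 fun p => ∑ d : ι → κ, (∏ j, x (j, d j)) * φ p.1 p.2 d
  have hG : Continuous G := by fun_prop
  obtain ⟨x, hx, hvi⟩ := exists_variational_inequality hKne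
    (Metric.isCompact_of_isClosed_isBounded hKclosed hKbdd) hKconv hG
  refine ⟨e x, hx, fun i a => ?_⟩
  let y : EuclideanSpace ℝ (ι × κ) :=
    WithLp.toLp 2 fun p => if p.1 = i then Pi.single (M := fun _ => ℝ) a 1 p.2 else x p
  have hy : y ∈ K := by
    intro j
    by_cases hj : j = i
    · have : e y j = Pi.single a 1 := by ext b; simp [e, y, hj]
      rw [this]; exact single_mem_stdSimplex ℝ a
    · have : e y j = e x j := by ext b; simp [e, y, hj]
      rw [this]; exact hx j
  have h := hvi y hy
  rw [PiLp.inner_apply, Fintype.sum_prod_type, Finset.sum_eq_single i] at h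
  · simp only [G, y, RCLike.inner_apply, conj_trivial, PiLp.sub_apply, if_true, sub_mul,
      Finset.sum_sub_distrib] at h
    rw [Finset.sum_eq_single a (fun b _ hb => by simp [hb]) (by simp)] at h
    simpa [e] using h
  · intro j _ hj
    refine Finset.sum_eq_zero fun b _ => ?_
    simp [y, hj]
  · simp

/-- Equilibrium of a finite game embedded, through maps `e i : κ → S i`, in a larger game. -/
theorem exists_equilibrium_against_finite {ι κ : Type*} [Fintype ι] [DecidableEq ι] [Fintype κ] [Nonempty κ]
    {S : ι → Type*} [∀ i, MeasurableSpace (S i)] {φ : ∀ i, S i → (∀ j, S j) → ℝ}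
    (hφ : ∀ i, Measurable (Function.uncurry (φ i)))
    (e : ∀ i, κ → S i) :
    ∃ γ : ∀ i, ProbabilityMeasure (S i), ∀ i a,
      ∫ s, ∫ b, φ i s b ∂(Measure.pi fun j => (γ j : Measure (S j))) ∂(γ i : Measure (S i)) ≤
        ∫ b, φ i (e i a) b ∂(Measure.pi fun j => (γ j : Measure (S j))) := by
  obtain ⟨x, hx, hle⟩ := exists_equilibrium_finite fun i k (d : ι → κ) =>
    φ i (e i k) fun j => e j (d j)
  let : MeasurableSpace κ := ⊤
  have : DiscreteMeasurableSpace κ := ⟨fun _ => trivial⟩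
  let ν : ι → Measure κ := fun i => ∑ a, ENNReal.ofReal (x i a) • Measure.dirac a
  have hν1 : ∀ i a, ν i {a} = ENNReal.ofReal (x i a) := by
    intro i a
    classical
    simp only [ν, Measure.finsetSum_apply, Measure.smul_apply, smul_eq_mul]
    rw [Finset.sum_eq_single a (fun b _ hb => by simp [hb]) (by simp)]
    simp
  have hνp : ∀ i, IsProbabilityMeasure (ν i) := fun i => ⟨by
    simp only [ν, Measure.finsetSum_apply, Measure.smul_apply, smul_eq_mul, measure_univ, mul_one]
    rw [← ENNReal.ofReal_sum_of_nonneg fun a _ => (hx i).1 a, (hx i).2, ENNReal.ofReal_one]⟩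
  have hem : ∀ i, Measurable (e i) := fun i => measurable_from_top
  have : ∀ i, IsProbabilityMeasure ((ν i).map (e i)) := fun i =>
    Measure.isProbabilityMeasure_map (hem i).aemeasurable
  have hemp : Measurable fun (d : ι → κ) j => e j (d j) :=
    measurable_pi_lambda _ fun i => (hem i).comp (measurable_pi_apply i)
  have hpi : ∀ F : (∀ j, S j) → ℝ, Measurable F →
      ∫ b, F b ∂(Measure.pi fun j => (ν j).map (e j)) =
        ∑ d : ι → κ, (∏ j, x j (d j)) * F fun j => e j (d j) := by
    intro F hF
    rw [← Measure.pi_map_pi fun i => (hem i).aemeasurable,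
      integral_map hemp.aemeasurable hF.aestronglyMeasurable, integral_fintype .of_finite]
    refine Finset.sum_congr rfl fun d _ => ?_
    rw [measureReal_def, Measure.pi_singleton, ENNReal.toReal_prod, smul_eq_mul]
    simp [hν1, ENNReal.toReal_ofReal ((hx _).1 _)]
  refine ⟨fun i => ⟨(ν i).map (e i), inferInstance⟩, fun i a => ?_⟩
  simp only [ProbabilityMeasure.coe_mk]
  rw [integral_map (hem i).aemeasurable (hφ i).stronglyMeasurable.integral_prod_right.aestronglyMeasurable,
    integral_fintype .of_finite, hpi _ (by fun_prop)]
  refine le_of_eq_of_le (Finset.sum_congr rfl fun b _ => ?_) (hle i a)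
  rw [hpi _ (by fun_prop), measureReal_def, hν1, ENNReal.toReal_ofReal ((hx i).1 b), smul_eq_mul]

/-- Existence of an equilibrium in mixed strategies for a game with compact metrizable strategy
spaces and continuous costs, when each player treats the joint distribution of play as exogenous:
`φ i s b` is the cost of player `i` using the strategy `s` while the exogenous profile is `b`. -/
theorem exists_equilibrium_compact {ι : Type*} [Fintype ι] {S : ι → Type*}
    [∀ i, TopologicalSpace (S i)] [∀ i, CompactSpace (S i)] [∀ i, Nonempty (S i)]
    [∀ i, TopologicalSpace.MetrizableSpace (S i)] [∀ i, SecondCountableTopology (S i)]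
    [∀ i, MeasurableSpace (S i)] [∀ i, BorelSpace (S i)]
    {φ : ∀ i, S i → (∀ j, S j) → ℝ} (hφ : ∀ i, Continuous (Function.uncurry (φ i))) :
    ∃ γ : ∀ i, ProbabilityMeasure (S i), ∀ i (γ' : ProbabilityMeasure (S i)),
      ∫ s, ∫ b, φ i s b ∂(Measure.pi fun j => (γ j : Measure (S j))) ∂(γ i : Measure (S i)) ≤
        ∫ s, ∫ b, φ i s b ∂(Measure.pi fun j => (γ j : Measure (S j))) ∂(γ' : Measure (S i)) := by
  classical
  have hint : ∀ i (ν : Measure (S i × ∀ j, S j)) [IsFiniteMeasure ν],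
      Integrable (Function.uncurry (φ i)) ν := fun i ν _ =>
    (hφ i).integrable_of_hasCompactSupport (HasCompactSupport.of_compactSpace _)
  have hcont : ∀ i (ν : Measure (∀ j, S j)) [IsFiniteMeasure ν],
      Continuous fun s => ∫ b, φ i s b ∂ν := by
    intro i ν _
    have := continuous_parametric_integral_of_continuous (μ := ν) (hφ i) isCompact_univ
    simpa using this
  have hclosed : ∀ i s, IsClosed {γ : ∀ i, ProbabilityMeasure (S i) |
      ∫ s, ∫ b, φ i s b ∂(Measure.pi fun j => (γ j : Measure (S j))) ∂(γ i : Measure (S i)) ≤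
        ∫ b, φ i s b ∂(Measure.pi fun j => (γ j : Measure (S j)))} := by
    intro i s
    refine isClosed_le ?_ ?_
    · have h := (ProbabilityMeasure.continuous_integral_boundedContinuousFunction
        (BoundedContinuousFunction.mkOfCompact ⟨_, hφ i⟩)).comp
        (ProbabilityMeasure.continuous_prod.comp ((continuous_apply i).prodMk
          (ProbabilityMeasure.continuous_pi (α := S))))
      refine h.congr fun γ => ?_
      exact integral_prod _ (hint i _)
    · exact (ProbabilityMeasure.continuous_integral_boundedContinuousFunction
        (BoundedContinuousFunction.mkOfCompact
          ⟨φ i s, (hφ i).comp (Continuous.prodMk_right s)⟩)).comp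
        (ProbabilityMeasure.continuous_pi (α := S))
  let e : ∀ i, ℕ → S i := fun i => TopologicalSpace.denseSeq (S i)
  obtain ⟨γ, hγ⟩ := IsCompact.nonempty_iInter_of_sequence_nonempty_isCompact_isClosed
    (fun n : ℕ => ⋂ (i : ι) (k : Fin (n + 1)), {γ : ∀ i, ProbabilityMeasure (S i) |
      ∫ s, ∫ b, φ i s b ∂(Measure.pi fun j => (γ j : Measure (S j))) ∂(γ i : Measure (S i)) ≤
        ∫ b, φ i (e i k) b ∂(Measure.pi fun j => (γ j : Measure (S j)))})
    (fun n => Set.iInter_mono fun i => Set.subset_iInter fun k => Set.iInter_subset_of_subset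
      k.castSucc (by simp))
    (fun n => by
      obtain ⟨γ, hγ⟩ := exists_equilibrium_against_finite (κ := Fin (n + 1))
        (fun i => (hφ i).measurable) (fun i k => e i k)
      exact ⟨γ, Set.mem_iInter₂.mpr hγ⟩)
    (isClosed_iInter fun i => isClosed_iInter fun k => hclosed i _).isCompact
    (fun n => isClosed_iInter fun i => isClosed_iInter fun k => hclosed i _)
  have hpure : ∀ i s,
      ∫ s, ∫ b, φ i s b ∂(Measure.pi fun j => (γ j : Measure (S j))) ∂(γ i : Measure (S i)) ≤
        ∫ b, φ i s b ∂(Measure.pi fun j => (γ j : Measure (S j))) := by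
    intro i s
    refine (TopologicalSpace.denseRange_denseSeq (S i)).induction_on s
      (isClosed_le continuous_const (hcont i _)) fun n => ?_
    exact Set.mem_iInter₂.mp (Set.mem_iInter.mp hγ n) i (Fin.last n)
  refine ⟨γ, fun i γ' => ?_⟩
  calc _ = ∫ _, ∫ s, ∫ b, φ i s b ∂(Measure.pi fun j => (γ j : Measure (S j)))
        ∂(γ i : Measure (S i)) ∂(γ' : Measure (S i)) := by simp
    _ ≤ _ := integral_mono (integrable_const _) ((hcont i _).integrable_of_hasCompactSupport
        (HasCompactSupport.of_compactSpace _)) (hpure i)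

end Game

namespace SEBEU0

section Continuity

variable {N : ℕ} {X0 : Type} {X U : Fin N → Type} {W0 : Type} {W : Fin N → Type} {Y Ξ : Type}
  [TopologicalSpace X0] [∀ i, TopologicalSpace (X i)] [∀ i, TopologicalSpace (U i)]
  [TopologicalSpace W0] [∀ i, TopologicalSpace (W i)] [TopologicalSpace Y] [TopologicalSpace Ξ]
  [∀ i, LocallyCompactSpace (X i)] [∀ i, LocallyCompactSpace (U i)] [LocallyCompactSpace Y]
  {Sset : ∀ i : Fin N, ∀ t : ℕ, Set C(Hist (X i) (U i) Y t, U i)}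
  {f : ∀ i : Fin N, ℕ → X i → U i → Y → W i → X i}
  {g : ℕ → X0 → (∀ i, X i) → (∀ i, U i) → Ξ → Y}
  {f0 : ℕ → X0 → (∀ i, X i) → (∀ i, U i) → W0 → X0}

theorem continuous_sysHist
    (hf : ∀ i t, Continuous fun p : X i × U i × Y × W i => f i t p.1 p.2.1 p.2.2.1 p.2.2.2)
    (hg : ∀ t, Continuous fun p : X0 × (∀ i, X i) × (∀ i, U i) × Ξ =>
      g t p.1 p.2.1 p.2.2.1 p.2.2.2)
    (hf0 : ∀ t, Continuous fun p : X0 × (∀ i, X i) × (∀ i, U i) × W0 =>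
      f0 t p.1 p.2.1 p.2.2.1 p.2.2.2) (t : ℕ) :
    Continuous fun p : (∀ i, Strat X U Y Sset i) × Prim X0 X W0 W Ξ =>
      sysHist f g f0 p.1 p.2 t := by
  induction t with
  | zero =>
    simp only [sysHist]
    fun_prop
  | succ t ih =>
    have hu : ∀ i, Continuous fun p : (∀ i, Strat X U Y Sset i) × Prim X0 X W0 W Ξ =>
        (p.1 i t).val ⟨((sysHist f g f0 p.1 p.2 t).1 i).1, ((sysHist f g f0 p.1 p.2 t).1 i).2,
          (sysHist f g f0 p.1 p.2 t).2.1⟩ := fun i =>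
      Continuous.eval (by fun_prop) (by fun_prop)
    have hx : ∀ i, Continuous fun p : (∀ i, Strat X U Y Sset i) × Prim X0 X W0 W Ξ =>
        ((sysHist f g f0 p.1 p.2 t).1 i).1 (Fin.last t) := fun i => by fun_prop
    have hx0 : Continuous fun p : (∀ i, Strat X U Y Sset i) × Prim X0 X W0 W Ξ =>
        (sysHist f g f0 p.1 p.2 t).2.2 := by fun_prop
    have hy := (hg t).comp (hx0.prodMk ((continuous_pi hx).prodMk ((continuous_pi hu).prodMk
      (show Continuous fun p : (∀ i, Strat X U Y Sset i) × Prim X0 X W0 W Ξ => p.2.1.2.2 t by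
        fun_prop))))
    simp only [sysHist]
    refine .prodMk (continuous_pi fun i => .prodMk (.finSnoc (by fun_prop) ?_)
      (.finSnoc (by fun_prop) (hu i))) (.prodMk (.finSnoc (by fun_prop) hy) ?_)
    · exact (hf i t).comp ((hx i).prodMk ((hu i).prodMk (hy.prodMk
        (show Continuous fun p : (∀ i, Strat X U Y Sset i) × Prim X0 X W0 W Ξ => (p.2.2 i).2 t by
          fun_prop))))
    · exact (hf0 t).comp (hx0.prodMk ((continuous_pi hx).prodMk ((continuous_pi hu).prodMk
        (show Continuous fun p : (∀ i, Strat X U Y Sset i) × Prim X0 X W0 W Ξ => p.2.1.2.1 t by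
          fun_prop))))

theorem continuous_yPath
    (hf : ∀ i t, Continuous fun p : X i × U i × Y × W i => f i t p.1 p.2.1 p.2.2.1 p.2.2.2)
    (hg : ∀ t, Continuous fun p : X0 × (∀ i, X i) × (∀ i, U i) × Ξ =>
      g t p.1 p.2.1 p.2.2.1 p.2.2.2)
    (hf0 : ∀ t, Continuous fun p : X0 × (∀ i, X i) × (∀ i, U i) × W0 =>
      f0 t p.1 p.2.1 p.2.2.1 p.2.2.2) :
    Continuous fun p : (∀ i, Strat X U Y Sset i) × Prim X0 X W0 W Ξ => yPath f g f0 p.1 p.2 :=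
  continuous_pi fun t => (continuous_apply (Fin.last t)).comp
    (continuous_fst.comp (continuous_snd.comp (continuous_sysHist hf hg hf0 (t + 1))))

theorem continuous_subjHist (i : Fin N)
    (hf : ∀ t, Continuous fun p : X i × U i × Y × W i => f i t p.1 p.2.1 p.2.2.1 p.2.2.2)
    (t : ℕ) :
    Continuous fun p : Strat X U Y Sset i × (ℕ → Y) × (X i × (ℕ → W i)) =>
      subjHist f i p.1 p.2.1 p.2.2 t := by
  induction t with
  | zero =>
    simp only [subjHist]
    fun_prop
  | succ t ih =>
    have hu : Continuous fun p : Strat X U Y Sset i × (ℕ → Y) × (X i × (ℕ → W i)) =>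
        (p.1 t).val ⟨(subjHist f i p.1 p.2.1 p.2.2 t).1, (subjHist f i p.1 p.2.1 p.2.2 t).2,
          fun k : Fin t => p.2.1 k⟩ :=
      Continuous.eval (by fun_prop) (by fun_prop)
    simp only [subjHist]
    refine .prodMk (.finSnoc (by fun_prop) ?_) (.finSnoc (by fun_prop) hu)
    exact (hf t).comp ((show Continuous fun p : Strat X U Y Sset i × (ℕ → Y) × (X i × (ℕ → W i)) =>
      (subjHist f i p.1 p.2.1 p.2.2 t).1 (Fin.last t) by fun_prop).prodMk (hu.prodMk
        (show Continuous fun p : Strat X U Y Sset i × (ℕ → Y) × (X i × (ℕ → W i)) =>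
          (p.2.1 t, p.2.2.2 t) by fun_prop)))

end Continuity

/-- A parametric integral of a jointly continuous function over a compact space is continuous. -/
theorem continuous_integral_of_compactSpace {A B : Type*} [TopologicalSpace A]
    [FirstCountableTopology A] [LocallyCompactSpace A] [TopologicalSpace B] [CompactSpace B]
    [MeasurableSpace B] [OpensMeasurableSpace B] {ν : Measure B} [IsFiniteMeasure ν]
    {F : A → B → ℝ} (hF : Continuous (Function.uncurry F)) : Continuous fun a => ∫ b, F a b ∂ν := by
  simpa using continuous_parametric_integral_of_continuous (μ := ν) hF isCompact_univ

set_option synthInstance.maxHeartbeats 200000 in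
theorem borelSpace_prim {N : ℕ} {X0 : Type} {X : Fin N → Type} {W0 : Type} {W : Fin N → Type}
    {Ξ : Type} [TopologicalSpace X0] [SecondCountableTopology X0]
    [∀ i, TopologicalSpace (X i)] [∀ i, SecondCountableTopology (X i)]
    [TopologicalSpace W0] [SecondCountableTopology W0]
    [∀ i, TopologicalSpace (W i)] [∀ i, SecondCountableTopology (W i)]
    [TopologicalSpace Ξ] [SecondCountableTopology Ξ] [MeasurableSpace X0] [BorelSpace X0]
    [∀ i, MeasurableSpace (X i)] [∀ i, BorelSpace (X i)] [MeasurableSpace W0] [BorelSpace W0]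
    [∀ i, MeasurableSpace (W i)] [∀ i, BorelSpace (W i)] [MeasurableSpace Ξ] [BorelSpace Ξ] :
    BorelSpace (Prim X0 X W0 W Ξ) :=
  inferInstance

section Cost

variable {N : ℕ} {X0 : Type} {X U : Fin N → Type} {W0 : Type} {W : Fin N → Type} {Y Ξ : Type}
  [MetricSpace X0] [CompactSpace X0] [∀ i, MetricSpace (X i)] [∀ i, CompactSpace (X i)]
  [∀ i, MetricSpace (U i)] [∀ i, CompactSpace (U i)] [MetricSpace W0] [CompactSpace W0]
  [∀ i, MetricSpace (W i)] [∀ i, CompactSpace (W i)] [MetricSpace Y] [CompactSpace Y]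
  [MetricSpace Ξ] [CompactSpace Ξ] [MeasurableSpace X0] [∀ i, MeasurableSpace (X i)]
  [MeasurableSpace W0] [∀ i, MeasurableSpace (W i)] [MeasurableSpace Ξ]
  {Sset : ∀ i : Fin N, ∀ t : ℕ, Set C(Hist (X i) (U i) Y t, U i)}
  [∀ i t, CompactSpace (Sset i t)]
  {f : ∀ i : Fin N, ℕ → X i → U i → Y → W i → X i}

/-- Integration against the endogenous environment law is iterated integration over strategy
profiles and primitive random variables. -/
theorem integral_envLaw [MeasurableSpace Y] [BorelSpace Y]
    {g : ℕ → X0 → (∀ i, X i) → (∀ i, U i) → Ξ → Y}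
    {f0 : ℕ → X0 → (∀ i, X i) → (∀ i, U i) → W0 → X0}
    (μ : Measure (Prim X0 X W0 W Ξ)) [IsProbabilityMeasure μ]
    (hy : Measurable fun p : (∀ i, Strat X U Y Sset i) × Prim X0 X W0 W Ξ =>
      yPath f g f0 p.1 p.2)
    (γ : ∀ i, ProbabilityMeasure (Strat X U Y Sset i)) {h : (ℕ → Y) → ℝ} (hh : Continuous h) :
    ∫ Z, h Z ∂(envLaw μ f g f0 γ) = ∫ s, ∫ ω, h (yPath f g f0 s ω) ∂μ
      ∂(Measure.pi fun i => (γ i : Measure (Strat X U Y Sset i))) := by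
  have hys : ∀ s : ∀ i, Strat X U Y Sset i, Measurable (yPath f g f0 s) := fun s =>
    hy.comp measurable_prodMk_left
  have hlaw : envLaw μ f g f0 γ =
      ((Measure.pi fun i => (γ i : Measure (Strat X U Y Sset i))).prod μ).map
        (fun p => yPath f g f0 p.1 p.2) := by
    ext A hA
    have hker : Measurable fun s : ∀ i, Strat X U Y Sset i => μ.map (yPath f g f0 s) := by
      refine Measure.measurable_of_measurable_coe _ fun B hB => ?_
      simp_rw [Measure.map_apply (hys _) hB]
      exact measurable_measure_prodMk_left (hy hB)
    rw [envLaw, Measure.bind_apply hA hker.aemeasurable, Measure.map_apply hy hA,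
      Measure.prod_apply (hy hA)]
    simp_rw [Measure.map_apply (hys _) hA]
    rfl
  rw [hlaw, integral_map hy.aemeasurable hh.aestronglyMeasurable, integral_prod]
  obtain ⟨C, hC⟩ := isCompact_univ.exists_bound_of_continuousOn hh.continuousOn
  exact .of_bound (hh.measurable.comp hy).aestronglyMeasurable C
    (.of_forall fun p => hC _ (Set.mem_univ _))

variable [BorelSpace X0] [∀ i, BorelSpace (X i)] [BorelSpace W0] [∀ i, BorelSpace (W i)]
  [BorelSpace Ξ]

theorem continuous_subjCost {c : ∀ i : Fin N, ℕ → X i → U i → Y → ℝ} {β : Fin N → ℝ}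
    {cbar : ℝ} (i : Fin N)
    (hf : ∀ t, Continuous fun p : X i × U i × Y × W i => f i t p.1 p.2.1 p.2.2.1 p.2.2.2)
    (hc : ∀ t, Continuous fun p : X i × U i × Y => c i t p.1 p.2.1 p.2.2)
    (hcb : ∀ t x u y, |c i t x u y| ≤ cbar) (hβ0 : 0 ≤ β i) (hβ1 : β i < 1)
    (μ : Measure (Prim X0 X W0 W Ξ)) [IsFiniteMeasure μ] :
    Continuous fun p : Strat X U Y Sset i × (ℕ → Y) => subjCost μ f c β i p.1 p.2 := by
  have := borelSpace_prim (X0 := X0) (X := X) (W0 := W0) (W := W) (Ξ := Ξ)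
  refine continuous_integral_of_compactSpace (continuous_tsum
    (u := fun t => β i ^ t * cbar) (fun t => continuous_const.mul ?_)
    ((summable_geometric_of_lt_one hβ0 hβ1).mul_right cbar) fun t p => ?_)
  · have hr : Continuous fun p : (Strat X U Y Sset i × (ℕ → Y)) × Prim X0 X W0 W Ξ =>
        (p.1.1, p.1.2, p.2.2 i) := by fun_prop
    have hh := fun t => (continuous_subjHist i hf t).comp hr
    exact (hc t).comp (((continuous_apply (Fin.last t)).comp (continuous_fst.comp (hh t))).prodMk
      (((continuous_apply (Fin.last t)).comp (continuous_snd.comp (hh (t + 1)))).prodMk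
        (show Continuous fun p : (Strat X U Y Sset i × (ℕ → Y)) × Prim X0 X W0 W Ξ => p.1.2 t by
          fun_prop)))
  · rw [norm_mul, Real.norm_of_nonneg (pow_nonneg hβ0 t), Real.norm_eq_abs]
    exact mul_le_mul_of_nonneg_left (hcb _ _ _ _) (pow_nonneg hβ0 t)

end Cost

end SEBEU0

open SEBEU0 in
theorem exists_SEBEU_mixed
    {N : ℕ}
    (X0 : Type) (X : Fin N → Type) (U : Fin N → Type)
    (W0 : Type) (W : Fin N → Type) (Y : Type) (Ξ : Type)
    [MetricSpace X0] [CompactSpace X0] [Nonempty X0]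
    [∀ i, MetricSpace (X i)] [∀ i, CompactSpace (X i)] [∀ i, Nonempty (X i)]
    [∀ i, MetricSpace (U i)] [∀ i, CompactSpace (U i)] [∀ i, Nonempty (U i)]
    [MetricSpace W0] [CompactSpace W0] [Nonempty W0]
    [∀ i, MetricSpace (W i)] [∀ i, CompactSpace (W i)] [∀ i, Nonempty (W i)]
    [MetricSpace Y] [CompactSpace Y] [Nonempty Y]
    [MetricSpace Ξ] [CompactSpace Ξ] [Nonempty Ξ]
    [MeasurableSpace X0] [BorelSpace X0]
    [∀ i, MeasurableSpace (X i)] [∀ i, BorelSpace (X i)]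
    [∀ i, MeasurableSpace (U i)] [∀ i, BorelSpace (U i)]
    [MeasurableSpace W0] [BorelSpace W0]
    [∀ i, MeasurableSpace (W i)] [∀ i, BorelSpace (W i)]
    [MeasurableSpace Y] [BorelSpace Y] [MeasurableSpace Ξ] [BorelSpace Ξ]
    (f : ∀ i : Fin N, ℕ → X i → U i → Y → W i → X i)
    (g : ℕ → X0 → (∀ i, X i) → (∀ i, U i) → Ξ → Y)
    (f0 : ℕ → X0 → (∀ i, X i) → (∀ i, U i) → W0 → X0)
    (c : ∀ i : Fin N, ℕ → X i → U i → Y → ℝ)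
    (hf : ∀ i t, Continuous fun p : X i × U i × Y × W i => f i t p.1 p.2.1 p.2.2.1 p.2.2.2)
    (hg : ∀ t, Continuous fun p : X0 × (∀ i, X i) × (∀ i, U i) × Ξ =>
      g t p.1 p.2.1 p.2.2.1 p.2.2.2)
    (hf0 : ∀ t, Continuous fun p : X0 × (∀ i, X i) × (∀ i, U i) × W0 =>
      f0 t p.1 p.2.1 p.2.2.1 p.2.2.2)
    (hc : ∀ i t, Continuous fun p : X i × U i × Y => c i t p.1 p.2.1 p.2.2)
    (Sset : ∀ i : Fin N, ∀ t : ℕ, Set C(Hist (X i) (U i) Y t, U i))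
    (hScpt : ∀ i t, IsCompact (Sset i t)) (hSne : ∀ i t, (Sset i t).Nonempty)
    (β : Fin N → ℝ) (cbar βbar : ℝ)
    (hcb : ∀ i t x u y, |c i t x u y| ≤ cbar)
    (hβ0 : ∀ i, 0 ≤ β i) (hβb : ∀ i, β i ≤ βbar) (hβbar : βbar < 1)
    (μ : MeasureTheory.Measure (Prim X0 X W0 W Ξ)) [MeasureTheory.IsProbabilityMeasure μ] :
    ∃ γ : ∀ i, MeasureTheory.ProbabilityMeasure (Strat X U Y Sset i),
      ∀ i : Fin N, ∀ γ' : MeasureTheory.ProbabilityMeasure (Strat X U Y Sset i),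
        expSubjCost μ f c β i (γ i) (envLaw μ f g f0 γ) ≤
          expSubjCost μ f c β i γ' (envLaw μ f g f0 γ) := by
  have : ∀ i t, CompactSpace (Sset i t) := fun i t => isCompact_iff_compactSpace.mp (hScpt i t)
  have : ∀ i t, Nonempty (Sset i t) := fun i t => (hSne i t).to_subtype
  have : ∀ i t, BorelSpace C(Hist (X i) (U i) Y t, U i) := fun i t => ⟨rfl⟩
  have : ∀ i, SecondCountableTopology (Strat X U Y Sset i) := fun i => inferInstance
  have : SecondCountableTopology (∀ i, Strat X U Y Sset i) := inferInstance
  have : BorelSpace (∀ i, Strat X U Y Sset i) := inferInstance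
  have := borelSpace_prim (X0 := X0) (X := X) (W0 := W0) (W := W) (Ξ := Ξ)
  have hy : Continuous fun p : (∀ i, Strat X U Y Sset i) × Prim X0 X W0 W Ξ =>
      yPath f g f0 p.1 p.2 := continuous_yPath hf hg hf0
  have hJ : ∀ i, Continuous fun p : Strat X U Y Sset i × (ℕ → Y) => subjCost μ f c β i p.1 p.2 :=
    fun i => continuous_subjCost i (hf i) (hc i) (hcb i) (hβ0 i) ((hβb i).trans_lt hβbar) μ
  have hφ : ∀ i, Continuous (Function.uncurry
      fun (si : Strat X U Y Sset i) (s : ∀ j, Strat X U Y Sset j) =>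
        ∫ ω, subjCost μ f c β i si (yPath f g f0 s ω) ∂μ) := fun i =>
    continuous_integral_of_compactSpace ((hJ i).comp (.prodMk
      (show Continuous fun p : (Strat X U Y Sset i × ∀ j, Strat X U Y Sset j) ×
        Prim X0 X W0 W Ξ => p.1.1 by fun_prop)
      (hy.comp (show Continuous fun p : (Strat X U Y Sset i × ∀ j, Strat X U Y Sset j) ×
        Prim X0 X W0 W Ξ => (p.1.2, p.2) by fun_prop))))
  obtain ⟨γ, hγ⟩ := exists_equilibrium_compact hφ
  have hcost : ∀ i (γ' : ProbabilityMeasure (Strat X U Y Sset i)),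
      expSubjCost μ f c β i γ' (envLaw μ f g f0 γ) = ∫ si, ∫ s, ∫ ω,
        subjCost μ f c β i si (yPath f g f0 s ω) ∂μ
          ∂(Measure.pi fun j => (γ j : Measure (Strat X U Y Sset j)))
          ∂(γ' : Measure (Strat X U Y Sset i)) := fun i γ' =>
    integral_congr_ae (.of_forall fun si =>
      integral_envLaw μ hy.measurable γ ((hJ i).comp (Continuous.prodMk_right si)))
  refine ⟨γ, fun i γ' => ?_⟩
  rw [hcost, hcost]
  exact hγ i γ'
end

section
/- Under Assumption 3.1 (compact metric space model), if there are sets of identical DMs (DM i and DM j are identical if their best-reply sets to every exogenous environment distribution ζ ∈ P(Y^{[0,T)}) coincide: BR^i(ζ) = BR^j(ζ)), then there exists a symmetric SEBEU in mixed strategies γ ∈ Γ such that identical DMs use identical strategies at γ, i.e., γ^i = γ^j whenever DM i and DM j are identical. -/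
/-
STATEMENT 1.  Existence of a *symmetric* SEBEU in mixed strategies for the compact metric
space model under Assumption 3.1, when there are sets of identical DMs.

DM `i` and DM `j` are identical if their best-reply sets coincide for every exogenous
environment distribution `ζ ∈ P(Y^ℕ)`: `BR i ζ = BR j ζ` (in particular their common
strategy space is the same; here all DMs share the underlying state/control/disturbance
spaces and the strategy constraint sets, while their dynamics `f i`, costs `c i` and
discount factors `β i` may differ).  The theorem asserts the existence of an SEBEU
`γ` in mixed strategies such that `γ i = γ j` whenever DM `i` and DM `j` are identical.

Time runs over `ℕ`, which subsumes every horizon `T ∈ ℕ ∪ {∞}` (a finite horizon with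
terminal cost is recovered by stage costs vanishing beyond the horizon).
-/

open MeasureTheory

namespace SEBEU1

/-- Borel σ-algebra on a space of continuous maps (compact-open topology, i.e. uniform
convergence on the compact domain). -/
noncomputable instance instMeasurableSpaceContinuousMap (A B : Type)
    [TopologicalSpace A] [TopologicalSpace B] : MeasurableSpace C(A, B) := borel _

/-- Information of a DM at time `t`: own state history, own control history, environment
history. -/
abbrev Hist (X U Y : Type) (t : ℕ) : Type :=
  (Fin (t + 1) → X) × (Fin t → U) × (Fin t → Y)

variable {N : ℕ}
variable (X0 X U W0 W Y Ξ : Type)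
variable [TopologicalSpace X] [TopologicalSpace U] [TopologicalSpace Y]

/-- Common pure strategy space. -/
abbrev Strat (Sset : ∀ t : ℕ, Set C(Hist X U Y t, U)) : Type := ∀ t : ℕ, ↥(Sset t)

/-- Joint history of the whole system at time `t`. -/
abbrev SysHist (t : ℕ) : Type :=
  (Fin N → (Fin (t + 1) → X) × (Fin t → U)) × (Fin t → Y) × X0

/-- Primitive random variables. -/
abbrev Prim : Type := (X0 × (ℕ → W0) × (ℕ → Ξ)) × (Fin N → X × (ℕ → W))

variable {X0 X U W0 W Y Ξ}
variable {Sset : ∀ t : ℕ, Set C(Hist X U Y t, U)}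

/-- Closed-loop joint history under the pure strategy profile `s`. -/
noncomputable def sysHist
    (f : Fin N → ℕ → X → U → Y → W → X)
    (g : ℕ → X0 → (Fin N → X) → (Fin N → U) → Ξ → Y)
    (f0 : ℕ → X0 → (Fin N → X) → (Fin N → U) → W0 → X0)
    (s : Fin N → Strat X U Y Sset) (ω : Prim (N := N) X0 X W0 W Ξ) :
    (t : ℕ) → SysHist (N := N) X0 X U Y t
  | 0 => (fun i => (fun _ => (ω.2 i).1, Fin.elim0), Fin.elim0, ω.1.1)
  | t + 1 =>
      let h := sysHist f g f0 s ω t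
      let xcur : Fin N → X := fun i => (h.1 i).1 (Fin.last t)
      let u : Fin N → U := fun i => (s i t).val ⟨(h.1 i).1, (h.1 i).2, h.2.1⟩
      let y : Y := g t h.2.2 xcur u (ω.1.2.2 t)
      (fun i => (Fin.snoc (h.1 i).1 (f i t (xcur i) (u i) y ((ω.2 i).2 t)),
                 Fin.snoc (h.1 i).2 (u i)),
       Fin.snoc h.2.1 y,
       f0 t h.2.2 xcur u (ω.1.2.1 t))

/-- The realized environment path under `s`. -/
noncomputable def yPath
    (f : Fin N → ℕ → X → U → Y → W → X)
    (g : ℕ → X0 → (Fin N → X) → (Fin N → U) → Ξ → Y)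
    (f0 : ℕ → X0 → (Fin N → X) → (Fin N → U) → W0 → X0)
    (s : Fin N → Strat X U Y Sset) (ω : Prim (N := N) X0 X W0 W Ξ) : ℕ → Y :=
  fun t => (sysHist f g f0 s ω (t + 1)).2.1 (Fin.last t)

/-- DM `i`'s own state–control history under strategy `si` against a fixed deterministic
environment sequence `Z`. -/
noncomputable def subjHist (f : Fin N → ℕ → X → U → Y → W → X) (i : Fin N)
    (si : Strat X U Y Sset) (Z : ℕ → Y) (ωi : X × (ℕ → W)) :
    (t : ℕ) → (Fin (t + 1) → X) × (Fin t → U)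
  | 0 => (fun _ => ωi.1, Fin.elim0)
  | t + 1 =>
      let h := subjHist f i si Z ωi t
      let u : U := (si t).val ⟨h.1, h.2, fun k : Fin t => Z k⟩
      (Fin.snoc h.1 (f i t (h.1 (Fin.last t)) u (Z t) (ωi.2 t)), Fin.snoc h.2 u)

section Meas

variable [MeasurableSpace X] [MeasurableSpace U] [MeasurableSpace X0]
    [MeasurableSpace W0] [MeasurableSpace W] [MeasurableSpace Y] [MeasurableSpace Ξ]

/-- Subjective cost `Jᶦ(sᶦ, Z)`. -/
noncomputable def subjCost (μ : Measure (Prim (N := N) X0 X W0 W Ξ))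
    (f : Fin N → ℕ → X → U → Y → W → X)
    (c : Fin N → ℕ → X → U → Y → ℝ) (β : Fin N → ℝ)
    (i : Fin N) (si : Strat X U Y Sset) (Z : ℕ → Y) : ℝ :=
  ∫ ω, (∑' t : ℕ, β i ^ t *
      c i t ((subjHist f i si Z (ω.2 i) t).1 (Fin.last t))
            ((subjHist f i si Z (ω.2 i) (t + 1)).2 (Fin.last t)) (Z t)) ∂μ

/-- Expected subjective cost `E^{(γᶦ, ζ)}[Jᶦ]` of DM `i` under the mixed strategy `γᶦ` and
an independent exogenous environment distribution `ζ`. -/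
noncomputable def expSubjCost (μ : Measure (Prim (N := N) X0 X W0 W Ξ))
    (f : Fin N → ℕ → X → U → Y → W → X)
    (c : Fin N → ℕ → X → U → Y → ℝ) (β : Fin N → ℝ)
    (i : Fin N) (γi : ProbabilityMeasure (Strat X U Y Sset)) (ζ : Measure (ℕ → Y)) : ℝ :=
  ∫ si, ∫ Z, subjCost μ f c β i si Z ∂ζ ∂(γi : Measure (Strat X U Y Sset))

/-- The best-reply set `BRᶦ(ζ)` of DM `i` in mixed strategies against an independent
exogenous environment distribution `ζ`. -/
noncomputable def BR (μ : Measure (Prim (N := N) X0 X W0 W Ξ))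
    (f : Fin N → ℕ → X → U → Y → W → X)
    (c : Fin N → ℕ → X → U → Y → ℝ) (β : Fin N → ℝ)
    (i : Fin N) (ζ : Measure (ℕ → Y)) : Set (ProbabilityMeasure (Strat X U Y Sset)) :=
  {γi | ∀ γ' : ProbabilityMeasure (Strat X U Y Sset),
    expSubjCost μ f c β i γi ζ ≤ expSubjCost μ f c β i γ' ζ}

/-- Environment distribution `ζ_γ` induced endogenously by the joint mixed strategy `γ`. -/
noncomputable def envLaw (μ : Measure (Prim (N := N) X0 X W0 W Ξ))
    (f : Fin N → ℕ → X → U → Y → W → X)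
    (g : ℕ → X0 → (Fin N → X) → (Fin N → U) → Ξ → Y)
    (f0 : ℕ → X0 → (Fin N → X) → (Fin N → U) → W0 → X0)
    (γ : Fin N → ProbabilityMeasure (Strat X U Y Sset)) : Measure (ℕ → Y) :=
  (Measure.pi fun i => (γ i : Measure (Strat X U Y Sset))).bind
    (fun s => Measure.map (yPath f g f0 s) μ)

end Meas

end SEBEU1

set_option linter.unusedSectionVars false

namespace Scarf

open Finset

variable {V I : Type*} [Fintype V] [DecidableEq V] [Fintype I] [DecidableEq I]

/-- A set `D` is dominated by the rank functions `r` if no point lies strictly above the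
minimum of `D` in all of the orders. -/
def Dominated (r : I → V → ℕ) (D : Finset V) : Prop :=
  ∀ y, ∃ i, ∀ x ∈ D, r i y ≤ r i x

theorem Dominated.mono {r : I → V → ℕ} {D A : Finset V} (hA : Dominated r A) (h : D ⊆ A) :
    Dominated r D := fun y => (hA y).imp fun _ hi x hx => hi x (h hx)

/-- The points lying above the thresholds `m j` in all the orders `j ≠ i`. -/
def above (r : I → V → ℕ) (m : I → V) (i : I) : Finset V :=
  univ.filter fun y => ∀ j, j ≠ i → r j (m j) < r j y

/-- The maximal elements of `above r m i` for the order `i`. -/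
def topAbove (r : I → V → ℕ) (m : I → V) (i : I) : Finset V :=
  (above r m i).filter fun a => ∀ y ∈ above r m i, r i y ≤ r i a

theorem card_topAbove {r : I → V → ℕ} (hr : ∀ i, Function.Injective (r i)) (m : I → V) (i : I)
    (h : (above r m i).Nonempty) : (topAbove r m i).card = 1 := by
  obtain ⟨a, ha, hmax⟩ := exists_max_image _ (r i) h
  rw [card_eq_one]
  refine ⟨a, ?_⟩
  ext b
  simp only [topAbove, mem_filter, mem_singleton]
  constructor
  · rintro ⟨hb, hb'⟩
    exact hr i (le_antisymm (hmax b hb) (hb' a ha))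
  · rintro rfl
    exact ⟨ha, hmax⟩

/-- The ways to extend `D` by one point to a dominated set. -/
noncomputable def extensions (r : I → V → ℕ) (D : Finset V) : Finset V :=
  open Classical in univ.filter fun a => a ∉ D ∧ Dominated r (insert a D)

theorem exists_extensions_eq {r : I → V → ℕ} (hr : ∀ i, Function.Injective (r i))
    {D : Finset V} (hD : Dominated r D) (hcard : D.card + 1 = Fintype.card I)
    {m : I → V} (hmD : ∀ i, m i ∈ D) (hm : ∀ i, ∀ x ∈ D, r i (m i) ≤ r i x) :
    ∃ i₁ i₂, i₁ ≠ i₂ ∧ m i₁ = m i₂ ∧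
      (extensions r D).card = (topAbove r m i₁).card + (topAbove r m i₂).card := by
  classical
  have hsurj : ∀ x ∈ D, ∃ i, m i = x := by
    intro x hx
    obtain ⟨i, hi⟩ := hD x
    exact ⟨i, hr i (le_antisymm (hm i x hx) (hi _ (hmD i)))⟩
  obtain ⟨i₁, -, i₂, -, hne, heq⟩ := exists_ne_map_eq_of_card_lt_of_maps_to
    (s := (univ : Finset I)) (t := D) (f := m) (by rw [card_univ]; omega) (fun i _ => hmD i)
  have key : ∀ k l : I, k ≠ l → m k = m l → Set.InjOn m (univ.erase k : Finset I) := by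
    intro k l hkl hkl'
    apply injOn_of_card_image_eq
    have : (univ.erase k).image m = D := by
      ext x
      simp only [mem_image, mem_erase, mem_univ, and_true]
      constructor
      · rintro ⟨i, -, rfl⟩
        exact hmD i
      · intro hx
        obtain ⟨i, rfl⟩ := hsurj x hx
        by_cases hik : i = k
        · exact ⟨l, hkl.symm, by rw [hik, hkl']⟩
        · exact ⟨i, hik, rfl⟩
    rw [this, card_erase_of_mem (mem_univ _), card_univ]
    omega
  have below : ∀ y, ∃ i, r i y ≤ r i (m i) := fun y => (hD y).imp fun i hi => hi _ (hmD i)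
  have sufficient : ∀ k l : I, k ≠ l → m k = m l → ∀ a ∈ topAbove r m k,
      a ∉ D ∧ Dominated r (insert a D) ∧ r k a ≤ r k (m k) := by
    intro k l hkl hkl' a ha
    simp only [topAbove, above, mem_filter, mem_univ, true_and] at ha
    obtain ⟨ha, hmax⟩ := ha
    have hak : r k a ≤ r k (m k) := by
      obtain ⟨i, hi⟩ := below a
      by_cases hik : i = k
      · exact hik ▸ hi
      · exact absurd (ha i hik) (not_lt.2 hi)
    refine ⟨fun haD => ?_, fun y => ?_, hak⟩
    · obtain ⟨i, hi⟩ := hsurj a haD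
      by_cases hik : i = k
      · have := ha l hkl.symm
        rw [← hkl', ← hik, hi] at this
        exact lt_irrefl _ this
      · have := ha i hik
        rw [hi] at this
        exact lt_irrefl _ this
    · by_cases hy : ∀ j, j ≠ k → r j (m j) < r j y
      · refine ⟨k, fun x hx => ?_⟩
        rcases mem_insert.1 hx with rfl | hx
        · exact hmax y hy
        · exact (hmax y hy).trans (hak.trans (hm k x hx))
      · push Not at hy
        obtain ⟨j, hj, hy⟩ := hy
        refine ⟨j, fun x hx => ?_⟩
        rcases mem_insert.1 hx with rfl | hx
        · exact hy.trans (ha j hj).le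
        · exact hy.trans (hm j x hx)
  have necessary : ∀ k l : I, k ≠ l → m k = m l → ∀ a, a ∉ D → Dominated r (insert a D) →
      r l (m l) < r l a → a ∈ topAbove r m k := by
    intro k l hkl hkl' a haD hdom hla
    have hgt : ∀ j, j ≠ k → r j (m j) < r j a := by
      intro j hj
      by_cases hjl : j = l
      · exact hjl ▸ hla
      obtain ⟨i, hi⟩ := hdom (m j)
      have hij : m i = m j := hr i (le_antisymm (hm i _ (hmD j))
        (hi _ (mem_insert_of_mem (hmD i))))
      have hij' : i = j := by
        by_cases hik : i = k
        · exact absurd (key k l hkl hkl' (by simp [hj]) (by simp [hkl.symm])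
            (by rw [← hij, hik, hkl'])) hjl
        · exact key k l hkl hkl' (by simp [hik]) (by simp [hj]) hij
      subst hij'
      refine lt_of_le_of_ne (hi a (mem_insert_self _ _)) fun h => haD ?_
      exact hr i h ▸ hmD i
    simp only [topAbove, above, mem_filter, mem_univ, true_and]
    refine ⟨hgt, fun y hy => ?_⟩
    obtain ⟨i, hi⟩ := hdom y
    by_cases hik : i = k
    · exact hik ▸ hi a (mem_insert_self _ _)
    · exact absurd (hy i hik) (not_lt.2 (hi _ (mem_insert_of_mem (hmD i))))
  refine ⟨i₁, i₂, hne, heq, ?_⟩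
  rw [← card_union_of_disjoint]
  · congr 1
    ext a
    simp only [extensions, mem_filter, mem_univ, true_and, mem_union]
    constructor
    · rintro ⟨haD, hdom⟩
      obtain ⟨i, hi⟩ := hdom (m i₁)
      have hmi : m i = m i₁ := hr i (le_antisymm (hm i _ (hmD i₁))
        (hi _ (mem_insert_of_mem (hmD i))))
      have hlt : r i (m i) < r i a := by
        rw [hmi]
        refine lt_of_le_of_ne (hi a (mem_insert_self _ _)) fun h => haD ?_
        exact hr i h ▸ hmD i₁
      by_cases hi1 : i = i₁
      · exact Or.inr (necessary i₂ i₁ hne.symm heq.symm a haD hdom (hi1 ▸ hlt))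
      · have : i = i₂ := key i₁ i₂ hne heq (by simp [hi1]) (by simp [hne.symm])
          (by rw [hmi, heq])
        exact Or.inl (necessary i₁ i₂ hne heq a haD hdom (this ▸ hlt))
    · rintro (ha | ha)
      · exact ⟨(sufficient _ _ hne heq a ha).1, (sufficient _ _ hne heq a ha).2.1⟩
      · exact ⟨(sufficient _ _ hne.symm heq.symm a ha).1,
          (sufficient _ _ hne.symm heq.symm a ha).2.1⟩
  · rw [disjoint_left]
    intro a ha hb
    have h2 := (sufficient _ _ hne.symm heq.symm a hb).2.2
    simp only [topAbove, above, mem_filter, mem_univ, true_and] at ha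
    exact absurd (ha.1 i₂ hne.symm) (not_lt.2 h2)

/-- Rank functions `r` together with slack elements `e i`: the element `e i` is minimal for the
order `i` and lies above every non-slack element for the other orders. -/
structure IsSlack (r : I → V → ℕ) (e : I → V) : Prop where
  inj : ∀ i, Function.Injective (r i)
  bot : ∀ i v, r i (e i) ≤ r i v
  top : ∀ i j v, i ≠ j → v ∉ Set.range e → r j v < r j (e i)

theorem IsSlack.even_card_extensions {r : I → V → ℕ} {e : I → V} (h : IsSlack r e)
    {D : Finset V} (hcard : D.card + 1 = Fintype.card I) {v : V} (hv : v ∈ D)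
    (hve : v ∉ Set.range e) : Even (extensions r D).card := by
  by_cases hext : (extensions r D).card = 0
  · simp [hext]
  obtain ⟨a, ha⟩ := card_ne_zero.1 hext
  simp only [extensions, mem_filter, mem_univ, true_and] at ha
  have hD : Dominated r D := ha.2.mono (subset_insert _ _)
  choose m hmD hm using fun i => exists_min_image D (r i) ⟨v, hv⟩
  obtain ⟨i₁, i₂, -, -, heq⟩ := exists_extensions_eq h.inj hD hcard hmD hm
  have hne : ∀ i, (above r m i).Nonempty := by
    intro i
    refine ⟨e i, ?_⟩
    simp only [above, mem_filter, mem_univ, true_and]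
    exact fun j hj => (hm j v hv).trans_lt (h.top i j v hj.symm hve)
  rw [heq, card_topAbove h.inj m _ (hne _), card_topAbove h.inj m _ (hne _)]
  decide

theorem IsSlack.card_extensions_slack [Nontrivial I] {r : I → V → ℕ} {e : I → V}
    (h : IsSlack r e) (he : Function.Injective e) {v : V} (hv : v ∉ Set.range e) (i₀ : I) :
    (extensions r ((univ.erase i₀).image e)).card = 1 := by
  set D := (univ.erase i₀).image e with hDdef
  have hmem : ∀ j, j ≠ i₀ → e j ∈ D := fun j hj => mem_image_of_mem _ (by simp [hj])
  have hcard : D.card + 1 = Fintype.card I := by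
    rw [card_image_of_injective _ he, card_erase_add_one (mem_univ _), card_univ]
  have hD : Dominated r D := by
    intro y
    by_cases hy : y ∈ Set.range e
    · obtain ⟨j, rfl⟩ := hy
      exact ⟨j, fun x _ => h.bot j x⟩
    · refine ⟨i₀, fun x hx => ?_⟩
      obtain ⟨j, hj, rfl⟩ := mem_image.1 hx
      exact (h.top j i₀ y (ne_of_mem_erase hj) hy).le
  obtain ⟨k, hk⟩ := exists_ne i₀
  choose m hmD hm using fun i => exists_min_image D (r i) ⟨e k, hmem k hk⟩
  have hme : ∀ j, j ≠ i₀ → m j = e j := fun j hj =>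
    h.inj j (le_antisymm (hm j _ (hmem j hj)) (h.bot j _))
  have hfirst : (above r m i₀).Nonempty := by
    refine ⟨v, ?_⟩
    simp only [above, mem_filter, mem_univ, true_and]
    intro j hj
    rw [hme j hj]
    exact lt_of_le_of_ne (h.bot j v) fun hjv => hv ⟨j, h.inj j hjv⟩
  have hsecond : ∀ l, l ≠ i₀ → m l = m i₀ → topAbove r m l = ∅ := by
    intro l hl hml
    rw [topAbove, filter_eq_empty_iff]
    intro y hy
    exfalso
    simp only [above, mem_filter, mem_univ, true_and] at hy
    have h0 := hy i₀ hl.symm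
    rw [← hml, hme l hl] at h0
    have hyr : y ∈ Set.range e := by
      by_contra hyr
      exact absurd h0 (not_lt.2 (h.top l i₀ y hl hyr).le)
    obtain ⟨j, rfl⟩ := hyr
    by_cases hj0 : j = i₀
    · subst hj0
      exact absurd h0 (not_lt.2 (h.bot _ _))
    by_cases hjl : j = l
    · subst hjl
      exact lt_irrefl _ h0
    have := hy j hjl
    rw [hme j hj0] at this
    exact lt_irrefl _ this
  obtain ⟨i₁, i₂, hne, hmi, heq⟩ := exists_extensions_eq h.inj hD hcard hmD hm
  rw [heq]
  by_cases h1 : i₁ = i₀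
  · subst h1
    rw [card_topAbove h.inj m _ hfirst, hsecond i₂ hne.symm hmi.symm, card_empty]
  · by_cases h2 : i₂ = i₀
    · subst h2
      rw [card_topAbove h.inj m _ hfirst, hsecond i₁ h1 hmi, card_empty]
    · rw [hme _ h1, hme _ h2] at hmi
      exact absurd (he hmi) hne

/-- Parity of the number of facets of `A` that carry all colours but `i₀`. -/
theorem odd_card_facets_iff (c : V → I) (i₀ : I) {A : Finset V}
    (hA : A.card = Fintype.card I) :
    Odd (A.filter fun a => (A.erase a).image c = univ.erase i₀).card ↔ A.image c = univ := by
  constructor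
  · intro hodd
    by_contra hfull
    obtain ⟨a, ha⟩ := card_pos.1 hodd.pos
    obtain ⟨haA, himg⟩ := mem_filter.1 ha
    have hinj : Set.InjOn c (A.erase a : Finset V) := by
      apply injOn_of_card_image_eq
      rw [himg, card_erase_of_mem haA, card_erase_of_mem (mem_univ _), hA, card_univ]
    have hca : c a ≠ i₀ := by
      intro hca
      apply hfull
      rw [← insert_erase haA, image_insert, himg, hca, insert_erase (mem_univ _)]
    have : c a ∈ (A.erase a).image c := by rw [himg]; simp [hca]
    obtain ⟨b, hb, hbc⟩ := mem_image.1 this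
    obtain ⟨hba, hbA⟩ := mem_erase.1 hb
    have hset : (A.filter fun x => (A.erase x).image c = univ.erase i₀) = {a, b} := by
      ext x
      simp only [mem_filter, mem_insert, mem_singleton]
      constructor
      · rintro ⟨hx, hximg⟩
        by_contra! hne
        have hxa : x ∈ A.erase a := mem_erase.2 ⟨hne.1, hx⟩
        have : c x ∈ (A.erase x).image c := by
          rw [hximg, ← himg]
          exact mem_image_of_mem _ hxa
        obtain ⟨z, hz, hzc⟩ := mem_image.1 this
        obtain ⟨hzx, hzA⟩ := mem_erase.1 hz
        by_cases hza : z = a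
        · exact hne.2 (hinj hxa hb (by rw [hbc, ← hza, hzc]))
        · exact hzx (hinj (mem_coe.2 (mem_erase.2 ⟨hza, hzA⟩)) hxa hzc)
      · rintro (rfl | rfl)
        · exact ⟨haA, himg⟩
        · refine ⟨hbA, ?_⟩
          rw [← himg]
          ext i
          simp only [mem_image, mem_erase]
          constructor
          · rintro ⟨z, ⟨hzx, hzA⟩, rfl⟩
            by_cases hza : z = a
            · exact ⟨x, ⟨hba, hbA⟩, by rw [hbc, hza]⟩
            · exact ⟨z, ⟨hza, hzA⟩, rfl⟩
          · rintro ⟨z, ⟨hza, hzA⟩, rfl⟩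
            by_cases hzx : z = x
            · exact ⟨a, ⟨hba.symm, haA⟩, by rw [hzx, hbc]⟩
            · exact ⟨z, ⟨hzx, hzA⟩, rfl⟩
    rw [hset, card_pair hba.symm] at hodd
    exact absurd hodd (by decide)
  · intro hfull
    have hinj : Set.InjOn c A := injOn_of_card_image_eq (by rw [hfull, hA, card_univ])
    obtain ⟨a, haA, hca⟩ := mem_image.1 (hfull ▸ mem_univ i₀ : i₀ ∈ A.image c)
    have hset : (A.filter fun x => (A.erase x).image c = univ.erase i₀) = {a} := by
      ext x
      simp only [mem_filter, mem_singleton]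
      constructor
      · rintro ⟨hx, himg⟩
        by_contra hne
        have : c a ∈ (A.erase x).image c :=
          mem_image_of_mem _ (mem_erase.2 ⟨Ne.symm hne, haA⟩)
        rw [himg, hca] at this
        simp at this
      · rintro rfl
        refine ⟨haA, ?_⟩
        ext i
        simp only [mem_image, mem_erase, mem_univ, and_true]
        constructor
        · rintro ⟨z, ⟨hzx, hzA⟩, rfl⟩ hz
          exact hzx (hinj hzA haA (hz.trans hca.symm))
        · intro hi
          obtain ⟨z, hzA, rfl⟩ := mem_image.1 (hfull ▸ mem_univ i : i ∈ A.image c)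
          exact ⟨z, ⟨fun hzx => hi (hzx ▸ hca), hzA⟩, rfl⟩
    rw [hset, card_singleton]
    exact odd_one

/-- **Scarf's lemma**: a colouring in which every slack element `e i` has colour `i` admits a
dominated set carrying all colours. -/
theorem IsSlack.exists_dominated_image_eq_univ [Nontrivial I] {r : I → V → ℕ} {e : I → V}
    (h : IsSlack r e) {v : V} (hv : v ∉ Set.range e) {c : V → I} (hc : ∀ i, c (e i) = i) :
    ∃ A : Finset V, A.card = Fintype.card I ∧ Dominated r A ∧ A.image c = univ := by
  classical
  have he : Function.Injective e := Function.LeftInverse.injective hc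
  obtain ⟨i₀⟩ : Nonempty I := inferInstance
  set rooms : Finset (Finset V) :=
    univ.filter fun A => A.card = Fintype.card I ∧ Dominated r A with hrooms
  set doors : Finset (Finset V) :=
    univ.filter fun D => D.card + 1 = Fintype.card I ∧ D.image c = univ.erase i₀ with hdoors
  have hroom : ∀ A ∈ rooms, (bipartiteBelow (fun D A => D ⊆ A) doors A).card =
      (A.filter fun a => (A.erase a).image c = univ.erase i₀).card := by
    intro A hA
    obtain ⟨hAcard, -⟩ := (mem_filter.1 hA).2
    symm
    apply card_bij (fun a _ => A.erase a)
    · intro a ha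
      obtain ⟨haA, himg⟩ := mem_filter.1 ha
      simp only [bipartiteBelow, hdoors, mem_filter, mem_univ, true_and]
      exact ⟨⟨by rw [card_erase_add_one haA, hAcard], himg⟩, erase_subset _ _⟩
    · intro a ha b hb hab
      exact (erase_inj A (mem_filter.1 ha).1).1 hab
    · intro D hD
      simp only [bipartiteBelow, hdoors, mem_filter, mem_univ, true_and] at hD
      obtain ⟨⟨hDcard, himg⟩, hsub⟩ := hD
      obtain ⟨a, ha⟩ := card_eq_one.1 (show (A \ D).card = 1 by
        rw [card_sdiff_of_subset hsub]; omega)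
      have haA : a ∈ A \ D := ha ▸ mem_singleton_self a
      have hAD : A.erase a = D := by
        rw [erase_eq, ← ha, Finset.sdiff_sdiff_eq_self hsub]
      exact ⟨a, mem_filter.2 ⟨(mem_sdiff.1 haA).1, by rw [hAD, himg]⟩, hAD⟩
  have hdoor : ∀ D ∈ doors, (bipartiteAbove (fun D A => D ⊆ A) rooms D).card =
      (extensions r D).card := by
    intro D hD
    obtain ⟨hDcard, -⟩ := (mem_filter.1 hD).2
    symm
    apply card_bij (fun a _ => insert a D)
    · intro a ha
      simp only [extensions, mem_filter, mem_univ, true_and] at ha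
      simp only [bipartiteAbove, hrooms, mem_filter, mem_univ, true_and]
      exact ⟨⟨by rw [card_insert_of_notMem ha.1, hDcard], ha.2⟩, subset_insert _ _⟩
    · intro a ha b hb hab
      simp only [extensions, mem_filter, mem_univ, true_and] at ha
      exact (insert_inj ha.1).1 hab
    · intro A hA
      simp only [bipartiteAbove, hrooms, mem_filter, mem_univ, true_and] at hA
      obtain ⟨⟨hAcard, hdom⟩, hsub⟩ := hA
      obtain ⟨a, ha⟩ := card_eq_one.1 (show (A \ D).card = 1 by
        rw [card_sdiff_of_subset hsub]; omega)
      have haA : a ∈ A \ D := ha ▸ mem_singleton_self a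
      have hAD : insert a D = A := by
        rw [insert_eq, ← ha, sdiff_union_of_subset hsub]
      refine ⟨a, ?_, hAD⟩
      simp only [extensions, mem_filter, mem_univ, true_and]
      exact ⟨(mem_sdiff.1 haA).2, hAD ▸ hdom⟩
  have hcount := sum_card_bipartiteAbove_eq_sum_card_bipartiteBelow
    (s := doors) (t := rooms) (fun D A => D ⊆ A)
  rw [sum_congr rfl hdoor, sum_congr rfl hroom] at hcount
  set D₀ := (univ.erase i₀).image e with hD₀
  have hD₀mem : D₀ ∈ doors := by
    simp only [hdoors, mem_filter, mem_univ, true_and]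
    refine ⟨by rw [card_image_of_injective _ he, card_erase_add_one (mem_univ _), card_univ], ?_⟩
    rw [hD₀, image_image]
    simp [Function.comp_def, hc]
  have hodd : Odd (∑ D ∈ doors, (extensions r D).card) := by
    rw [← add_sum_erase _ _ hD₀mem, h.card_extensions_slack he hv i₀]
    refine Even.one_add (even_sum _ fun D hD => ?_)
    obtain ⟨hne, hD⟩ := mem_erase.1 hD
    obtain ⟨hDcard, himg⟩ := (mem_filter.1 hD).2
    by_cases hex : ∃ w ∈ D, w ∉ Set.range e
    · obtain ⟨w, hw, hwe⟩ := hex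
      exact h.even_card_extensions hDcard hw hwe
    · push Not at hex
      refine absurd ?_ hne
      rw [hD₀, ← himg, image_image]
      ext x
      simp only [mem_image, Function.comp_apply]
      constructor
      · intro hx
        obtain ⟨j, rfl⟩ := hex x hx
        exact ⟨e j, hx, by rw [hc]⟩
      · rintro ⟨y, hy, rfl⟩
        obtain ⟨j, rfl⟩ := hex y hy
        rwa [hc]
  rw [hcount] at hodd
  obtain ⟨A, hA, hAodd⟩ : ∃ A ∈ rooms,
      Odd (A.filter fun a => (A.erase a).image c = univ.erase i₀).card := by
    by_contra! hcon
    exact (Nat.not_odd_iff_even.2 (even_sum _ fun A hA =>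
      Nat.not_odd_iff_even.1 (hcon A hA))) hodd
  obtain ⟨hAcard, hdom⟩ := (mem_filter.1 hA).2
  exact ⟨A, hAcard, hdom, (odd_card_facets_iff c i₀ hAcard).1 hAodd⟩

/-- The points of the standard simplex scaled by `m` with natural coordinates. -/
abbrev Grid (I : Type*) [Fintype I] (m : ℕ) : Type _ :=
  {x : I → Fin (m + 1) // ∑ i, (x i : ℕ) = m}

/-- Height of a grid point or slack element in direction `i`. -/
def height (m : ℕ) (i : I) : Grid I m ⊕ I → ℕ
  | Sum.inl x => x.1 i + 1
  | Sum.inr j => if j = i then 0 else m + 2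

theorem exists_isSlack_height (m : ℕ) :
    ∃ r : I → Grid I m ⊕ I → ℕ, IsSlack r Sum.inr ∧
      ∀ i v w, r i v ≤ r i w → height m i v ≤ height m i w := by
  let M := Fintype.card (Grid I m ⊕ I)
  let ρ := Fintype.equivFin (Grid I m ⊕ I)
  have hlt : ∀ i v w, height m i v < height m i w →
      height m i v * M + ρ v < height m i w * M + ρ w := by
    intro i v w h
    have h1 : (height m i v + 1) * M ≤ height m i w * M := Nat.mul_le_mul_right _ h
    have h2 : (ρ v : ℕ) < M := (ρ v).2
    rw [add_mul, one_mul] at h1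
    omega
  refine ⟨fun i v => height m i v * M + ρ v, ⟨?_, ?_, ?_⟩, ?_⟩
  · intro i v w h
    rcases lt_trichotomy (height m i v) (height m i w) with h' | h' | h'
    · exact absurd h (hlt i v w h').ne
    · simp only [h', add_right_inj] at h
      exact ρ.injective (Fin.ext h)
    · exact absurd h (hlt i w v h').ne'
  · intro i v
    rcases v with x | j
    · exact (hlt i _ _ (by simp [height])).le
    · by_cases hj : j = i
      · rw [hj]
      · exact (hlt i _ _ (by simp [height, hj])).le
  · intro i j v hij hv
    rcases v with x | k
    · refine hlt j _ _ ?_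
      have := (x.1 j).2
      simp only [height, hij, if_false]
      omega
    · exact absurd ⟨k, rfl⟩ hv
  · intro i v w h
    by_contra hcon
    exact absurd h (not_le.2 (hlt i w v (not_le.1 hcon)))

/-- Every labelling of the grid admits a point that is near to every label, up to directions
in which the point is near to the boundary. -/
theorem exists_grid_point [Nontrivial I] (m : ℕ) (lab : Grid I m → I) :
    ∃ a : Grid I m, ∀ i, (a.1 i : ℕ) ≤ Fintype.card I ∨
      ∃ b : Grid I m, lab b = i ∧ ∀ j, (b.1 j : ℕ) ≤ a.1 j + Fintype.card I ∧
        (a.1 j : ℕ) ≤ b.1 j + Fintype.card I := by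
  obtain ⟨r, hr, hheight⟩ := exists_isSlack_height (I := I) m
  have mkGrid : ∀ y : I → ℕ, ∑ i, y i = m → ∃ x : Grid I m, ∀ i, (x.1 i : ℕ) = y i := by
    intro y hy
    have hle : ∀ i, y i < m + 1 := fun i => Nat.lt_succ_of_le
      (hy ▸ single_le_sum (fun _ _ => Nat.zero_le _) (mem_univ i))
    exact ⟨⟨fun i => ⟨y i, hle i⟩, hy⟩, fun i => rfl⟩
  obtain ⟨k⟩ : Nonempty I := inferInstance
  obtain ⟨v, -⟩ := mkGrid (Pi.single k m) (by simp)
  obtain ⟨A, -, hdom, himg⟩ := hr.exists_dominated_image_eq_univ (v := Sum.inl v) (by simp)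
    (c := Sum.elim lab id) (fun i => rfl)
  set σ : Finset (Grid I m) := univ.filter fun x => Sum.inl x ∈ A with hσ
  set C : Finset I := univ.filter fun i => Sum.inr i ∉ A with hC
  have hlab : ∀ i ∈ C, ∃ b ∈ σ, lab b = i := by
    intro i hi
    obtain ⟨w, hw, hwi⟩ := mem_image.1 (himg ▸ mem_univ i : i ∈ A.image _)
    rcases w with b | j
    · exact ⟨b, by simpa [hσ] using hw, hwi⟩
    · simp only [Sum.elim_inr, id_eq] at hwi
      rw [hwi] at hw
      simp [hC, hw] at hi
  have hdomC : ∀ y : Grid I m, ∃ i ∈ C, ∀ x ∈ σ, (y.1 i : ℕ) ≤ x.1 i := by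
    intro y
    obtain ⟨i, hi⟩ := hdom (Sum.inl y)
    refine ⟨i, ?_, fun x hx => ?_⟩
    · simp only [hC, mem_filter, mem_univ, true_and]
      intro hiA
      have := hheight i _ _ (hi _ hiA)
      simp [height] at this
    · have := hheight i _ _ (hi (Sum.inl x) (by simpa [hσ] using hx))
      simpa [height] using this
  obtain ⟨i₁, hi₁, -⟩ := hdomC v
  obtain ⟨a, haσ, -⟩ := hlab i₁ hi₁
  choose mn hmnσ hmn using fun i => exists_min_image σ (fun x => (x.1 i : ℕ)) ⟨a, haσ⟩
  set b : I → ℕ := fun i => (mn i).1 i with hb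
  have hbσ : ∀ i, ∀ x ∈ σ, b i ≤ x.1 i := hmn
  have hsum : m < ∑ i ∈ C, b i + Fintype.card I := by
    by_contra! hle
    have hle' : ∑ i ∈ C, (b i + 1) ≤ m := by
      rw [sum_add_distrib, sum_const, smul_eq_mul, mul_one]
      have := card_le_univ C
      omega
    obtain ⟨y, hy⟩ := mkGrid
      (fun i => (if i ∈ C then b i + 1 else 0) +
        (Pi.single i₁ (m - ∑ i ∈ C, (b i + 1)) : I → ℕ) i) (by
        rw [sum_add_distrib, sum_ite_mem, univ_inter, sum_pi_single']
        simp only [mem_univ, if_true]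
        omega)
    obtain ⟨i, hi, hyi⟩ := hdomC y
    have := hyi (mn i) (hmnσ i)
    rw [hy, if_pos hi] at this
    simp only [hb] at this
    omega
  have hσsum : ∀ x ∈ σ, ∀ j, ((j ∈ C → (x.1 j : ℕ) < b j + Fintype.card I) ∧
      (j ∉ C → (x.1 j : ℕ) < Fintype.card I)) := by
    intro x hx j
    have htot := x.2
    constructor
    · intro hj
      have h1 : ∑ i ∈ C.erase j, b i ≤ ∑ i ∈ C.erase j, (x.1 i : ℕ) :=
        sum_le_sum fun i _ => hbσ i x hx
      have h2 : ∑ i ∈ C, (x.1 i : ℕ) ≤ ∑ i, (x.1 i : ℕ) :=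
        sum_le_sum_of_subset (subset_univ _)
      rw [← add_sum_erase C _ hj] at h2 hsum
      omega
    · intro hj
      have h1 : ∑ i ∈ C, b i ≤ ∑ i ∈ C, (x.1 i : ℕ) :=
        sum_le_sum fun i _ => hbσ i x hx
      have h2 : ∑ i ∈ insert j C, (x.1 i : ℕ) ≤ ∑ i, (x.1 i : ℕ) :=
        sum_le_sum_of_subset (subset_univ _)
      rw [sum_insert hj] at h2
      omega
  refine ⟨a, fun i => ?_⟩
  by_cases hi : i ∈ C
  · right
    obtain ⟨x, hx, hxi⟩ := hlab i hi
    refine ⟨x, hxi, fun j => ?_⟩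
    have h1 := hσsum x hx j
    have h2 := hσsum a haσ j
    have h3 := hbσ j x hx
    have h4 := hbσ j a haσ
    by_cases hj : j ∈ C
    · have := h1.1 hj
      have := h2.1 hj
      omega
    · have := h1.2 hj
      have := h2.2 hj
      omega
  · exact Or.inl ((hσsum a haσ i).2 hi).le

end Scarf

open Filter Topology in
/-- **Brouwer's fixed point theorem** for the standard simplex. -/
theorem exists_isFixedPt_stdSimplex {I : Type*} [Fintype I] [Nontrivial I]
    {f : stdSimplex ℝ I → stdSimplex ℝ I} (hf : Continuous f) :
    ∃ x, Function.IsFixedPt f x := by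
  classical
  set n : ℝ := (Fintype.card I : ℝ) with hn
  have approx : ∀ k : ℕ, ∃ x : stdSimplex ℝ I, ∀ i, ∃ b : stdSimplex ℝ I,
      dist b x ≤ n * (1 / ((k : ℝ) + 1)) ∧ b.1 i - n * (1 / ((k : ℝ) + 1)) ≤ (f b).1 i := by
    intro k
    have hk : (0 : ℝ) < (k : ℝ) + 1 := by positivity
    have hpt : ∀ a : Scarf.Grid I (k + 1),
        (fun i => (a.1 i : ℝ) / ((k : ℝ) + 1)) ∈ stdSimplex ℝ I := by
      intro a
      refine ⟨fun i => by positivity, ?_⟩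
      have := a.2
      rw [← Finset.sum_div, div_eq_one_iff_eq hk.ne']
      exact_mod_cast this
    let pt : Scarf.Grid I (k + 1) → stdSimplex ℝ I := fun a => ⟨_, hpt a⟩
    have hlab : ∀ a, ∃ i, (pt a).1 i ≤ (f (pt a)).1 i := by
      intro a
      obtain ⟨i, -, hi⟩ := Finset.exists_le_of_sum_le (s := Finset.univ) (f := (pt a).1)
        (g := (f (pt a)).1) Finset.univ_nonempty (by rw [(pt a).2.2, (f (pt a)).2.2])
      exact ⟨i, hi⟩
    choose lab hlab using hlab
    obtain ⟨a, ha⟩ := Scarf.exists_grid_point (k + 1) lab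
    refine ⟨pt a, fun i => ?_⟩
    rcases ha i with hi | ⟨b, hbi, hb⟩
    · refine ⟨pt a, by rw [dist_self]; positivity, ?_⟩
      have h1 : (pt a).1 i ≤ n * (1 / ((k : ℝ) + 1)) := by
        rw [mul_one_div]
        exact div_le_div_of_nonneg_right (by rw [hn]; exact_mod_cast hi) hk.le
      have h2 := (f (pt a)).2.1 i
      linarith
    · refine ⟨pt b, ?_, ?_⟩
      · rw [Subtype.dist_eq, dist_pi_le_iff (by positivity)]
        intro j
        have h1 : ((b.1 j : ℕ) : ℝ) ≤ (a.1 j : ℕ) + n := by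
          rw [hn]; exact_mod_cast (hb j).1
        have h2 : ((a.1 j : ℕ) : ℝ) ≤ (b.1 j : ℕ) + n := by
          rw [hn]; exact_mod_cast (hb j).2
        rw [Real.dist_eq, ← sub_div, abs_div, abs_of_pos hk, mul_one_div]
        refine div_le_div_of_nonneg_right ?_ hk.le
        rw [abs_le]
        constructor <;> linarith
      · have h1 := hlab b
        rw [hbi] at h1
        have : 0 ≤ n * (1 / ((k : ℝ) + 1)) := by positivity
        linarith
  choose x b hdist hle using approx
  have hcoord : ∀ i, Continuous fun y : stdSimplex ℝ I => y.1 i :=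
    fun i => (continuous_apply i).comp continuous_subtype_val
  obtain ⟨z, φ, hφ, hlim⟩ := CompactSpace.tendsto_subseq x
  have hε : Tendsto (fun k : ℕ => n * (1 / (((φ k : ℕ) : ℝ) + 1))) atTop (𝓝 0) := by
    have := (tendsto_one_div_add_atTop_nhds_zero_nat (𝕜 := ℝ)).comp hφ.tendsto_atTop
    simpa using this.const_mul n
  have hzle : ∀ i, z.1 i ≤ (f z).1 i := by
    intro i
    have hbz : Tendsto (fun k => b (φ k) i) atTop (𝓝 z) := by
      refine tendsto_of_tendsto_of_dist hlim ?_
      refine squeeze_zero (fun _ => dist_nonneg) (fun k => ?_) hε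
      rw [dist_comm]
      exact hdist (φ k) i
    have h1 := (((hcoord i).tendsto z).comp hbz).sub hε
    rw [sub_zero] at h1
    exact le_of_tendsto_of_tendsto' h1 ((((hcoord i).comp hf).tendsto z).comp hbz)
      fun k => hle (φ k) i
  refine ⟨z, Subtype.ext ?_⟩
  have hsum : ∑ i, z.1 i = ∑ i, (f z).1 i := by rw [z.2.2, (f z).2.2]
  funext i
  exact ((Finset.sum_eq_sum_iff_of_le fun i _ => hzle i).1 hsum i (Finset.mem_univ i)).symm

/-- A continuous vector field `p` on the simplex with `⟪x, p x⟫ = 0` is nonpositive somewhere. -/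
theorem exists_forall_nonpos_stdSimplex {I : Type*} [Fintype I] [Nontrivial I]
    {p : stdSimplex ℝ I → I → ℝ} (hp : ∀ i, Continuous fun x => p x i)
    (horth : ∀ x, ∑ i, x.1 i * p x i = 0) : ∃ x, ∀ i, p x i ≤ 0 := by
  have hpos : ∀ x, 0 < 1 + ∑ j, max (p x j) 0 := fun x =>
    add_pos_of_pos_of_nonneg one_pos (Finset.sum_nonneg fun j _ => le_max_right _ _)
  have hmem : ∀ x : stdSimplex ℝ I,
      (fun i => (x.1 i + max (p x i) 0) / (1 + ∑ j, max (p x j) 0)) ∈ stdSimplex ℝ I := by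
    intro x
    refine ⟨fun i => div_nonneg (add_nonneg (x.2.1 i) (le_max_right _ _)) (hpos x).le, ?_⟩
    rw [← Finset.sum_div, Finset.sum_add_distrib, x.2.2, div_self (hpos x).ne']
  obtain ⟨x, hx⟩ := exists_isFixedPt_stdSimplex
    (f := fun x => (⟨_, hmem x⟩ : stdSimplex ℝ I)) (by
      refine Continuous.subtype_mk (continuous_pi fun i => ?_) _
      have hmax : ∀ j, Continuous fun x => max (p x j) 0 := fun j => (hp j).max continuous_const
      refine Continuous.div ?_ ?_ fun x => (hpos x).ne'
      · exact ((continuous_apply i).comp continuous_subtype_val).add (hmax i)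
      · exact continuous_const.add (continuous_finsetSum _ fun j _ => hmax j))
  have hfix : ∀ i, max (p x i) 0 = x.1 i * ∑ j, max (p x j) 0 := by
    intro i
    have := congrFun (congrArg Subtype.val hx) i
    simp only at this
    rw [div_eq_iff (hpos x).ne'] at this
    linarith
  obtain ⟨k, hk, hpk⟩ : ∃ k, 0 < x.1 k ∧ p x k ≤ 0 := by
    by_contra! hcon
    obtain ⟨k, -, hk⟩ := Finset.exists_lt_of_sum_lt (s := Finset.univ) (f := fun _ : I => (0 : ℝ))
      (g := x.1) (by simp [x.2.2])
    have : 0 < ∑ i, x.1 i * p x i := Finset.sum_pos' (fun i _ => by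
      rcases (x.2.1 i).eq_or_lt with h | h
      · rw [← h, zero_mul]
      · exact (mul_pos h (hcon i h)).le) ⟨k, Finset.mem_univ k, mul_pos hk (hcon k hk)⟩
    exact this.ne' (horth x)
  have hzero : ∑ j, max (p x j) 0 = 0 := by
    have := hfix k
    rw [max_eq_right hpk] at this
    exact (mul_eq_zero.1 this.symm).resolve_left hk.ne'
  refine ⟨x, fun i => ?_⟩
  have := hfix i
  rw [hzero, mul_zero] at this
  exact max_eq_right_iff.1 this

/-- A **Ky Fan inequality** on a compact space `K` in which convex combinations are replaced by
continuous images of simplices. -/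
theorem exists_forall_nonpos_of_mixture {K : Type*} [TopologicalSpace K] [CompactSpace K]
    [Nonempty K] {φ : K → K → ℝ} (hφ : ∀ τ, Continuous fun σ => φ σ τ)
    (hmix : ∀ (I : Type) [Fintype I] (τ : I → K), ∃ σ : stdSimplex ℝ I → K,
      Continuous σ ∧ ∀ x, ∑ i, x.1 i * φ (σ x) (τ i) = 0) :
    ∃ σ, ∀ τ, φ σ τ ≤ 0 := by
  by_contra! hcon
  obtain ⟨t, ht⟩ := isCompact_univ.elim_finite_subcover (fun τ => {σ | 0 < φ σ τ})
    (fun τ => isOpen_lt continuous_const (hφ τ))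
    (fun σ _ => Set.mem_iUnion.2 (hcon σ))
  obtain ⟨τ₀⟩ : Nonempty K := inferInstance
  let τ : Option (Option (Fin t.card)) → K := fun o =>
    o.elim τ₀ fun o => o.elim τ₀ fun k => (t.equivFin.symm k).1
  obtain ⟨σ, hσ, hzero⟩ := hmix _ τ
  obtain ⟨x, hx⟩ := exists_forall_nonpos_stdSimplex (p := fun x i => φ (σ x) (τ i))
    (fun i => (hφ (τ i)).comp hσ) hzero
  obtain ⟨τ', hτ', hpos⟩ := Set.mem_iUnion₂.1 (ht (Set.mem_univ (σ x)))
  have := hx (some (some (t.equivFin ⟨τ', hτ'⟩)))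
  simp only [τ, Option.elim_some, Equiv.symm_apply_apply] at this
  exact absurd hpos (not_lt.2 this)

namespace MeasureTheory.ProbabilityMeasure

variable {S : Type*} [MeasurableSpace S] {I : Type*} [Fintype I]

/-- The mixture of finitely many probability measures with weights `x`. -/
noncomputable def mixture (τ : I → ProbabilityMeasure S) (x : stdSimplex ℝ I) :
    ProbabilityMeasure S :=
  ⟨∑ k, ENNReal.ofReal (x.1 k) • (τ k : Measure S), ⟨by
    simp only [Measure.coe_finsetSum, Finset.sum_apply, Measure.smul_apply, measure_univ,
      smul_eq_mul, mul_one]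
    rw [← ENNReal.ofReal_sum_of_nonneg fun k _ => x.2.1 k, x.2.2, ENNReal.ofReal_one]⟩⟩

theorem integral_mixture (τ : I → ProbabilityMeasure S) (x : stdSimplex ℝ I) {F : S → ℝ}
    (hF : ∀ k, Integrable F (τ k : Measure S)) :
    ∫ s, F s ∂(mixture τ x : Measure S) = ∑ k, x.1 k * ∫ s, F s ∂(τ k : Measure S) := by
  change ∫ s, F s ∂(∑ k, ENNReal.ofReal (x.1 k) • (τ k : Measure S)) = _
  rw [integral_finsetSum_measure fun k _ => (hF k).smul_measure ENNReal.ofReal_ne_top]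
  refine Finset.sum_congr rfl fun k _ => ?_
  rw [integral_smul_measure, ENNReal.toReal_ofReal (x.2.1 k), smul_eq_mul]

theorem continuous_mixture [TopologicalSpace S] [OpensMeasurableSpace S]
    (τ : I → ProbabilityMeasure S) : Continuous (mixture τ) := by
  rw [continuous_iff_continuousAt]
  intro x
  rw [ContinuousAt, tendsto_iff_forall_integral_tendsto]
  intro F
  simp only [integral_mixture τ _ fun k => F.integrable _]
  exact ((continuous_finsetSum _ fun k _ =>
    ((continuous_apply k).comp continuous_subtype_val).mul continuous_const).tendsto x)

end MeasureTheory.ProbabilityMeasure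

namespace MeasureTheory

theorem Measure.bind_map_eq_map_prod {A B C : Type*} [MeasurableSpace A] [MeasurableSpace B]
    [MeasurableSpace C] (m : Measure A) (μ : Measure B) [SFinite μ] {F : A → B → C}
    (hF : Measurable (Function.uncurry F)) :
    (m.bind fun s => Measure.map (F s) μ) = Measure.map (Function.uncurry F) (m.prod μ) := by
  have hFs : ∀ s, Measurable (F s) := fun s => hF.comp measurable_prodMk_left
  have hmeas : Measurable fun s => Measure.map (F s) μ := by
    refine Measure.measurable_of_measurable_coe _ fun E hE => ?_
    simp only [Measure.map_apply (hFs _) hE]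
    exact measurable_measure_prodMk_left (hF hE)
  ext E hE
  rw [Measure.bind_apply hE hmeas.aemeasurable, Measure.map_apply hF hE,
    Measure.prod_apply (hF hE)]
  exact lintegral_congr fun s => by rw [Measure.map_apply (hFs s) hE]; rfl

end MeasureTheory

namespace SEBEU1

instance (A B : Type) [TopologicalSpace A] [TopologicalSpace B] : BorelSpace C(A, B) := ⟨rfl⟩

variable {N : ℕ} {X0 X U W0 W Y Ξ : Type}
    [MetricSpace X0] [CompactSpace X0] [MetricSpace X] [CompactSpace X]
    [MetricSpace U] [CompactSpace U] [MetricSpace W0] [CompactSpace W0]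
    [MetricSpace W] [CompactSpace W] [MetricSpace Y] [CompactSpace Y]
    [MetricSpace Ξ] [CompactSpace Ξ]
    {f : Fin N → ℕ → X → U → Y → W → X}
    {g : ℕ → X0 → (Fin N → X) → (Fin N → U) → Ξ → Y}
    {f0 : ℕ → X0 → (Fin N → X) → (Fin N → U) → W0 → X0}
    {c : Fin N → ℕ → X → U → Y → ℝ}
    {Sset : ∀ t : ℕ, Set C(Hist X U Y t, U)}

theorem continuous_sysHist
    (hf : ∀ i t, Continuous fun p : X × U × Y × W => f i t p.1 p.2.1 p.2.2.1 p.2.2.2)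
    (hg : ∀ t, Continuous fun p : X0 × (Fin N → X) × (Fin N → U) × Ξ =>
      g t p.1 p.2.1 p.2.2.1 p.2.2.2)
    (hf0 : ∀ t, Continuous fun p : X0 × (Fin N → X) × (Fin N → U) × W0 =>
      f0 t p.1 p.2.1 p.2.2.1 p.2.2.2) (t : ℕ) :
    Continuous fun p : (Fin N → Strat X U Y Sset) × Prim (N := N) X0 X W0 W Ξ =>
      sysHist f g f0 p.1 p.2 t := by
  induction t with
  | zero =>
    simp only [sysHist]
    fun_prop
  | succ t ih =>
    have hx : ∀ i, Continuous fun p : (Fin N → Strat X U Y Sset) × Prim (N := N) X0 X W0 W Ξ =>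
        ((sysHist f g f0 p.1 p.2 t).1 i).1 (Fin.last t) := fun i => by fun_prop
    have hu : ∀ i, Continuous fun p : (Fin N → Strat X U Y Sset) × Prim (N := N) X0 X W0 W Ξ =>
        (p.1 i t).val (((sysHist f g f0 p.1 p.2 t).1 i).1, ((sysHist f g f0 p.1 p.2 t).1 i).2,
          (sysHist f g f0 p.1 p.2 t).2.1) := fun i => by fun_prop
    have hy := (hg t).comp ((ih.snd.snd).prodMk ((continuous_pi hx).prodMk
      ((continuous_pi hu).prodMk (by fun_prop :
        Continuous fun p : (Fin N → Strat X U Y Sset) × Prim (N := N) X0 X W0 W Ξ =>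
          p.2.1.2.2 t))))
    simp only [sysHist]
    refine Continuous.prodMk (continuous_pi fun i => Continuous.prodMk ?_ ?_)
      (Continuous.prodMk ?_ ?_)
    · refine Continuous.finSnoc (A := fun _ => X) (by fun_prop) ?_
      exact (hf i t).comp ((hx i).prodMk ((hu i).prodMk (hy.prodMk (by fun_prop :
        Continuous fun p : (Fin N → Strat X U Y Sset) × Prim (N := N) X0 X W0 W Ξ =>
          (p.2.2 i).2 t))))
    · exact Continuous.finSnoc (A := fun _ => U) (by fun_prop) (hu i)
    · exact Continuous.finSnoc (A := fun _ => Y) (by fun_prop) hy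
    · exact (hf0 t).comp ((ih.snd.snd).prodMk ((continuous_pi hx).prodMk
        ((continuous_pi hu).prodMk (by fun_prop :
          Continuous fun p : (Fin N → Strat X U Y Sset) × Prim (N := N) X0 X W0 W Ξ =>
            p.2.1.2.1 t))))

theorem continuous_yPath
    (hf : ∀ i t, Continuous fun p : X × U × Y × W => f i t p.1 p.2.1 p.2.2.1 p.2.2.2)
    (hg : ∀ t, Continuous fun p : X0 × (Fin N → X) × (Fin N → U) × Ξ =>
      g t p.1 p.2.1 p.2.2.1 p.2.2.2)
    (hf0 : ∀ t, Continuous fun p : X0 × (Fin N → X) × (Fin N → U) × W0 =>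
      f0 t p.1 p.2.1 p.2.2.1 p.2.2.2) :
    Continuous (Function.uncurry (yPath (Sset := Sset) f g f0)) := by
  refine continuous_pi fun t => ?_
  have := continuous_sysHist (Sset := Sset) hf hg hf0 (t + 1)
  exact (continuous_apply (Fin.last t)).comp this.snd.fst

theorem continuous_subjHist
    (hf : ∀ i t, Continuous fun p : X × U × Y × W => f i t p.1 p.2.1 p.2.2.1 p.2.2.2)
    (i : Fin N) (t : ℕ) :
    Continuous fun p : Strat X U Y Sset × (ℕ → Y) × X × (ℕ → W) =>
      subjHist f i p.1 p.2.1 p.2.2 t := by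
  induction t with
  | zero =>
    simp only [subjHist]
    fun_prop
  | succ t ih =>
    have hu : Continuous fun p : Strat X U Y Sset × (ℕ → Y) × X × (ℕ → W) =>
        (p.1 t).val ((subjHist f i p.1 p.2.1 p.2.2 t).1, (subjHist f i p.1 p.2.1 p.2.2 t).2,
          fun k : Fin t => p.2.1 k) := by fun_prop
    simp only [subjHist]
    refine Continuous.prodMk (Continuous.finSnoc (A := fun _ => X) (by fun_prop) ?_)
      (Continuous.finSnoc (A := fun _ => U) (by fun_prop) hu)
    have hx : Continuous fun p : Strat X U Y Sset × (ℕ → Y) × X × (ℕ → W) =>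
      (subjHist f i p.1 p.2.1 p.2.2 t).1 (Fin.last t) := by fun_prop
    exact (hf i t).comp (hx.prodMk (hu.prodMk (Continuous.prodMk
      (by fun_prop : Continuous fun p : Strat X U Y Sset × (ℕ → Y) × X × (ℕ → W) => p.2.1 t)
      (by fun_prop : Continuous fun p : Strat X U Y Sset × (ℕ → Y) × X × (ℕ → W) =>
        p.2.2.2 t))))

variable [MeasurableSpace X0] [BorelSpace X0] [MeasurableSpace X] [BorelSpace X]
    [MeasurableSpace U] [BorelSpace U] [MeasurableSpace W0] [BorelSpace W0]
    [MeasurableSpace W] [BorelSpace W] [MeasurableSpace Y] [BorelSpace Y]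
    [MeasurableSpace Ξ] [BorelSpace Ξ]
    {μ : Measure (Prim (N := N) X0 X W0 W Ξ)} [IsProbabilityMeasure μ]

instance : OpensMeasurableSpace (Fin N → X × (ℕ → W)) := inferInstance

instance : OpensMeasurableSpace (X0 × (ℕ → W0) × (ℕ → Ξ)) := inferInstance

instance : OpensMeasurableSpace (Prim (N := N) X0 X W0 W Ξ) := inferInstance

instance : OpensMeasurableSpace (Strat X U Y Sset) := inferInstance

instance (t : ℕ) : SecondCountableTopology (Hist X U Y t) := inferInstance

instance (t : ℕ) : SecondCountableTopology C(Hist X U Y t, U) := inferInstance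

instance (t : ℕ) : SecondCountableTopology (Sset t) := inferInstance

instance : SecondCountableTopology (Strat X U Y Sset) := inferInstance

instance : OpensMeasurableSpace (Fin N → Strat X U Y Sset) := inferInstance

instance : SecondCountableTopology (Prim (N := N) X0 X W0 W Ξ) := inferInstance

instance : OpensMeasurableSpace
    ((Fin N → Strat X U Y Sset) × Prim (N := N) X0 X W0 W Ξ) := inferInstance

theorem continuous_subjCost
    (hf : ∀ i t, Continuous fun p : X × U × Y × W => f i t p.1 p.2.1 p.2.2.1 p.2.2.2)
    (hc : ∀ i t, Continuous fun p : X × U × Y => c i t p.1 p.2.1 p.2.2)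
    {β : Fin N → ℝ} {cbar : ℝ} (hcb : ∀ i t x u y, |c i t x u y| ≤ cbar)
    (i : Fin N) (hβ0 : 0 ≤ β i) (hβ1 : β i < 1) :
    Continuous fun p : Strat X U Y Sset × (ℕ → Y) => subjCost μ f c β i p.1 p.2 := by
  have hbound : ∀ (t : ℕ) (x : X) (u : U) (y : Y), ‖β i ^ t * c i t x u y‖ ≤ β i ^ t * cbar := by
    intro t x u y
    rw [norm_mul, Real.norm_of_nonneg (pow_nonneg hβ0 t)]
    exact mul_le_mul_of_nonneg_left (hcb i t x u y) (pow_nonneg hβ0 t)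
  have hsum : Summable fun t : ℕ => β i ^ t * cbar :=
    (summable_geometric_of_lt_one hβ0 hβ1).mul_right cbar
  have hcont : Continuous fun p : (Strat X U Y Sset × (ℕ → Y)) × Prim (N := N) X0 X W0 W Ξ =>
      ∑' t : ℕ, β i ^ t * c i t ((subjHist f i p.1.1 p.1.2 (p.2.2 i) t).1 (Fin.last t))
        ((subjHist f i p.1.1 p.1.2 (p.2.2 i) (t + 1)).2 (Fin.last t)) (p.1.2 t) := by
    refine continuous_tsum (fun t => continuous_const.mul ?_) hsum
      fun t p => hbound t _ _ _
    have hh : ∀ t, Continuous fun p : (Strat X U Y Sset × (ℕ → Y)) ×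
        Prim (N := N) X0 X W0 W Ξ => subjHist f i p.1.1 p.1.2 (p.2.2 i) t := fun t =>
      (continuous_subjHist hf i t).comp (by fun_prop : Continuous
        fun p : (Strat X U Y Sset × (ℕ → Y)) × Prim (N := N) X0 X W0 W Ξ =>
          (p.1.1, p.1.2, p.2.2 i))
    have h1 := hh t
    have h2 := hh (t + 1)
    exact (hc i t).comp (((continuous_apply (Fin.last t)).comp h1.fst).prodMk
      (((continuous_apply (Fin.last t)).comp h2.snd).prodMk
        ((continuous_apply t).comp continuous_fst.snd)))
  refine continuous_of_dominated (bound := fun _ => ∑' t : ℕ, β i ^ t * cbar) (fun p => ?_)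
    (fun p => Filter.Eventually.of_forall fun ω =>
      tsum_of_norm_bounded hsum.hasSum fun t => hbound t _ _ _)
    (integrable_const _) (Filter.Eventually.of_forall fun ω => ?_)
  · exact (hcont.comp (Continuous.prodMk_right p)).aestronglyMeasurable
  · exact hcont.comp (Continuous.prodMk_left ω)

/-- The environment law as a probability measure. -/
noncomputable def envProb (μ : Measure (Prim (N := N) X0 X W0 W Ξ)) [IsProbabilityMeasure μ]
    (hy : Continuous (Function.uncurry (yPath (Sset := Sset) f g f0)))
    (γ : Fin N → ProbabilityMeasure (Strat X U Y Sset)) : ProbabilityMeasure (ℕ → Y) :=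
  ((ProbabilityMeasure.pi γ).prod ⟨μ, inferInstance⟩).map hy.measurable.aemeasurable

theorem coe_envProb (hy : Continuous (Function.uncurry (yPath (Sset := Sset) f g f0)))
    (γ : Fin N → ProbabilityMeasure (Strat X U Y Sset)) :
    (envProb μ hy γ : Measure (ℕ → Y)) = envLaw μ f g f0 γ :=
  (Measure.bind_map_eq_map_prod _ μ hy.measurable).symm

theorem continuous_envProb (hy : Continuous (Function.uncurry (yPath (Sset := Sset) f g f0))) :
    Continuous (envProb μ hy) :=
  (ProbabilityMeasure.continuous_map hy).comp (ProbabilityMeasure.continuous_prod.comp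
    (ProbabilityMeasure.continuous_pi.prodMk continuous_const))

variable [CompactSpace (Strat X U Y Sset)]

theorem expSubjCost_eq_integral_prod {β : Fin N → ℝ} {i : Fin N}
    (hJ : Continuous fun p : Strat X U Y Sset × (ℕ → Y) => subjCost μ f c β i p.1 p.2)
    (τ : ProbabilityMeasure (Strat X U Y Sset)) (ζ : ProbabilityMeasure (ℕ → Y)) :
    expSubjCost μ f c β i τ ζ = ∫ p, subjCost μ f c β i p.1 p.2
      ∂(τ.prod ζ : Measure (Strat X U Y Sset × (ℕ → Y))) :=
  (integral_prod _ ((BoundedContinuousFunction.mkOfCompact ⟨_, hJ⟩).integrable _)).symm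

theorem continuous_expSubjCost {β : Fin N → ℝ} {i : Fin N}
    (hJ : Continuous fun p : Strat X U Y Sset × (ℕ → Y) => subjCost μ f c β i p.1 p.2) :
    Continuous fun q : ProbabilityMeasure (Strat X U Y Sset) × ProbabilityMeasure (ℕ → Y) =>
      expSubjCost μ f c β i q.1 q.2 := by
  simp only [expSubjCost_eq_integral_prod hJ]
  exact (ProbabilityMeasure.continuous_integral_boundedContinuousFunction
    (BoundedContinuousFunction.mkOfCompact ⟨_, hJ⟩)).comp ProbabilityMeasure.continuous_prod

theorem expSubjCost_mixture {β : Fin N → ℝ} {i : Fin N}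
    (hJ : Continuous fun p : Strat X U Y Sset × (ℕ → Y) => subjCost μ f c β i p.1 p.2)
    {I : Type} [Fintype I] (τ : I → ProbabilityMeasure (Strat X U Y Sset))
    (x : stdSimplex ℝ I) (ζ : ProbabilityMeasure (ℕ → Y)) :
    expSubjCost μ f c β i (ProbabilityMeasure.mixture τ x) ζ =
      ∑ k, x.1 k * expSubjCost μ f c β i (τ k) ζ :=
  ProbabilityMeasure.integral_mixture τ x fun k =>
    ((BoundedContinuousFunction.mkOfCompact ⟨_, hJ⟩).integrable
      ((τ k).prod ζ : Measure (Strat X U Y Sset × (ℕ → Y)))).integral_prod_left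

end SEBEU1

open SEBEU1 in
/-- under Assumption 3.1, if there are sets of identical DMs (identical
meaning equal best-reply sets against every exogenous environment distribution), there
exists a symmetric SEBEU in mixed strategies: identical DMs use identical strategies. -/
theorem exists_symmetric_SEBEU_mixed
    {N : ℕ}
    (X0 X U W0 W Y Ξ : Type)
    [MetricSpace X0] [CompactSpace X0] [Nonempty X0]
    [MetricSpace X] [CompactSpace X] [Nonempty X]
    [MetricSpace U] [CompactSpace U] [Nonempty U]
    [MetricSpace W0] [CompactSpace W0] [Nonempty W0]
    [MetricSpace W] [CompactSpace W] [Nonempty W]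
    [MetricSpace Y] [CompactSpace Y] [Nonempty Y]
    [MetricSpace Ξ] [CompactSpace Ξ] [Nonempty Ξ]
    [MeasurableSpace X0] [BorelSpace X0] [MeasurableSpace X] [BorelSpace X]
    [MeasurableSpace U] [BorelSpace U] [MeasurableSpace W0] [BorelSpace W0]
    [MeasurableSpace W] [BorelSpace W] [MeasurableSpace Y] [BorelSpace Y]
    [MeasurableSpace Ξ] [BorelSpace Ξ]
    (f : Fin N → ℕ → X → U → Y → W → X)
    (g : ℕ → X0 → (Fin N → X) → (Fin N → U) → Ξ → Y)
    (f0 : ℕ → X0 → (Fin N → X) → (Fin N → U) → W0 → X0)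
    (c : Fin N → ℕ → X → U → Y → ℝ)
    (hf : ∀ i t, Continuous fun p : X × U × Y × W => f i t p.1 p.2.1 p.2.2.1 p.2.2.2)
    (hg : ∀ t, Continuous fun p : X0 × (Fin N → X) × (Fin N → U) × Ξ =>
      g t p.1 p.2.1 p.2.2.1 p.2.2.2)
    (hf0 : ∀ t, Continuous fun p : X0 × (Fin N → X) × (Fin N → U) × W0 =>
      f0 t p.1 p.2.1 p.2.2.1 p.2.2.2)
    (hc : ∀ i t, Continuous fun p : X × U × Y => c i t p.1 p.2.1 p.2.2)
    (Sset : ∀ t : ℕ, Set C(Hist X U Y t, U))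
    (hScpt : ∀ t, IsCompact (Sset t)) (hSne : ∀ t, (Sset t).Nonempty)
    (β : Fin N → ℝ) (cbar βbar : ℝ)
    (hcb : ∀ i t x u y, |c i t x u y| ≤ cbar)
    (hβ0 : ∀ i, 0 ≤ β i) (hβb : ∀ i, β i ≤ βbar) (hβbar : βbar < 1)
    (μ : Measure (Prim (N := N) X0 X W0 W Ξ)) [IsProbabilityMeasure μ] :
    ∃ γ : Fin N → ProbabilityMeasure (Strat X U Y Sset),
      (∀ i : Fin N, ∀ γ' : ProbabilityMeasure (Strat X U Y Sset),
        expSubjCost μ f c β i (γ i) (envLaw μ f g f0 γ) ≤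
          expSubjCost μ f c β i γ' (envLaw μ f g f0 γ)) ∧
      (∀ i j : Fin N,
        (∀ ζ : Measure (ℕ → Y), IsProbabilityMeasure ζ →
          BR (Sset := Sset) μ f c β i ζ = BR (Sset := Sset) μ f c β j ζ) →
        γ i = γ j) := by
  classical
  have : ∀ t, CompactSpace (Sset t) := fun t => isCompact_iff_compactSpace.1 (hScpt t)
  have : ∀ t, Nonempty (Sset t) := fun t => (hSne t).to_subtype
  obtain ⟨s₀⟩ : Nonempty (Strat X U Y Sset) := inferInstance
  have : Nonempty (ProbabilityMeasure (Strat X U Y Sset)) :=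
    ⟨⟨Measure.dirac s₀, inferInstance⟩⟩
  have hJ : ∀ i, Continuous fun p : Strat X U Y Sset × (ℕ → Y) => subjCost μ f c β i p.1 p.2 :=
    fun i => continuous_subjCost hf hc hcb i (hβ0 i) ((hβb i).trans_lt hβbar)
  have hy := continuous_yPath (Sset := Sset) hf hg hf0
  let identical : Setoid (Fin N) :=
    { r := fun i j => ∀ ζ : Measure (ℕ → Y), IsProbabilityMeasure ζ →
        BR (Sset := Sset) μ f c β i ζ = BR (Sset := Sset) μ f c β j ζ
      iseqv := ⟨fun _ _ _ => rfl, fun h ζ hζ => (h ζ hζ).symm,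
        fun h h' ζ hζ => (h ζ hζ).trans (h' ζ hζ)⟩ }
  let rep : Fin N → Fin N := fun i => (Quotient.mk identical i).out
  let env : (Fin N → ProbabilityMeasure (Strat X U Y Sset)) → ProbabilityMeasure (ℕ → Y) :=
    fun σ => envProb μ hy (σ ∘ rep)
  have henv : Continuous env :=
    (continuous_envProb hy).comp (continuous_pi fun i => continuous_apply (rep i))
  obtain ⟨σ, hσ⟩ := exists_forall_nonpos_of_mixture
    (φ := fun σ τ : Fin N → ProbabilityMeasure (Strat X U Y Sset) =>
      ∑ i, (expSubjCost μ f c β i (σ i) (env σ) - expSubjCost μ f c β i (τ i) (env σ)))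
    (fun τ => continuous_finsetSum _ fun i _ =>
      ((continuous_expSubjCost (hJ i)).comp ((continuous_apply i).prodMk henv)).sub
        ((continuous_expSubjCost (hJ i)).comp (continuous_const.prodMk henv)))
    (fun I _ τ => ⟨fun x i => ProbabilityMeasure.mixture (fun k => τ k i) x,
      continuous_pi fun i => ProbabilityMeasure.continuous_mixture _, fun x => by
        simp only [Finset.mul_sum]
        rw [Finset.sum_comm]
        refine Finset.sum_eq_zero fun i _ => ?_
        simp only [mul_sub]
        rw [Finset.sum_sub_distrib, ← Finset.sum_mul, x.2.2, one_mul,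
          ← expSubjCost_mixture (hJ i) (fun k => τ k i) x, sub_self]⟩)
  have hbest : ∀ i, σ i ∈ BR μ f c β i (env σ : Measure (ℕ → Y)) := by
    intro i γ'
    have h := hσ (Function.update σ i γ')
    rw [Finset.sum_eq_single i (fun j _ hj => by rw [Function.update_of_ne hj, sub_self])
      (fun hi => absurd (Finset.mem_univ i) hi), Function.update_self] at h
    linarith
  refine ⟨σ ∘ rep, fun i => ?_, fun i j hij => ?_⟩
  · rw [← coe_envProb hy]
    have hrep : rep i ≈ i := Quotient.exact (Quotient.out_eq (Quotient.mk identical i))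
    have h : σ (rep i) ∈ BR μ f c β i (env σ : Measure (ℕ → Y)) :=
      hrep (env σ) inferInstance ▸ hbest (rep i)
    exact h
  · have hrep : rep i = rep j := congrArg Quotient.out (Quotient.sound (s := identical) hij)
    rw [Function.comp_apply, Function.comp_apply, hrep]
end

section
/- Consider a sequence (G^N)_{N∈ℕ} of games under Assumption 4.1 (large games with aggregate-statistic-driven environment). For every ε > 0 there exists N̄_ε ∈ ℕ such that for all N ≥ N̄_ε, every SEBEU γ^{*,N} = (γ^{1,N},…,γ^{N,N}) in mixed strategies in G^N is also an ε-Nash equilibrium in G^N: for every i ∈ [1,N] and every γ̃^i ∈ Γ^i, E^{γ^{*,N}}[J̄^{i,N}] ≤ E^{(γ̃^i, γ^{−i,N})}[J̄^{i,N}] + ε. -/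
/-
STATEMENT 3.  In large games with aggregate-statistic-driven environment (Assumption 4.1),
every SEBEU in mixed strategies in `G^N` is an `ε`-Nash equilibrium once `N` is large:
for every `ε > 0` there is `N̄_ε` such that for all `N ≥ N̄_ε` and every SEBEU
`γ = (γ¹,…,γᴺ)` of `G^N`, `E^{γ}[J̄^{i,N}] ≤ E^{(γ̃ᶦ, γ^{-i})}[J̄^{i,N}] + ε` for every
DM `i` and every mixed strategy `γ̃ᶦ`.

The model: in `G^N` there are `N` DMs drawn from the countable population `ℕ`; DM `i`
evolves as `x_{t+1}ᶦ = f_tᶦ(x_tᶦ, u_tᶦ, y_t, w_tᶦ)` and incurs the discounted cost with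
stage costs `c_tᶦ`; the environment depends on the players only through the aggregate
statistic `d_t^N(x_t, u_t) ∈ D`: `y_t = g_t(x_t⁰, d_t^N, ξ_t)`,
`x_{t+1}⁰ = f_t⁰(x_t⁰, d_t^N, w_t⁰)`.  All games share the common environment data, and
DM `i`'s individual data `(f i, c i, β i, μloc i)` are the same in every game containing
DM `i`.  Time runs over `ℕ`, subsuming every horizon `T ∈ ℕ ∪ {∞}` of the paper.

Assumption 4.1: Assumption 3.1 (compact metric spaces, continuous dynamics/costs, compact
strategy constraint sets, uniformly bounded costs, discount factors uniformly below one)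
holds in all games, strengthened so that all DMs share the same spaces and strategy sets
and the families `(c_tᶦ)ᵢ`, `(f_tᶦ)ᵢ` are uniformly equicontinuous; the aggregate
statistics have negligible sensitivity (`hd1`) and vanishing single-player influence
(`hd2`); the primitive random variables `ω⁰, ω¹, ω², …` are mutually independent (built
into `jointLaw`, the product measure of `μ0` and the `μloc i`).

An SEBEU of `G^N` is a joint mixed strategy `γ` such that each DM's mixed strategy is a
best reply, among mixed strategies, to the endogenously induced environment distribution
`ζ_γ` treated as an independent exogenous process.
-/

open MeasureTheory

namespace SEBEULarge

/-- Borel σ-algebra on a space of continuous maps. -/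
noncomputable instance instMeasurableSpaceContinuousMap (A B : Type)
    [TopologicalSpace A] [TopologicalSpace B] : MeasurableSpace C(A, B) := borel _

/-- Information of a DM at time `t`. -/
abbrev Hist (X U Y : Type) (t : ℕ) : Type :=
  (Fin (t + 1) → X) × (Fin t → U) × (Fin t → Y)

variable (X U W X0 W0 Ξ Y D : Type)
variable [TopologicalSpace X] [TopologicalSpace U] [TopologicalSpace Y]

/-- The common pure strategy space of every DM (Assumption 4.1). -/
abbrev Strat (Sset : ∀ t : ℕ, Set C(Hist X U Y t, U)) : Type := ∀ t : ℕ, ↥(Sset t)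

/-- Joint history in the game `G^N` at time `t`. -/
abbrev SysHist (N : ℕ) (t : ℕ) : Type :=
  (Fin N → (Fin (t + 1) → X) × (Fin t → U)) × (Fin t → Y) × X0

/-- Environment primitive random variables `ω⁰ = (x₀⁰, (w_t⁰), (ξ_t))`. -/
abbrev Prim0 : Type := X0 × (ℕ → W0) × (ℕ → Ξ)

/-- DM-local primitive random variables `ωᶦ = (x₀ᶦ, (w_tᶦ))`. -/
abbrev PrimLoc : Type := X × (ℕ → W)

variable {X U W X0 W0 Ξ Y D}
variable {Sset : ∀ t : ℕ, Set C(Hist X U Y t, U)}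

/-- Closed-loop joint history in `G^N` under the pure strategy profile `s`:
`u_tᶦ = s_tᶦ(I_tᶦ, Y_{t-1})`, `d_t = d_t^N(x_t, u_t)`, `y_t = g_t(x_t⁰, d_t, ξ_t)`,
`x_{t+1}⁰ = f_t⁰(x_t⁰, d_t, w_t⁰)`, `x_{t+1}ᶦ = f_tᶦ(x_tᶦ, u_tᶦ, y_t, w_tᶦ)`. -/
noncomputable def sysHist
    (f : ℕ → ℕ → X → U → Y → W → X)
    (dstat : (N : ℕ) → ℕ → (Fin N → X) → (Fin N → U) → D)
    (g : ℕ → X0 → D → Ξ → Y) (f0 : ℕ → X0 → D → W0 → X0)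
    {N : ℕ} (s : Fin N → Strat X U Y Sset)
    (ω : Prim0 X0 W0 Ξ × (Fin N → PrimLoc X W)) :
    (t : ℕ) → SysHist X U X0 Y N t
  | 0 => (fun i => (fun _ => (ω.2 i).1, Fin.elim0), Fin.elim0, ω.1.1)
  | t + 1 =>
      let h := sysHist f dstat g f0 s ω t
      let xcur : Fin N → X := fun i => (h.1 i).1 (Fin.last t)
      let u : Fin N → U := fun i => (s i t).val ⟨(h.1 i).1, (h.1 i).2, h.2.1⟩
      let d : D := dstat N t xcur u
      let y : Y := g t h.2.2 d (ω.1.2.2 t)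
      (fun i => (Fin.snoc (h.1 i).1 (f i t (xcur i) (u i) y ((ω.2 i).2 t)),
                 Fin.snoc (h.1 i).2 (u i)),
       Fin.snoc h.2.1 y,
       f0 t h.2.2 d (ω.1.2.1 t))

/-- Realized environment path in `G^N` under the profile `s`. -/
noncomputable def yPath
    (f : ℕ → ℕ → X → U → Y → W → X)
    (dstat : (N : ℕ) → ℕ → (Fin N → X) → (Fin N → U) → D)
    (g : ℕ → X0 → D → Ξ → Y) (f0 : ℕ → X0 → D → W0 → X0)
    {N : ℕ} (s : Fin N → Strat X U Y Sset)
    (ω : Prim0 X0 W0 Ξ × (Fin N → PrimLoc X W)) : ℕ → Y :=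
  fun t => (sysHist f dstat g f0 s ω (t + 1)).2.1 (Fin.last t)

/-- DM `i`'s state–control history under strategy `si` against a fixed deterministic
environment sequence `Z` (independent of `N`). -/
noncomputable def subjHist (f : ℕ → ℕ → X → U → Y → W → X) (i : ℕ)
    (si : Strat X U Y Sset) (Z : ℕ → Y) (ωi : PrimLoc X W) :
    (t : ℕ) → (Fin (t + 1) → X) × (Fin t → U)
  | 0 => (fun _ => ωi.1, Fin.elim0)
  | t + 1 =>
      let h := subjHist f i si Z ωi t
      let u : U := (si t).val ⟨h.1, h.2, fun k : Fin t => Z k⟩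
      (Fin.snoc h.1 (f i t (h.1 (Fin.last t)) u (Z t) (ωi.2 t)), Fin.snoc h.2 u)

section Meas

variable [MeasurableSpace X] [MeasurableSpace U] [MeasurableSpace X0]
    [MeasurableSpace W0] [MeasurableSpace W] [MeasurableSpace Y] [MeasurableSpace Ξ]
variable (μ0 : Measure (Prim0 X0 W0 Ξ)) (μloc : ℕ → Measure (PrimLoc X W))
variable [IsProbabilityMeasure μ0] [∀ i, IsProbabilityMeasure (μloc i)]

/-- Joint law of all primitive random variables in `G^N`: the mutually independent product
of `μ0` and the local laws `μloc i`, `i < N` (Assumption 4.1, Condition 3). -/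
noncomputable def jointLaw (N : ℕ) : Measure (Prim0 X0 W0 Ξ × (Fin N → PrimLoc X W)) :=
  μ0.prod (Measure.pi fun i : Fin N => μloc i)

/-- Subjective cost `Jᶦ(sᶦ, Z)` of DM `i` (the same function in every game containing
DM `i`). -/
noncomputable def subjCost
    (f : ℕ → ℕ → X → U → Y → W → X) (c : ℕ → ℕ → X → U → Y → ℝ) (β : ℕ → ℝ)
    (i : ℕ) (si : Strat X U Y Sset) (Z : ℕ → Y) : ℝ :=
  ∫ ωi, (∑' t : ℕ, β i ^ t *
      c i t ((subjHist f i si Z ωi t).1 (Fin.last t))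
            ((subjHist f i si Z ωi (t + 1)).2 (Fin.last t)) (Z t)) ∂(μloc i)

/-- Expected subjective cost `E^{(γ̃ᶦ, ζ)}[Jᶦ]` of DM `i` under the mixed strategy `γ̃ᶦ`
and an independent exogenous environment distribution `ζ`. -/
noncomputable def expSubjCost
    (f : ℕ → ℕ → X → U → Y → W → X) (c : ℕ → ℕ → X → U → Y → ℝ) (β : ℕ → ℝ)
    (i : ℕ) (γi : ProbabilityMeasure (Strat X U Y Sset)) (ζ : Measure (ℕ → Y)) : ℝ :=
  ∫ si, ∫ Z, subjCost μloc f c β i si Z ∂ζ ∂(γi : Measure (Strat X U Y Sset))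

/-- Environment distribution `ζ_γ` induced endogenously in `G^N` by the joint mixed
strategy `γ`. -/
noncomputable def envLawMixed
    (f : ℕ → ℕ → X → U → Y → W → X)
    (dstat : (N : ℕ) → ℕ → (Fin N → X) → (Fin N → U) → D)
    (g : ℕ → X0 → D → Ξ → Y) (f0 : ℕ → X0 → D → W0 → X0)
    (N : ℕ) (γ : Fin N → ProbabilityMeasure (Strat X U Y Sset)) : Measure (ℕ → Y) :=
  (Measure.pi fun j => (γ j : Measure (Strat X U Y Sset))).bind
    (fun s => Measure.map (yPath f dstat g f0 s) (jointLaw μ0 μloc N))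

/-- Actual (objective) long-term cost `J̄^{i,N}(s)` of DM `i` in `G^N` under the pure
strategy profile `s`. -/
noncomputable def objCost
    (f : ℕ → ℕ → X → U → Y → W → X)
    (dstat : (N : ℕ) → ℕ → (Fin N → X) → (Fin N → U) → D)
    (g : ℕ → X0 → D → Ξ → Y) (f0 : ℕ → X0 → D → W0 → X0)
    (c : ℕ → ℕ → X → U → Y → ℝ) (β : ℕ → ℝ)
    {N : ℕ} (i : Fin N) (s : Fin N → Strat X U Y Sset) : ℝ :=
  ∫ ω, (∑' t : ℕ, β i.val ^ t *
      c i.val t (((sysHist f dstat g f0 s ω t).1 i).1 (Fin.last t))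
                (((sysHist f dstat g f0 s ω (t + 1)).1 i).2 (Fin.last t))
                ((sysHist f dstat g f0 s ω (t + 1)).2.1 (Fin.last t))) ∂(jointLaw μ0 μloc N)

/-- Expected objective cost `E^{γ}[J̄^{i,N}]` of DM `i` in `G^N` under the joint mixed
strategy `γ`. -/
noncomputable def expObjCost
    (f : ℕ → ℕ → X → U → Y → W → X)
    (dstat : (N : ℕ) → ℕ → (Fin N → X) → (Fin N → U) → D)
    (g : ℕ → X0 → D → Ξ → Y) (f0 : ℕ → X0 → D → W0 → X0)
    (c : ℕ → ℕ → X → U → Y → ℝ) (β : ℕ → ℝ)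
    {N : ℕ} (i : Fin N) (γ : Fin N → ProbabilityMeasure (Strat X U Y Sset)) : ℝ :=
  ∫ s, objCost μ0 μloc f dstat g f0 c β i s
    ∂(Measure.pi fun j => (γ j : Measure (Strat X U Y Sset)))

end Meas

end SEBEULarge

namespace SEBEULarge

instance instBorelSpaceContinuousMap (A B : Type)
    [TopologicalSpace A] [TopologicalSpace B] : BorelSpace C(A, B) := ⟨rfl⟩

section Uniform

/-- A series dominated by a fixed summable sequence is small as soon as finitely many of its
terms are small. -/
theorem exists_abs_tsum_le {b : ℕ → ℝ} (hb : Summable b) {ε : ℝ} (hε : 0 < ε) :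
    ∃ T : ℕ, ∃ δ : ℝ, 0 < δ ∧ ∀ a : ℕ → ℝ, (∀ t, |a t| ≤ b t) → (∀ t < T, |a t| ≤ δ) →
      |∑' t, a t| ≤ ε := by
  obtain ⟨T, hT⟩ :=
    ((tendsto_sum_nat_add b).eventually_lt_const (half_pos hε)).exists
  refine ⟨T, ε / 2 / (T + 1), by positivity, fun a hab haT => ?_⟩
  have hsa : Summable fun t => |a t| := hb.of_nonneg_of_le (fun _ => abs_nonneg _) hab
  have habs : |∑' t, a t| ≤ ∑' t, |a t| := by
    simpa [Real.norm_eq_abs] using norm_tsum_le_tsum_norm (f := a) hsa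
  have hhead : ∑ t ∈ Finset.range T, |a t| ≤ ε / 2 := by
    calc ∑ t ∈ Finset.range T, |a t| ≤ ∑ _t ∈ Finset.range T, ε / 2 / (T + 1) :=
          Finset.sum_le_sum fun t ht => haT t (Finset.mem_range.1 ht)
      _ = T * (ε / 2 / (T + 1)) := by simp
      _ = ε / 2 * (T / (T + 1)) := by ring
      _ ≤ ε / 2 * 1 := by
          gcongr
          rw [div_le_one (by positivity)]
          linarith
      _ = ε / 2 := mul_one _
  have htail : ∑' t, |a (t + T)| ≤ ∑' t, b (t + T) :=
    ((summable_nat_add_iff T).2 hsa).tsum_le_tsum (fun t => hab _) ((summable_nat_add_iff T).2 hb)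
  rw [← hsa.sum_add_tsum_nat_add T] at habs
  linarith

/-- A compact set of continuous maps on a compact space is uniformly equicontinuous. -/
theorem exists_dist_apply_lt_of_isCompact {A B : Type} [PseudoMetricSpace A] [CompactSpace A]
    [PseudoMetricSpace B] {K : Set C(A, B)} (hK : IsCompact K) {ε : ℝ} (hε : 0 < ε) :
    ∃ δ : ℝ, 0 < δ ∧ ∀ s ∈ K, ∀ a a' : A, dist a a' < δ → dist (s a) (s a') < ε := by
  have := isCompact_iff_compactSpace.1 hK
  have hcont : Continuous fun p : K × A => p.1.val p.2 := by fun_prop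
  obtain ⟨δ, hδ, h⟩ := Metric.uniformContinuous_iff.1
    (CompactSpace.uniformContinuous_of_continuous hcont) ε hε
  refine ⟨δ, hδ, fun s hs a a' haa => h (a := (⟨s, hs⟩, a)) (b := (⟨s, hs⟩, a')) ?_⟩
  simpa [Prod.dist_eq, hδ] using haa

theorem dist_snoc_lt {A : Type} [PseudoMetricSpace A] {n : ℕ} {p p' : Fin n → A} {a a' : A}
    {ε : ℝ} (hp : dist p p' < ε) (ha : dist a a' < ε) :
    dist (Fin.snoc (α := fun _ => A) p a) (Fin.snoc (α := fun _ => A) p' a') < ε := by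
  have hε : 0 < ε := dist_nonneg.trans_lt ha
  rw [dist_pi_lt_iff hε]
  intro k
  refine Fin.lastCases ?_ (fun k => ?_) k
  · simpa using ha
  · simpa using (dist_pi_lt_iff hε).1 hp k

end Uniform

section Dynamics

variable {X U W X0 W0 Ξ Y D : Type}
  [TopologicalSpace X] [TopologicalSpace U] [TopologicalSpace Y]
  {f : ℕ → ℕ → X → U → Y → W → X}
  {dstat : (N : ℕ) → ℕ → (Fin N → X) → (Fin N → U) → D}
  {g : ℕ → X0 → D → Ξ → Y} {f0 : ℕ → X0 → D → W0 → X0}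
  {Sset : ∀ t : ℕ, Set C(Hist X U Y t, U)}

/-- Discounted cost of DM `i` along a realization of its own disturbances and of the
environment. -/
noncomputable def pathCost
    (f : ℕ → ℕ → X → U → Y → W → X) (c : ℕ → ℕ → X → U → Y → ℝ) (β : ℕ → ℝ)
    (i : ℕ) (si : Strat X U Y Sset) (Z : ℕ → Y) (ωi : PrimLoc X W) : ℝ :=
  ∑' t : ℕ, β i ^ t *
    c i t ((subjHist f i si Z ωi t).1 (Fin.last t))
      ((subjHist f i si Z ωi (t + 1)).2 (Fin.last t)) (Z t)

/-- Along a play of the game, DM `i`'s history is its response to the realized environment. -/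
theorem sysHist_eq {N : ℕ} (s : Fin N → Strat X U Y Sset)
    (ω : Prim0 X0 W0 Ξ × (Fin N → PrimLoc X W)) (t : ℕ) :
    (sysHist f dstat g f0 s ω t).2.1 = (fun k : Fin t => yPath f dstat g f0 s ω k) ∧
    ∀ i, (sysHist f dstat g f0 s ω t).1 i =
      subjHist f i (s i) (yPath f dstat g f0 s ω) (ω.2 i) t := by
  induction t with
  | zero => exact ⟨funext fun k => k.elim0, fun i => rfl⟩
  | succ t ih =>
    have hy : (sysHist f dstat g f0 s ω (t + 1)).2.1 =
        fun k : Fin (t + 1) => yPath f dstat g f0 s ω k := by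
      funext k
      refine Fin.lastCases rfl (fun k => ?_) k
      simpa [sysHist] using congrFun ih.1 k
    refine ⟨hy, fun i => ?_⟩
    have hyt : g t (sysHist f dstat g f0 s ω t).2.2
        (dstat N t (fun i => ((sysHist f dstat g f0 s ω t).1 i).1 (Fin.last t))
          (fun i => (s i t).val ⟨((sysHist f dstat g f0 s ω t).1 i).1,
            ((sysHist f dstat g f0 s ω t).1 i).2, (sysHist f dstat g f0 s ω t).2.1⟩))
        (ω.1.2.2 t) = yPath f dstat g f0 s ω t := by
      simp [yPath, sysHist]
    simp only [sysHist, subjHist, hyt]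
    rw [ih.2 i, ih.1]

end Dynamics

theorem abs_stageCost_le {X U Y : Type} {c : ℕ → ℕ → X → U → Y → ℝ} {β : ℕ → ℝ}
    {cbar βbar : ℝ} (hcb : ∀ i t x u y, |c i t x u y| ≤ cbar)
    (hβ0 : ∀ i, 0 ≤ β i) (hβb : ∀ i, β i ≤ βbar) (i t : ℕ) (x : X) (u : U) (y : Y) :
    |β i ^ t * c i t x u y| ≤ βbar ^ t * cbar := by
  rw [abs_mul, abs_of_nonneg (pow_nonneg (hβ0 i) t)]
  have := hβ0 i
  exact mul_le_mul (pow_le_pow_left₀ this (hβb i) t) (hcb i t x u y) (abs_nonneg _)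
    (pow_nonneg (this.trans (hβb i)) t)

theorem abs_pathCost_le {X U W Y : Type}
    [TopologicalSpace X] [TopologicalSpace U] [TopologicalSpace Y]
    {f : ℕ → ℕ → X → U → Y → W → X} {c : ℕ → ℕ → X → U → Y → ℝ} {β : ℕ → ℝ}
    {Sset : ∀ t : ℕ, Set C(Hist X U Y t, U)}
    {cbar βbar : ℝ} (hcb : ∀ i t x u y, |c i t x u y| ≤ cbar)
    (hβ0 : ∀ i, 0 ≤ β i) (hβb : ∀ i, β i ≤ βbar) (hβbar : βbar < 1)
    (i : ℕ) (si : Strat X U Y Sset) (Z : ℕ → Y) (ωi : PrimLoc X W) :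
    |pathCost f c β i si Z ωi| ≤ ∑' t : ℕ, βbar ^ t * cbar := by
  rw [pathCost, ← Real.norm_eq_abs]
  exact tsum_of_norm_bounded
    ((summable_geometric_of_lt_one ((hβ0 0).trans (hβb 0)) hβbar).mul_right cbar).hasSum
    (fun t => abs_stageCost_le hcb hβ0 hβb i t _ _ _)

/-- A single DM has a vanishing influence on the aggregate statistic. -/
theorem exists_dist_dstat_lt {X U D : Type} [MetricSpace D] [CompactSpace D]
    {dstat : (N : ℕ) → ℕ → (Fin N → X) → (Fin N → U) → D} {t : ℕ}
    (hd2 : Filter.Tendsto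
        (fun N : ℕ => ⨆ (i : Fin N) (x : Fin N → X) (u : Fin N → U)
            (x' : Fin N → X) (u' : Fin N → U)
            (_ : ∀ j : Fin N, j ≠ i → x j = x' j ∧ u j = u' j),
          dist (dstat N t x u) (dstat N t x' u'))
        Filter.atTop (nhds 0)) {ε : ℝ} (hε : 0 < ε) :
    ∃ N₀ : ℕ, ∀ N, N₀ ≤ N → ∀ (i : Fin N) (x : Fin N → X) (u : Fin N → U)
      (x' : Fin N → X) (u' : Fin N → U), (∀ j : Fin N, j ≠ i → x j = x' j ∧ u j = u' j) →
      dist (dstat N t x u) (dstat N t x' u') < ε := by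
  obtain ⟨N₀, hN₀⟩ := Filter.eventually_atTop.1 (hd2.eventually_lt_const hε)
  refine ⟨N₀, fun N hN i x u x' u' hj => lt_of_le_of_lt ?_ (hN₀ N hN)⟩
  set C := Metric.diam (Set.univ : Set D)
  have hC : 0 ≤ C := Metric.diam_nonneg
  have hdC : ∀ a b : D, dist a b ≤ C := fun a b =>
    Metric.dist_le_diam_of_mem isCompact_univ.isBounded (Set.mem_univ a) (Set.mem_univ b)
  have h5 : ∀ (i : Fin N) (x u x' u'),
      (⨆ (_ : ∀ j : Fin N, j ≠ i → x j = x' j ∧ u j = u' j),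
        dist (dstat N t x u) (dstat N t x' u')) ≤ C := fun i x u x' u' =>
    Real.iSup_le (fun _ => hdC _ _) hC
  have h4 := fun (i : Fin N) x u x' => Real.iSup_le (h5 i x u x') hC
  have h3 := fun (i : Fin N) x u => Real.iSup_le (h4 i x u) hC
  have h2 := fun (i : Fin N) x => Real.iSup_le (h3 i x) hC
  have h1 := fun (i : Fin N) => Real.iSup_le (h2 i) hC
  refine le_trans ?_ (le_ciSup ⟨C, Set.forall_mem_range.2 h1⟩ i)
  refine le_trans ?_ (le_ciSup ⟨C, Set.forall_mem_range.2 (h2 i)⟩ x)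
  refine le_trans ?_ (le_ciSup ⟨C, Set.forall_mem_range.2 (h3 i x)⟩ u)
  refine le_trans ?_ (le_ciSup ⟨C, Set.forall_mem_range.2 (h4 i x u)⟩ x')
  refine le_trans ?_ (le_ciSup ⟨C, Set.forall_mem_range.2 (h5 i x u x')⟩ u')
  rw [ciSup_pos hj]

theorem continuous_dstat {X U D : Type} [MetricSpace X] [MetricSpace U] [MetricSpace D]
    {dstat : (N : ℕ) → ℕ → (Fin N → X) → (Fin N → U) → D} {N t : ℕ}
    (hd1 : ∀ (ε : ℝ), 0 < ε → ∃ δ : ℝ, 0 < δ ∧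
      ∀ (x u x' u'),
        (∀ i : Fin N, dist ((x i, u i) : X × U) (x' i, u' i) < δ) →
        dist (dstat N t x u) (dstat N t x' u') < ε) :
    Continuous fun p : (Fin N → X) × (Fin N → U) => dstat N t p.1 p.2 := by
  refine Metric.continuous_iff.2 fun p ε hε => ?_
  obtain ⟨δ, hδ, h⟩ := hd1 ε hε
  refine ⟨δ, hδ, fun q hq => h _ _ _ _ fun i => ?_⟩
  rw [Prod.dist_eq, max_lt_iff, dist_pi_lt_iff hδ, dist_pi_lt_iff hδ] at hq
  rw [Prod.dist_eq, max_lt_iff]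
  exact ⟨hq.1 i, hq.2 i⟩

section Estimates

variable {X U W X0 W0 Ξ Y D : Type}
  [MetricSpace X] [CompactSpace X] [MetricSpace U] [CompactSpace U]
  [MetricSpace W] [MetricSpace X0] [CompactSpace X0]
  [MetricSpace W0] [CompactSpace W0] [MetricSpace Ξ] [CompactSpace Ξ]
  [MetricSpace Y] [CompactSpace Y] [MetricSpace D] [CompactSpace D]
  {f : ℕ → ℕ → X → U → Y → W → X}
  {dstat : (N : ℕ) → ℕ → (Fin N → X) → (Fin N → U) → D}
  {g : ℕ → X0 → D → Ξ → Y} {f0 : ℕ → X0 → D → W0 → X0}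
  {c : ℕ → ℕ → X → U → Y → ℝ} {β : ℕ → ℝ}
  {Sset : ∀ t : ℕ, Set C(Hist X U Y t, U)}

/-- The state–control history of a DM depends on the environment path uniformly continuously,
with a modulus common to all DMs, strategies and disturbances. -/
theorem exists_dist_subjHist_lt
    (hfEq : ∀ t, UniformEquicontinuous fun (i : ℕ) (p : X × U × Y × W) =>
      f i t p.1 p.2.1 p.2.2.1 p.2.2.2)
    (hScpt : ∀ t, IsCompact (Sset t)) (t : ℕ) {ε : ℝ} (hε : 0 < ε) :
    ∃ δ : ℝ, 0 < δ ∧ ∀ (i : ℕ) (si : Strat X U Y Sset) (Z Z' : ℕ → Y) (ωi : PrimLoc X W),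
      (∀ k < t, dist (Z k) (Z' k) < δ) →
      dist (subjHist f i si Z ωi t) (subjHist f i si Z' ωi t) < ε := by
  induction t generalizing ε with
  | zero =>
    refine ⟨1, one_pos, fun i si Z Z' ωi _ => ?_⟩
    simpa [subjHist] using hε
  | succ t ih =>
    obtain ⟨δf, hδf, hf'⟩ := Metric.uniformEquicontinuous_iff.1 (hfEq t) ε hε
    obtain ⟨δs, hδs, hs'⟩ := exists_dist_apply_lt_of_isCompact (hScpt t) (lt_min hε hδf)
    obtain ⟨δ, hδ, hih⟩ := ih (lt_min hε (lt_min hδf hδs))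
    refine ⟨min δ (min δf δs), lt_min hδ (lt_min hδf hδs), fun i si Z Z' ωi hZ => ?_⟩
    have hh := hih i si Z Z' ωi
      fun k hk => (hZ k (hk.trans t.lt_succ_self)).trans_le (min_le_left _ _)
    have hZt := hZ t t.lt_succ_self
    simp only [subjHist]
    generalize subjHist f i si Z ωi t = h at hh ⊢
    generalize subjHist f i si Z' ωi t = h' at hh ⊢
    simp only [Prod.dist_eq, max_lt_iff] at hh
    simp only [lt_min_iff] at hh hZt
    obtain ⟨⟨h1, h1f, h1s⟩, h2, -, h2s⟩ := hh
    have hu : dist ((si t).val ⟨h.1, h.2, fun k : Fin t => Z k⟩)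
        ((si t).val ⟨h'.1, h'.2, fun k : Fin t => Z' k⟩) < min ε δf := by
      refine hs' _ (si t).2 _ _ ?_
      simp only [Prod.dist_eq, max_lt_iff]
      refine ⟨h1s, h2s, (dist_pi_lt_iff hδs).2 fun k => ?_⟩
      exact ((hZ k (k.2.trans t.lt_succ_self)).trans_le (min_le_right _ _)).trans_le
        (min_le_right _ _)
    rw [lt_min_iff] at hu
    have hx := (dist_pi_lt_iff hδf).1 h1f (Fin.last t)
    simp only [Prod.dist_eq, max_lt_iff]
    refine ⟨dist_snoc_lt h1 ?_, dist_snoc_lt h2 hu.1⟩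
    refine hf' (h.1 (Fin.last t), _, Z t, ωi.2 t) (h'.1 (Fin.last t), _, Z' t, ωi.2 t) ?_ i
    simp only [Prod.dist_eq, max_lt_iff, dist_self]
    exact ⟨hx, hu.2, hZt.2.1, hδf⟩

/-- The discounted cost depends on the environment path uniformly continuously, with a modulus
common to all DMs, strategies and disturbances. -/
theorem exists_abs_pathCost_sub_le
    (hcEq : ∀ t, UniformEquicontinuous fun (i : ℕ) (p : X × U × Y) => c i t p.1 p.2.1 p.2.2)
    (hfEq : ∀ t, UniformEquicontinuous fun (i : ℕ) (p : X × U × Y × W) =>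
      f i t p.1 p.2.1 p.2.2.1 p.2.2.2)
    (hScpt : ∀ t, IsCompact (Sset t)) {cbar βbar : ℝ}
    (hcb : ∀ i t x u y, |c i t x u y| ≤ cbar)
    (hβ0 : ∀ i, 0 ≤ β i) (hβb : ∀ i, β i ≤ βbar) (hβbar : βbar < 1)
    {ε : ℝ} (hε : 0 < ε) :
    ∃ T : ℕ, ∃ δ : ℝ, 0 < δ ∧
      ∀ (i : ℕ) (si : Strat X U Y Sset) (Z Z' : ℕ → Y) (ωi : PrimLoc X W),
      (∀ k < T, dist (Z k) (Z' k) < δ) →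
      |pathCost f c β i si Z ωi - pathCost f c β i si Z' ωi| ≤ ε := by
  have hsum : Summable fun t : ℕ => βbar ^ t * cbar :=
    (summable_geometric_of_lt_one ((hβ0 0).trans (hβb 0)) hβbar).mul_right cbar
  obtain ⟨T, η, hη, hT⟩ := exists_abs_tsum_le (hsum.add hsum) hε
  have key : ∀ t, ∃ δ : ℝ, 0 < δ ∧
      ∀ (i : ℕ) (si : Strat X U Y Sset) (Z Z' : ℕ → Y) (ωi : PrimLoc X W),
      (∀ k < t + 1, dist (Z k) (Z' k) < δ) →
      |β i ^ t * c i t ((subjHist f i si Z ωi t).1 (Fin.last t))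
          ((subjHist f i si Z ωi (t + 1)).2 (Fin.last t)) (Z t) -
        β i ^ t * c i t ((subjHist f i si Z' ωi t).1 (Fin.last t))
          ((subjHist f i si Z' ωi (t + 1)).2 (Fin.last t)) (Z' t)| ≤ η := by
    intro t
    obtain ⟨δc, hδc, hc'⟩ := Metric.uniformEquicontinuous_iff.1 (hcEq t) η hη
    obtain ⟨δ₁, hδ₁, h₁⟩ := exists_dist_subjHist_lt (f := f) hfEq hScpt t hδc
    obtain ⟨δ₂, hδ₂, h₂⟩ := exists_dist_subjHist_lt (f := f) hfEq hScpt (t + 1) hδc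
    refine ⟨min δc (min δ₁ δ₂), lt_min hδc (lt_min hδ₁ hδ₂), fun i si Z Z' ωi hZ => ?_⟩
    have hx := h₁ i si Z Z' ωi fun k hk =>
      (lt_min_iff.1 (lt_min_iff.1 (hZ k (hk.trans t.lt_succ_self))).2).1
    have hu := h₂ i si Z Z' ωi fun k hk => (lt_min_iff.1 (lt_min_iff.1 (hZ k hk)).2).2
    rw [Prod.dist_eq, max_lt_iff] at hx hu
    rw [← mul_sub, abs_mul, abs_of_nonneg (pow_nonneg (hβ0 i) t)]
    have hcc := hc' (_, _, Z t) (_, _, Z' t) (by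
      simp only [Prod.dist_eq, max_lt_iff]
      exact ⟨(dist_pi_lt_iff hδc).1 hx.1 (Fin.last t), (dist_pi_lt_iff hδc).1 hu.2 (Fin.last t),
        (lt_min_iff.1 (hZ t t.lt_succ_self)).1⟩) i
    rw [Real.dist_eq] at hcc
    have hβ1 : β i ^ t ≤ 1 := pow_le_one₀ (hβ0 i) ((hβb i).trans hβbar.le)
    exact (mul_le_of_le_one_left (abs_nonneg _) hβ1).trans hcc.le
  choose δ hδ hkey using key
  obtain ⟨δm, hδm, hmin⟩ : ∃ δm : ℝ, 0 < δm ∧ ∀ t < T, δm ≤ δ t := by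
    clear hT
    induction T with
    | zero => exact ⟨1, one_pos, by simp⟩
    | succ T ih =>
      obtain ⟨δm, h1, h2⟩ := ih
      refine ⟨min δm (δ T), lt_min h1 (hδ T), fun t ht => ?_⟩
      rcases Nat.lt_succ_iff_lt_or_eq.1 ht with h | rfl
      · exact (min_le_left _ _).trans (h2 t h)
      · exact min_le_right _ _
  refine ⟨T, δm, hδm, fun i si Z Z' ωi hZ => ?_⟩
  have hsm : ∀ Z : ℕ → Y, Summable fun t : ℕ => β i ^ t *
      c i t ((subjHist f i si Z ωi t).1 (Fin.last t))
        ((subjHist f i si Z ωi (t + 1)).2 (Fin.last t)) (Z t) := fun Z =>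
    hsum.of_norm_bounded fun t => abs_stageCost_le hcb hβ0 hβb i t _ _ _
  rw [pathCost, pathCost, ← (hsm Z).tsum_sub (hsm Z')]
  refine hT _ (fun t => ?_) fun t ht => ?_
  · exact (abs_sub _ _).trans (add_le_add (abs_stageCost_le hcb hβ0 hβb i t _ _ _)
      (abs_stageCost_le hcb hβ0 hβb i t _ _ _))
  · exact hkey t i si Z Z' ωi fun k hk => (hZ k (by omega)).trans_le (hmin t ht)

/-- A single DM has a vanishing influence on the environment and on the other DMs. -/
theorem exists_dist_sysHist_lt
    (hg : ∀ t, Continuous fun p : X0 × D × Ξ => g t p.1 p.2.1 p.2.2)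
    (hf0 : ∀ t, Continuous fun p : X0 × D × W0 => f0 t p.1 p.2.1 p.2.2)
    (hfEq : ∀ t, UniformEquicontinuous fun (i : ℕ) (p : X × U × Y × W) =>
      f i t p.1 p.2.1 p.2.2.1 p.2.2.2)
    (hScpt : ∀ t, IsCompact (Sset t))
    (hd1 : ∀ (t : ℕ) (ε : ℝ), 0 < ε → ∃ δ : ℝ, 0 < δ ∧
      ∀ (N : ℕ) (x u x' u'),
        (∀ i : Fin N, dist ((x i, u i) : X × U) (x' i, u' i) < δ) →
        dist (dstat N t x u) (dstat N t x' u') < ε)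
    (hd2 : ∀ (t : ℕ), Filter.Tendsto
        (fun N : ℕ => ⨆ (i : Fin N) (x : Fin N → X) (u : Fin N → U)
            (x' : Fin N → X) (u' : Fin N → U)
            (_ : ∀ j : Fin N, j ≠ i → x j = x' j ∧ u j = u' j),
          dist (dstat N t x u) (dstat N t x' u'))
        Filter.atTop (nhds 0)) (t : ℕ) {ε : ℝ} (hε : 0 < ε) :
    ∃ N₀ : ℕ, ∀ N, N₀ ≤ N → ∀ (i : Fin N) (s s' : Fin N → Strat X U Y Sset)
      (ω ω' : Prim0 X0 W0 Ξ × (Fin N → PrimLoc X W)), (∀ j, j ≠ i → s j = s' j) →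
      ω.1 = ω'.1 → (∀ j, j ≠ i → ω.2 j = ω'.2 j) →
      (∀ j, j ≠ i → dist ((sysHist f dstat g f0 s ω t).1 j)
        ((sysHist f dstat g f0 s' ω' t).1 j) < ε) ∧
      dist (sysHist f dstat g f0 s ω t).2 (sysHist f dstat g f0 s' ω' t).2 < ε := by
  induction t generalizing ε with
  | zero =>
    refine ⟨0, fun N _ i s s' ω ω' _ h0 hloc => ⟨fun j hj => ?_, ?_⟩⟩
    · simpa [sysHist, hloc j hj] using hε
    · simpa [sysHist, h0] using hε
  | succ t ih =>
    obtain ⟨δf, hδf, hf'⟩ := Metric.uniformEquicontinuous_iff.1 (hfEq t) ε hε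
    obtain ⟨δg, hδg, hg'⟩ := Metric.uniformContinuous_iff.1
      (CompactSpace.uniformContinuous_of_continuous (hg t)) (min ε δf) (lt_min hε hδf)
    obtain ⟨δ0, hδ0, hf0'⟩ := Metric.uniformContinuous_iff.1
      (CompactSpace.uniformContinuous_of_continuous (hf0 t)) ε hε
    have hm : 0 < min δg δ0 := lt_min hδg hδ0
    obtain ⟨δd, hδd, hd1'⟩ := hd1 t (min δg δ0 / 2) (half_pos hm)
    obtain ⟨N₁, hN₁⟩ := exists_dist_dstat_lt (hd2 t) (half_pos hm)
    obtain ⟨δs, hδs, hs'⟩ := exists_dist_apply_lt_of_isCompact (hScpt t)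
      (lt_min hε (lt_min hδf hδd))
    obtain ⟨N₂, hN₂⟩ := ih (lt_min hε (lt_min (lt_min hδf hδd) (lt_min hm hδs)))
    refine ⟨max N₁ N₂, fun N hN i s s' ω ω' hss h0 hloc => ?_⟩
    obtain ⟨hh1, hh2⟩ := hN₂ N ((le_max_right _ _).trans hN) i s s' ω ω' hss h0 hloc
    simp only [sysHist]
    generalize sysHist f dstat g f0 s ω t = h at hh1 hh2 ⊢
    generalize sysHist f dstat g f0 s' ω' t = h' at hh1 hh2 ⊢
    simp only [Prod.dist_eq, max_lt_iff] at hh1 hh2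
    simp only [lt_min_iff] at hh1 hh2
    obtain ⟨⟨hy, -, -, hys⟩, -, -, ⟨hx0g, hx00⟩, -⟩ := hh2
    set u : Fin N → U := fun j => (s j t).val ⟨(h.1 j).1, (h.1 j).2, h.2.1⟩ with hu_def
    set u' : Fin N → U := fun j => (s' j t).val ⟨(h'.1 j).1, (h'.1 j).2, h'.2.1⟩ with hu'_def
    set x : Fin N → X := fun j => (h.1 j).1 (Fin.last t)
    set x' : Fin N → X := fun j => (h'.1 j).1 (Fin.last t)
    have hu : ∀ j, j ≠ i → dist (u j) (u' j) < min ε (min δf δd) := by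
      intro j hj
      simp only [hu_def, hu'_def, ← hss j hj]
      refine hs' _ (s j t).2 _ _ ?_
      simp only [Prod.dist_eq, max_lt_iff]
      exact ⟨(hh1 j hj).1.2.2.2, (hh1 j hj).2.2.2.2, hys⟩
    simp only [lt_min_iff] at hu
    have hx : ∀ j, j ≠ i → dist (x j) (x' j) < min δf δd := fun j hj =>
      (dist_le_pi_dist (h.1 j).1 (h'.1 j).1 (Fin.last t)).trans_lt (lt_min (hh1 j hj).1.2.1.1 (hh1 j hj).1.2.1.2)
    simp only [lt_min_iff] at hx
    have hd : dist (dstat N t x u) (dstat N t x' u') < min δg δ0 := by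
      have ha : dist (dstat N t x u)
          (dstat N t (Function.update x' i (x i)) (Function.update u' i (u i))) <
          min δg δ0 / 2 := by
        refine hd1' N _ _ _ _ fun j => ?_
        rcases eq_or_ne j i with rfl | hj
        · simpa using hδd
        · simpa [Function.update_of_ne hj, Prod.dist_eq] using ⟨(hx j hj).2, (hu j hj).2.2⟩
      have hb : dist (dstat N t (Function.update x' i (x i)) (Function.update u' i (u i)))
          (dstat N t x' u') < min δg δ0 / 2 := by
        refine hN₁ N ((le_max_left _ _).trans hN) i _ _ _ _ fun j hj => ?_
        simp [Function.update_of_ne hj]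
      exact (dist_triangle _ _ _).trans_lt ((add_lt_add ha hb).trans_eq (add_halves _))
    rw [lt_min_iff] at hd
    have hyt : dist (g t h.2.2 (dstat N t x u) (ω.1.2.2 t))
        (g t h'.2.2 (dstat N t x' u') (ω'.1.2.2 t)) < min ε δf := by
      refine hg' (a := (h.2.2, _, ω.1.2.2 t)) (b := (h'.2.2, _, ω'.1.2.2 t)) ?_
      simp only [Prod.dist_eq, max_lt_iff, h0, dist_self]
      exact ⟨hx0g, hd.1, hδg⟩
    rw [lt_min_iff] at hyt
    refine ⟨fun j hj => ?_, ?_⟩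
    · simp only [Prod.dist_eq, max_lt_iff]
      refine ⟨dist_snoc_lt (hh1 j hj).1.1 ?_, dist_snoc_lt (hh1 j hj).2.1 (hu j hj).1⟩
      refine hf' (x j, u j, _, (ω.2 j).2 t) (x' j, u' j, _, (ω'.2 j).2 t) ?_ j
      simp only [Prod.dist_eq, max_lt_iff, hloc j hj, dist_self]
      exact ⟨(hx j hj).1, (hu j hj).2.1, hyt.2, hδf⟩
    · simp only [Prod.dist_eq, max_lt_iff]
      refine ⟨dist_snoc_lt hy hyt.1, ?_⟩
      refine hf0' (a := (h.2.2, _, ω.1.2.1 t)) (b := (h'.2.2, _, ω'.1.2.1 t)) ?_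
      simp only [Prod.dist_eq, max_lt_iff, h0, dist_self]
      exact ⟨hx00, hd.2, hδ0⟩

/-- A single DM has a vanishing influence on any finite portion of the environment path. -/
theorem exists_dist_yPath_lt
    (hg : ∀ t, Continuous fun p : X0 × D × Ξ => g t p.1 p.2.1 p.2.2)
    (hf0 : ∀ t, Continuous fun p : X0 × D × W0 => f0 t p.1 p.2.1 p.2.2)
    (hfEq : ∀ t, UniformEquicontinuous fun (i : ℕ) (p : X × U × Y × W) =>
      f i t p.1 p.2.1 p.2.2.1 p.2.2.2)
    (hScpt : ∀ t, IsCompact (Sset t))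
    (hd1 : ∀ (t : ℕ) (ε : ℝ), 0 < ε → ∃ δ : ℝ, 0 < δ ∧
      ∀ (N : ℕ) (x u x' u'),
        (∀ i : Fin N, dist ((x i, u i) : X × U) (x' i, u' i) < δ) →
        dist (dstat N t x u) (dstat N t x' u') < ε)
    (hd2 : ∀ (t : ℕ), Filter.Tendsto
        (fun N : ℕ => ⨆ (i : Fin N) (x : Fin N → X) (u : Fin N → U)
            (x' : Fin N → X) (u' : Fin N → U)
            (_ : ∀ j : Fin N, j ≠ i → x j = x' j ∧ u j = u' j),
          dist (dstat N t x u) (dstat N t x' u'))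
        Filter.atTop (nhds 0)) (T : ℕ) {ε : ℝ} (hε : 0 < ε) :
    ∃ N₀ : ℕ, ∀ N, N₀ ≤ N → ∀ (i : Fin N) (s s' : Fin N → Strat X U Y Sset)
      (ω ω' : Prim0 X0 W0 Ξ × (Fin N → PrimLoc X W)), (∀ j, j ≠ i → s j = s' j) →
      ω.1 = ω'.1 → (∀ j, j ≠ i → ω.2 j = ω'.2 j) →
      ∀ k < T, dist (yPath f dstat g f0 s ω k) (yPath f dstat g f0 s' ω' k) < ε := by
  obtain ⟨N₀, hN₀⟩ := exists_dist_sysHist_lt (f := f) hg hf0 hfEq hScpt hd1 hd2 T hε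
  refine ⟨N₀, fun N hN i s s' ω ω' hs h0 hloc k hk => ?_⟩
  have h := (hN₀ N hN i s s' ω ω' hs h0 hloc).2
  rw [Prod.dist_eq, max_lt_iff, (sysHist_eq s ω T).1, (sysHist_eq s' ω' T).1] at h
  exact (dist_pi_lt_iff hε).1 h.1 ⟨k, hk⟩

theorem continuous_subjHist (i : ℕ)
    (hf : ∀ t, Continuous fun p : X × U × Y × W => f i t p.1 p.2.1 p.2.2.1 p.2.2.2) (t : ℕ) :
    Continuous fun p : Strat X U Y Sset × (ℕ → Y) × PrimLoc X W =>
      subjHist f i p.1 p.2.1 p.2.2 t := by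
  induction t with
  | zero =>
    simp only [subjHist]
    fun_prop
  | succ t ih =>
    simp only [subjHist]
    have hu : Continuous fun p : Strat X U Y Sset × (ℕ → Y) × PrimLoc X W =>
        (p.1 t).val ⟨(subjHist f i p.1 p.2.1 p.2.2 t).1, (subjHist f i p.1 p.2.1 p.2.2 t).2,
          fun k : Fin t => p.2.1 k⟩ := by fun_prop
    have hx := (hf t).comp (f := fun p : Strat X U Y Sset × (ℕ → Y) × PrimLoc X W =>
      ((subjHist f i p.1 p.2.1 p.2.2 t).1 (Fin.last t), (p.1 t).val
        ⟨(subjHist f i p.1 p.2.1 p.2.2 t).1, (subjHist f i p.1 p.2.1 p.2.2 t).2,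
          fun k : Fin t => p.2.1 k⟩, p.2.1 t, p.2.2.2 t)) (by fun_prop)
    exact (ih.fst.finSnoc hx).prodMk (ih.snd.finSnoc hu)

theorem continuous_pathCost (i : ℕ)
    (hf : ∀ t, Continuous fun p : X × U × Y × W => f i t p.1 p.2.1 p.2.2.1 p.2.2.2)
    (hc : ∀ t, Continuous fun p : X × U × Y => c i t p.1 p.2.1 p.2.2) {cbar βbar : ℝ}
    (hcb : ∀ i t x u y, |c i t x u y| ≤ cbar)
    (hβ0 : ∀ i, 0 ≤ β i) (hβb : ∀ i, β i ≤ βbar) (hβbar : βbar < 1) :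
    Continuous fun p : Strat X U Y Sset × (ℕ → Y) × PrimLoc X W =>
      pathCost f c β i p.1 p.2.1 p.2.2 := by
  refine continuous_tsum (fun t => ?_)
    ((summable_geometric_of_lt_one ((hβ0 0).trans (hβb 0)) hβbar).mul_right cbar)
    fun t p => abs_stageCost_le hcb hβ0 hβb i t _ _ _
  have h1 := continuous_subjHist (Sset := Sset) i hf t
  have h2 := continuous_subjHist (Sset := Sset) i hf (t + 1)
  exact continuous_const.mul ((hc t).comp (f := fun p : Strat X U Y Sset × (ℕ → Y) ×
    PrimLoc X W => ((subjHist f i p.1 p.2.1 p.2.2 t).1 (Fin.last t),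
      (subjHist f i p.1 p.2.1 p.2.2 (t + 1)).2 (Fin.last t), p.2.1 t)) (by fun_prop))

end Estimates

section Continuity

variable {X U W X0 W0 Ξ Y D : Type}
  [MetricSpace X] [CompactSpace X] [MetricSpace U] [CompactSpace U]
  [MetricSpace W] [MetricSpace X0] [MetricSpace W0] [MetricSpace Ξ]
  [MetricSpace Y] [CompactSpace Y] [MetricSpace D]
  {f : ℕ → ℕ → X → U → Y → W → X}
  {dstat : (N : ℕ) → ℕ → (Fin N → X) → (Fin N → U) → D}
  {g : ℕ → X0 → D → Ξ → Y} {f0 : ℕ → X0 → D → W0 → X0}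
  {Sset : ∀ t : ℕ, Set C(Hist X U Y t, U)}

theorem continuous_sysHist {N : ℕ}
    (hf : ∀ i t, Continuous fun p : X × U × Y × W => f i t p.1 p.2.1 p.2.2.1 p.2.2.2)
    (hg : ∀ t, Continuous fun p : X0 × D × Ξ => g t p.1 p.2.1 p.2.2)
    (hf0 : ∀ t, Continuous fun p : X0 × D × W0 => f0 t p.1 p.2.1 p.2.2)
    (hd : ∀ t, Continuous fun p : (Fin N → X) × (Fin N → U) => dstat N t p.1 p.2) (t : ℕ) :
    Continuous fun p : (Fin N → Strat X U Y Sset) × Prim0 X0 W0 Ξ × (Fin N → PrimLoc X W) =>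
      sysHist f dstat g f0 p.1 p.2 t := by
  induction t with
  | zero =>
    simp only [sysHist]
    fun_prop
  | succ t ih =>
    simp only [sysHist]
    set H := fun p : (Fin N → Strat X U Y Sset) × Prim0 X0 W0 Ξ × (Fin N → PrimLoc X W) =>
      sysHist f dstat g f0 p.1 p.2 t with hH
    have hu : ∀ i, Continuous fun p : (Fin N → Strat X U Y Sset) × Prim0 X0 W0 Ξ × (Fin N → PrimLoc X W) =>
        (p.1 i t).val ⟨((H p).1 i).1, ((H p).1 i).2, (H p).2.1⟩ := fun i => by fun_prop
    have hD := (hd t).comp (f := fun p : (Fin N → Strat X U Y Sset) × Prim0 X0 W0 Ξ × (Fin N → PrimLoc X W) =>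
      (fun i => ((H p).1 i).1 (Fin.last t), fun i =>
      (p.1 i t).val ⟨((H p).1 i).1, ((H p).1 i).2, (H p).2.1⟩)) (by fun_prop)
    have hw : Continuous fun p : (Fin N → Strat X U Y Sset) × Prim0 X0 W0 Ξ ×
        (Fin N → PrimLoc X W) => p.2.1.2.1 t := by fun_prop
    have hξ : Continuous fun p : (Fin N → Strat X U Y Sset) × Prim0 X0 W0 Ξ ×
        (Fin N → PrimLoc X W) => p.2.1.2.2 t := by fun_prop
    have hy := (hg t).comp (ih.snd.snd.prodMk (hD.prodMk hξ))
    refine (continuous_pi fun i => ?_).prodMk ((ih.snd.fst.finSnoc hy).prodMk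
      ((hf0 t).comp (ih.snd.snd.prodMk (hD.prodMk hw))))
    have hi : Continuous fun p => (H p).1 i := by fun_prop
    have hx : Continuous fun p => ((H p).1 i).1 (Fin.last t) := by fun_prop
    exact (hi.fst.finSnoc ((hf i t).comp (hx.prodMk ((hu i).prodMk
      (hy.prodMk (g := fun p => (p.2.2 i).2 t) (by fun_prop)))))).prodMk (hi.snd.finSnoc (hu i))

theorem continuous_yPath {N : ℕ}
    (hf : ∀ i t, Continuous fun p : X × U × Y × W => f i t p.1 p.2.1 p.2.2.1 p.2.2.2)
    (hg : ∀ t, Continuous fun p : X0 × D × Ξ => g t p.1 p.2.1 p.2.2)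
    (hf0 : ∀ t, Continuous fun p : X0 × D × W0 => f0 t p.1 p.2.1 p.2.2)
    (hd : ∀ t, Continuous fun p : (Fin N → X) × (Fin N → U) => dstat N t p.1 p.2) :
    Continuous fun p : (Fin N → Strat X U Y Sset) × Prim0 X0 W0 Ξ × (Fin N → PrimLoc X W) =>
      yPath f dstat g f0 p.1 p.2 :=
  continuous_pi fun t =>
    (continuous_apply _).comp (continuous_sysHist hf hg hf0 hd (t + 1)).snd.fst

end Continuity

section Integration

/-- Resampling one coordinate of a product measure changes the corresponding factor. -/
theorem map_update_prod_pi {ι : Type} [Fintype ι] [DecidableEq ι] {A : Type} [MeasurableSpace A]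
    (ν : ι → Measure A) [∀ j, IsProbabilityMeasure (ν j)] (i : ι) (ν' : Measure A)
    [IsProbabilityMeasure ν'] :
    (ν'.prod (Measure.pi ν)).map (fun p : A × (ι → A) => Function.update p.2 i p.1) =
      Measure.pi (Function.update ν i ν') := by
  have hprob : ∀ j, IsProbabilityMeasure (Function.update ν i ν' j) := fun j => by
    rcases eq_or_ne j i with rfl | hj
    · simpa
    · simpa [Function.update_of_ne hj] using inferInstanceAs (IsProbabilityMeasure (ν j))
  have hmeas : Measurable fun p : A × (ι → A) => Function.update p.2 i p.1 := by
    refine measurable_pi_lambda _ fun j => ?_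
    rcases eq_or_ne j i with rfl | hj
    · simpa using measurable_fst
    · simp only [Function.update_of_ne hj]
      exact (measurable_pi_apply j).comp measurable_snd
  refine (Measure.pi_eq fun B hB => ?_).symm
  rw [Measure.map_apply hmeas (MeasurableSet.univ_pi hB)]
  have hpre : (fun p : A × (ι → A) => Function.update p.2 i p.1) ⁻¹' Set.univ.pi B =
      B i ×ˢ Set.univ.pi (Function.update B i Set.univ) := by
    ext p
    simp only [Set.mem_preimage, Set.mem_pi, Set.mem_univ, true_implies, Set.mem_prod]
    constructor
    · refine fun h => ⟨by simpa using h i, fun j => ?_⟩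
      rcases eq_or_ne j i with rfl | hj
      · simp
      · simpa [Function.update_of_ne hj] using h j
    · rintro ⟨h1, h2⟩ j
      rcases eq_or_ne j i with rfl | hj
      · simpa using h1
      · simpa [Function.update_of_ne hj] using h2 j
  rw [hpre, Measure.prod_prod, Measure.pi_pi, ← Finset.mul_prod_erase _ _ (Finset.mem_univ i),
    ← Finset.mul_prod_erase _ _ (Finset.mem_univ i)]
  simp only [Function.update_self, measure_univ, one_mul]
  congr 1
  refine Finset.prod_congr rfl fun j hj => ?_
  simp [Function.update_of_ne (Finset.ne_of_mem_erase hj)]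

/-- Mixing the images of a measure along a parametrized family of maps. -/
theorem bind_map_eq_map_prod {A B C : Type} [MeasurableSpace A] [MeasurableSpace B]
    [MeasurableSpace C] (P : Measure A) (Q : Measure B) [SFinite Q] {φ : A → B → C}
    (hφ : Measurable (Function.uncurry φ)) :
    P.bind (fun a => Q.map (φ a)) = (P.prod Q).map (Function.uncurry φ) := by
  have hφa : ∀ a, Measurable (φ a) := fun a => hφ.comp measurable_prodMk_left
  have hker : Measurable fun a => Q.map (φ a) := by
    refine Measure.measurable_of_measurable_coe _ fun E hE => ?_
    simp only [Measure.map_apply (hφa _) hE]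
    exact measurable_measure_prodMk_left (hφ hE)
  ext E hE
  rw [Measure.bind_apply hE hker.aemeasurable, Measure.map_apply hφ hE,
    Measure.prod_apply (hφ hE)]
  simp only [Measure.map_apply (hφa _) hE]
  rfl

theorem abs_integral_integral_sub_le {A B : Type} [MeasurableSpace A] [MeasurableSpace B]
    (P : Measure A) (Q : Measure B) [IsProbabilityMeasure P] [IsProbabilityMeasure Q]
    {F G : A → B → ℝ} (hF : Measurable (Function.uncurry F))
    (hG : Measurable (Function.uncurry G)) {C η : ℝ} (hFC : ∀ a b, |F a b| ≤ C)
    (hGC : ∀ a b, |G a b| ≤ C) (hη : ∀ a b, |F a b - G a b| ≤ η) :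
    |∫ a, ∫ b, F a b ∂Q ∂P - ∫ a, ∫ b, G a b ∂Q ∂P| ≤ η := by
  have hFi : Integrable (Function.uncurry F) (P.prod Q) :=
    .of_bound hF.aestronglyMeasurable C (.of_forall fun p => hFC p.1 p.2)
  have hGi : Integrable (Function.uncurry G) (P.prod Q) :=
    .of_bound hG.aestronglyMeasurable C (.of_forall fun p => hGC p.1 p.2)
  rw [integral_integral hFi, integral_integral hGi]
  have hsub := integral_sub hFi hGi
  simp only [Function.uncurry] at hsub
  rw [← hsub, ← Real.norm_eq_abs]
  simpa using norm_integral_le_of_norm_le_const (μ := P.prod Q) (C := η)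
    (f := fun p => F p.1 p.2 - G p.1 p.2) (.of_forall fun p => hη p.1 p.2)

/-- Fubini for a bounded function of four independent variables. -/
theorem integral_integral_prod_eq {A B C E : Type} [MeasurableSpace A] [MeasurableSpace B]
    [MeasurableSpace C] [MeasurableSpace E] (α : Measure A) (P : Measure B) (Q : Measure C)
    (m : Measure E) [IsProbabilityMeasure α] [IsProbabilityMeasure P] [IsProbabilityMeasure Q]
    [IsProbabilityMeasure m] {F : A → B → C → E → ℝ}
    (hF : Measurable fun p : A × B × C × E => F p.1 p.2.1 p.2.2.1 p.2.2.2)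
    {M : ℝ} (hM : ∀ a b x e, |F a b x e| ≤ M) :
    ∫ a, ∫ r, ∫ e, F a r.1 r.2 e ∂m ∂(P.prod Q) ∂α =
      ∫ p, ∫ q, F p.1 p.2 q.2 q.1 ∂(m.prod Q) ∂(α.prod P) := by
  have hleft : Integrable (fun z : (A × B) × (E × C) => F z.1.1 z.1.2 z.2.2 z.2.1)
      ((α.prod P).prod (m.prod Q)) :=
    .of_bound (hF.comp (f := fun z : (A × B) × (E × C) => (z.1.1, z.1.2, z.2.2, z.2.1))
      (by fun_prop)).aestronglyMeasurable M (.of_forall fun z => hM _ _ _ _)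
  rw [integral_prod _ hleft.integral_prod_left]
  refine integral_congr_ae (.of_forall fun a => ?_)
  have hmid : Integrable (fun z : (B × C) × E => F a z.1.1 z.1.2 z.2) ((P.prod Q).prod m) :=
    .of_bound (hF.comp (f := fun z : (B × C) × E => (a, z.1.1, z.1.2, z.2))
      (by fun_prop)).aestronglyMeasurable M (.of_forall fun z => hM _ _ _ _)
  simp only
  rw [integral_prod _ hmid.integral_prod_left]
  refine integral_congr_ae (.of_forall fun b => ?_)
  have hin : Integrable (fun z : E × C => F a b z.2 z.1) (m.prod Q) :=
    .of_bound (hF.comp (f := fun z : E × C => (a, b, z.2, z.1))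
      (by fun_prop)).aestronglyMeasurable M (.of_forall fun z => hM _ _ _ _)
  exact (integral_prod_symm _ hin).symm

end Integration

section JointLaw

variable {X W X0 W0 Ξ : Type} [MeasurableSpace X] [MeasurableSpace W] [MeasurableSpace X0]
  [MeasurableSpace W0] [MeasurableSpace Ξ]
  (μ0 : Measure (Prim0 X0 W0 Ξ)) (μloc : ℕ → Measure (PrimLoc X W))
  [IsProbabilityMeasure μ0] [∀ i, IsProbabilityMeasure (μloc i)]

instance {N : ℕ} : IsProbabilityMeasure (jointLaw μ0 μloc N) := by
  unfold jointLaw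
  infer_instance

/-- The joint law of the primitives is unchanged when the local primitives of one DM are
replaced by an independent copy. -/
theorem map_update_jointLaw {N : ℕ} (i : Fin N) :
    ((μloc i).prod (jointLaw μ0 μloc N)).map
      (fun q : PrimLoc X W × Prim0 X0 W0 Ξ × (Fin N → PrimLoc X W) =>
        (q.2.1, Function.update q.2.2 i q.1)) = jointLaw μ0 μloc N := by
  have hmeas : Measurable fun p : PrimLoc X W × (Fin N → PrimLoc X W) =>
      Function.update p.2 i p.1 := by
    refine measurable_pi_lambda _ fun j => ?_
    rcases eq_or_ne j i with rfl | hj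
    · simpa using measurable_fst
    · simp only [Function.update_of_ne hj]
      fun_prop
  have hpi := map_update_prod_pi (fun j : Fin N => μloc j) i (μloc i)
  rw [Function.update_eq_self i (fun j : Fin N => μloc j)] at hpi
  have hmeas' : Measurable fun q : PrimLoc X W × Prim0 X0 W0 Ξ × (Fin N → PrimLoc X W) =>
      (q.2.1, Function.update q.2.2 i q.1) :=
    measurable_snd.fst.prodMk (hmeas.comp (measurable_fst.prodMk measurable_snd.snd))
  refine (Measure.prod_eq (μ := μ0) (ν := Measure.pi fun j : Fin N => μloc j)
    fun s t hs ht => ?_).symm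
  rw [Measure.map_apply hmeas' (hs.prod ht), Measure.prod_apply (hmeas' (hs.prod ht)), ← hpi,
    Measure.map_apply hmeas ht, Measure.prod_apply (hmeas ht),
    ← lintegral_const_mul' _ _ (measure_ne_top _ _)]
  refine lintegral_congr fun a => ?_
  exact Measure.prod_prod (μ := μ0) (ν := Measure.pi fun j : Fin N => μloc j) s ((fun ω => Function.update ω i a) ⁻¹' t)

end JointLaw

section Comparison

variable {X U W X0 W0 Ξ Y D : Type}
  [MetricSpace X] [CompactSpace X] [MetricSpace U] [CompactSpace U]
  [MetricSpace W] [CompactSpace W] [MetricSpace X0] [CompactSpace X0]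
  [MetricSpace W0] [CompactSpace W0] [MetricSpace Ξ] [CompactSpace Ξ]
  [MetricSpace Y] [CompactSpace Y] [MeasurableSpace X] [BorelSpace X]
  [MeasurableSpace W] [BorelSpace W] [MeasurableSpace X0] [BorelSpace X0]
  [MeasurableSpace W0] [BorelSpace W0] [MeasurableSpace Ξ] [BorelSpace Ξ]
  {f : ℕ → ℕ → X → U → Y → W → X}
  {dstat : (N : ℕ) → ℕ → (Fin N → X) → (Fin N → U) → D}
  {g : ℕ → X0 → D → Ξ → Y} {f0 : ℕ → X0 → D → W0 → X0}
  {c : ℕ → ℕ → X → U → Y → ℝ} {β : ℕ → ℝ}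
  {Sset : ∀ t : ℕ, Set C(Hist X U Y t, U)}
  (μ0 : Measure (Prim0 X0 W0 Ξ)) (μloc : ℕ → Measure (PrimLoc X W))
  [IsProbabilityMeasure μ0] [∀ i, IsProbabilityMeasure (μloc i)]

instance : BorelSpace (Strat X U Y Sset) := inferInstance

instance : SecondCountableTopology (Strat X U Y Sset) := inferInstance

instance : BorelSpace (Prim0 X0 W0 Ξ) := inferInstance

instance : SecondCountableTopology (Prim0 X0 W0 Ξ) := inferInstance

instance : BorelSpace (PrimLoc X W) := inferInstance

instance : SecondCountableTopology (PrimLoc X W) := inferInstance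

/-- The objective cost of DM `i` playing `γ'`, with DM `i`'s own strategy and primitives
separated from a full play of the game under `γ`. -/
theorem expObjCost_update_eq {N : ℕ} (i : Fin N)
    (hy : Continuous fun p : (Fin N → Strat X U Y Sset) × Prim0 X0 W0 Ξ ×
      (Fin N → PrimLoc X W) => yPath f dstat g f0 p.1 p.2)
    (hpc : Continuous fun p : Strat X U Y Sset × (ℕ → Y) × PrimLoc X W =>
      pathCost f c β i p.1 p.2.1 p.2.2)
    (γ : Fin N → ProbabilityMeasure (Strat X U Y Sset))
    (γ' : ProbabilityMeasure (Strat X U Y Sset)) :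
    expObjCost μ0 μloc f dstat g f0 c β i (Function.update γ i γ') =
      ∫ p, ∫ q, pathCost f c β i p.1 (yPath f dstat g f0 (Function.update p.2 i p.1)
          (q.2.1, Function.update q.2.2 i q.1)) q.1
        ∂((μloc i).prod (jointLaw μ0 μloc N))
        ∂((γ' : Measure (Strat X U Y Sset)).prod
          (Measure.pi fun j => (γ j : Measure (Strat X U Y Sset)))) := by
  have hobj : ∀ s : Fin N → Strat X U Y Sset, objCost μ0 μloc f dstat g f0 c β i s =
      ∫ ω, pathCost f c β i (s i) (yPath f dstat g f0 s ω) (ω.2 i) ∂(jointLaw μ0 μloc N) := by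
    intro s
    refine integral_congr_ae (.of_forall fun ω => tsum_congr fun t => ?_)
    simp only [(sysHist_eq s ω _).2, (sysHist_eq s ω _).1]
    rfl
  have hcost : Measurable fun p : (Fin N → Strat X U Y Sset) × Prim0 X0 W0 Ξ ×
      (Fin N → PrimLoc X W) =>
      pathCost f c β i (p.1 i) (yPath f dstat g f0 p.1 p.2) (p.2.2 i) := by
    refine Continuous.measurable (hpc.comp (f := fun p : (Fin N → Strat X U Y Sset) ×
      Prim0 X0 W0 Ξ × (Fin N → PrimLoc X W) =>
        (p.1 i, yPath f dstat g f0 p.1 p.2, p.2.2 i)) ?_)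
    fun_prop
  have hγ : (fun j => ((Function.update γ i γ' j : ProbabilityMeasure (Strat X U Y Sset)) :
      Measure (Strat X U Y Sset))) =
      Function.update (fun j => (γ j : Measure (Strat X U Y Sset))) i γ' := by
    funext j
    rcases eq_or_ne j i with rfl | hj
    · simp
    · simp [Function.update_of_ne hj]
  rw [expObjCost, hγ, ← map_update_prod_pi, integral_map]
  · refine integral_congr_ae (.of_forall fun p => ?_)
    simp only [hobj, Function.update_self]
    conv_lhs => rw [← map_update_jointLaw μ0 μloc i]
    rw [integral_map]
    · simp only [Function.update_self]
    · exact (Continuous.measurable (by fun_prop)).aemeasurable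
    · have hp := hcost.comp (measurable_prodMk_left (x := Function.update p.2 i p.1))
      simp only [Function.comp_def, Function.update_self] at hp
      exact hp.aestronglyMeasurable
  · exact (Continuous.measurable (by fun_prop)).aemeasurable
  · rw [funext hobj]
    exact hcost.stronglyMeasurable.integral_prod_right.aestronglyMeasurable

/-- The subjective cost of DM `i` playing `γ'` against the environment induced by `γ`. -/
theorem expSubjCost_envLawMixed_eq [MeasurableSpace Y] [BorelSpace Y] {N : ℕ} (i : Fin N)
    (hy : Continuous fun p : (Fin N → Strat X U Y Sset) × Prim0 X0 W0 Ξ ×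
      (Fin N → PrimLoc X W) => yPath f dstat g f0 p.1 p.2)
    (hpc : Continuous fun p : Strat X U Y Sset × (ℕ → Y) × PrimLoc X W =>
      pathCost f c β i p.1 p.2.1 p.2.2)
    {C : ℝ} (hC : ∀ (si : Strat X U Y Sset) Z ωi, |pathCost f c β i si Z ωi| ≤ C)
    (γ : Fin N → ProbabilityMeasure (Strat X U Y Sset))
    (γ' : ProbabilityMeasure (Strat X U Y Sset)) :
    expSubjCost μloc f c β i γ' (envLawMixed μ0 μloc f dstat g f0 N γ) =
      ∫ p, ∫ q, pathCost f c β i p.1 (yPath f dstat g f0 p.2 q.2) q.1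
        ∂((μloc i).prod (jointLaw μ0 μloc N))
        ∂((γ' : Measure (Strat X U Y Sset)).prod
          (Measure.pi fun j => (γ j : Measure (Strat X U Y Sset)))) := by
  have henv : envLawMixed μ0 μloc f dstat g f0 N γ =
      ((Measure.pi fun j => (γ j : Measure (Strat X U Y Sset))).prod
        (jointLaw μ0 μloc N)).map (Function.uncurry (yPath f dstat g f0)) :=
    bind_map_eq_map_prod _ _ hy.measurable
  have hF : Continuous fun p : Strat X U Y Sset × (Fin N → Strat X U Y Sset) ×
      (Prim0 X0 W0 Ξ × (Fin N → PrimLoc X W)) × PrimLoc X W =>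
      pathCost f c β i p.1 (yPath f dstat g f0 p.2.1 p.2.2.1) p.2.2.2 := by
    refine hpc.comp (f := fun p : Strat X U Y Sset × (Fin N → Strat X U Y Sset) ×
      (Prim0 X0 W0 Ξ × (Fin N → PrimLoc X W)) × PrimLoc X W =>
        (p.1, yPath f dstat g f0 p.2.1 p.2.2.1, p.2.2.2)) ?_
    fun_prop
  refine Eq.trans ?_ (integral_integral_prod_eq _ _ _ _
    (F := fun si s ω ωi => pathCost f c β i si (yPath f dstat g f0 s ω) ωi)
    hF.measurable fun _ _ _ _ => hC _ _ _)
  rw [expSubjCost, henv]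
  refine integral_congr_ae (.of_forall fun si => ?_)
  refine integral_map hy.measurable.aemeasurable ?_
  have hsub : Measurable fun p : (ℕ → Y) × PrimLoc X W => pathCost f c β i si p.1 p.2 :=
    hpc.measurable.comp measurable_prodMk_left
  exact hsub.stronglyMeasurable.integral_prod_right.aestronglyMeasurable

end Comparison

end SEBEULarge

open SEBEULarge in
theorem sebeu_is_eps_nash_in_large_games
    (X U W X0 W0 Ξ Y D : Type)
    [MetricSpace X] [CompactSpace X] [Nonempty X]
    [MetricSpace U] [CompactSpace U] [Nonempty U]
    [MetricSpace W] [CompactSpace W] [Nonempty W]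
    [MetricSpace X0] [CompactSpace X0] [Nonempty X0]
    [MetricSpace W0] [CompactSpace W0] [Nonempty W0]
    [MetricSpace Ξ] [CompactSpace Ξ] [Nonempty Ξ]
    [MetricSpace Y] [CompactSpace Y] [Nonempty Y]
    [MetricSpace D] [CompactSpace D] [Nonempty D]
    [MeasurableSpace X] [BorelSpace X] [MeasurableSpace U] [BorelSpace U]
    [MeasurableSpace W] [BorelSpace W] [MeasurableSpace X0] [BorelSpace X0]
    [MeasurableSpace W0] [BorelSpace W0] [MeasurableSpace Ξ] [BorelSpace Ξ]
    [MeasurableSpace Y] [BorelSpace Y]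
    (f : ℕ → ℕ → X → U → Y → W → X)
    (dstat : (N : ℕ) → ℕ → (Fin N → X) → (Fin N → U) → D)
    (g : ℕ → X0 → D → Ξ → Y) (f0 : ℕ → X0 → D → W0 → X0)
    (c : ℕ → ℕ → X → U → Y → ℝ) (β : ℕ → ℝ)
    -- Assumption 4.1, Condition 1: Assumption 3.1 in all games, strengthened
    (hf : ∀ i t, Continuous fun p : X × U × Y × W => f i t p.1 p.2.1 p.2.2.1 p.2.2.2)
    (hg : ∀ t, Continuous fun p : X0 × D × Ξ => g t p.1 p.2.1 p.2.2)
    (hf0 : ∀ t, Continuous fun p : X0 × D × W0 => f0 t p.1 p.2.1 p.2.2)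
    (hc : ∀ i t, Continuous fun p : X × U × Y => c i t p.1 p.2.1 p.2.2)
    (hcEq : ∀ t, UniformEquicontinuous fun (i : ℕ) (p : X × U × Y) => c i t p.1 p.2.1 p.2.2)
    (hfEq : ∀ t, UniformEquicontinuous fun (i : ℕ) (p : X × U × Y × W) =>
      f i t p.1 p.2.1 p.2.2.1 p.2.2.2)
    (Sset : ∀ t : ℕ, Set C(Hist X U Y t, U))
    (hScpt : ∀ t, IsCompact (Sset t)) (hSne : ∀ t, (Sset t).Nonempty)
    (cbar βbar : ℝ) (hcb : ∀ i t x u y, |c i t x u y| ≤ cbar)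
    (hβ0 : ∀ i, 0 ≤ β i) (hβb : ∀ i, β i ≤ βbar) (hβbar : βbar < 1)
    -- Assumption 4.1, Condition 2: negligible-impact conditions on the aggregates
    (hd1 : ∀ (t : ℕ) (ε : ℝ), 0 < ε → ∃ δ : ℝ, 0 < δ ∧
      ∀ (N : ℕ) (x u x' u'),
        (∀ i : Fin N, dist ((x i, u i) : X × U) (x' i, u' i) < δ) →
        dist (dstat N t x u) (dstat N t x' u') < ε)
    (hd2 : ∀ (t : ℕ) (ε : ℝ), 0 < ε →
      Filter.Tendsto
        (fun N : ℕ => ⨆ (i : Fin N) (x : Fin N → X) (u : Fin N → U)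
            (x' : Fin N → X) (u' : Fin N → U)
            (_ : ∀ j : Fin N, j ≠ i → x j = x' j ∧ u j = u' j),
          dist (dstat N t x u) (dstat N t x' u'))
        Filter.atTop (nhds 0))
    -- Assumption 4.1, Condition 3: the primitive random variables are mutually
    -- independent (built into `jointLaw`, the product of `μ0` and the `μloc i`)
    (μ0 : Measure (Prim0 X0 W0 Ξ)) (μloc : ℕ → Measure (PrimLoc X W))
    [IsProbabilityMeasure μ0] [∀ i, IsProbabilityMeasure (μloc i)] :
    -- conclusion: every SEBEU in `G^N` is an `ε`-Nash equilibrium for `N ≥ N̄_ε`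
    ∀ ε : ℝ, 0 < ε → ∃ Nbar : ℕ, ∀ N : ℕ, Nbar ≤ N →
      ∀ γ : Fin N → ProbabilityMeasure (Strat X U Y Sset),
        (∀ (i : Fin N) (γ' : ProbabilityMeasure (Strat X U Y Sset)),
          expSubjCost μloc f c β i.val (γ i) (envLawMixed μ0 μloc f dstat g f0 N γ) ≤
            expSubjCost μloc f c β i.val γ' (envLawMixed μ0 μloc f dstat g f0 N γ)) →
        ∀ (i : Fin N) (γ' : ProbabilityMeasure (Strat X U Y Sset)),
          expObjCost μ0 μloc f dstat g f0 c β i γ ≤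
            expObjCost μ0 μloc f dstat g f0 c β i (Function.update γ i γ') + ε := by
  intro ε hε
  obtain ⟨T, δ, hδ, hT⟩ := exists_abs_pathCost_sub_le (f := f) hcEq hfEq hScpt hcb hβ0 hβb hβbar
    (half_pos hε)
  obtain ⟨N₀, hN₀⟩ := exists_dist_yPath_lt (f := f) hg hf0 hfEq hScpt hd1
    (fun t => hd2 t 1 one_pos) T hδ
  refine ⟨N₀, fun N hN γ hγ i γ' => ?_⟩
  have hy := continuous_yPath (Sset := Sset) hf hg hf0
    fun t => continuous_dstat fun ε hε => (hd1 t ε hε).imp fun δ h => ⟨h.1, h.2 N⟩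
  have hpc := continuous_pathCost (Sset := Sset) i (hf i) (hc i) hcb hβ0 hβb hβbar
  have hC := abs_pathCost_le (f := f) (Sset := Sset) hcb hβ0 hβb hβbar
  have key : ∀ γ'' : ProbabilityMeasure (Strat X U Y Sset),
      |expObjCost μ0 μloc f dstat g f0 c β i (Function.update γ i γ'') -
        expSubjCost μloc f c β i γ'' (envLawMixed μ0 μloc f dstat g f0 N γ)| ≤ ε / 2 := by
    intro γ''
    rw [expObjCost_update_eq μ0 μloc i hy hpc, expSubjCost_envLawMixed_eq μ0 μloc i hy hpc (hC i)]
    refine abs_integral_integral_sub_le _ _ ?_ ?_ (fun _ _ => hC _ _ _ _)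
      (fun _ _ => hC _ _ _ _) fun p q => hT _ _ _ _ _ ?_
    · refine (hpc.comp (f := fun z : (Strat X U Y Sset × (Fin N → Strat X U Y Sset)) ×
        PrimLoc X W × Prim0 X0 W0 Ξ × (Fin N → PrimLoc X W) =>
          (z.1.1, yPath f dstat g f0 (Function.update z.1.2 i z.1.1)
            (z.2.2.1, Function.update z.2.2.2 i z.2.1), z.2.1)) ?_).measurable
      fun_prop
    · refine (hpc.comp (f := fun z : (Strat X U Y Sset × (Fin N → Strat X U Y Sset)) ×
        PrimLoc X W × Prim0 X0 W0 Ξ × (Fin N → PrimLoc X W) =>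
          (z.1.1, yPath f dstat g f0 z.1.2 z.2.2, z.2.1)) ?_).measurable
      fun_prop
    · exact hN₀ N hN i _ _ _ _ (fun j hj => Function.update_of_ne hj _ _) rfl
        fun j hj => Function.update_of_ne hj _ _
  have h1 := abs_le.1 (key (γ i))
  have h2 := abs_le.1 (key γ')
  rw [Function.update_eq_self] at h1
  linarith [hγ i γ', h1.2, h2.1]
end
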